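/- arXiv:1208.1509 — 4 statements merged into one kernel-verified Lean document; each statement's English description precedes it below -/
import Mathlib

section
/- Let μ ≤C ν be probability measures on ℝ with finite first moments, with μ atomless, and let c(x,y) = |y−x|. Then there exists exactly one optimal π ∈ Π_M(μ,ν) for c. Moreover π decomposes as π = π_stay + π_go, where π_stay is the image of the measure μ ∧ ν (the setwise infimum of μ and ν) under the map x ↦ (x,x), and π_go is concentrated on graph(T₁) ∪ graph(T₂) for some functions T₁, T₂ : ℝ → ℝ. In particular π is concentrated on a set Γ ⊆ ℝ×ℝ with |{y : (x,y) ∈ Γ}| ≤ 3 for every x ∈ ℝ. -/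
open MeasureTheory Set Filter Topology

noncomputable section

/-- Convex order of finite measures on `ℝ` with finite first moments. -/
def ConvexOrder (μ ν : MeasureTheory.Measure ℝ) : Prop :=
  μ Set.univ = ν Set.univ ∧
  (∫ x, x ∂μ) = (∫ x, x ∂ν) ∧
  ∀ k : ℝ, (∫ x, max (x - k) 0 ∂μ) ≤ ∫ x, max (x - k) 0 ∂ν

/-- Extended convex order: integrals of nonnegative convex functions increase. -/
def ExtConvexOrder (μ ν : MeasureTheory.Measure ℝ) : Prop :=
  ∀ φ : ℝ → ℝ, ConvexOn ℝ Set.univ φ → (∀ x, 0 ≤ φ x) →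
    (∫⁻ x, ENNReal.ofReal (φ x) ∂μ) ≤ ∫⁻ x, ENNReal.ofReal (φ x) ∂ν

/-- `π` is a transport plan with marginals `μ` and `ν`. -/
def IsCoupling (μ ν : MeasureTheory.Measure ℝ) (π : MeasureTheory.Measure (ℝ × ℝ)) : Prop :=
  π.map Prod.fst = μ ∧ π.map Prod.snd = ν

/-- `π ∈ Π_M(μ,ν)`: a coupling satisfying the martingale condition. -/
def IsMartingaleCoupling (μ ν : MeasureTheory.Measure ℝ) (π : MeasureTheory.Measure (ℝ × ℝ)) : Prop :=
  IsCoupling μ ν π ∧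
  ∀ ρ : ℝ → ℝ, Continuous ρ → (∃ M : ℝ, ∀ x, |ρ x| ≤ M) →
    (∫ p : ℝ × ℝ, ρ p.1 * (p.2 - p.1) ∂π) = 0

/-- `S` is the shadow `S^ν(μ)` of `μ` in `ν`. -/
def IsShadow (μ ν S : MeasureTheory.Measure ℝ) : Prop :=
  S ≤ ν ∧ ConvexOrder μ S ∧
  ∀ η : MeasureTheory.Measure ℝ, η ≤ ν → ConvexOrder μ η → ConvexOrder S η

/-- `π` is the left-curtain coupling between `μ` and `ν`. -/
def IsLeftCurtain (μ ν : MeasureTheory.Measure ℝ) (π : MeasureTheory.Measure (ℝ × ℝ)) : Prop :=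
  IsMartingaleCoupling μ ν π ∧
  ∀ x : ℝ, IsShadow (μ.restrict (Set.Iic x)) ν
    (MeasureTheory.Measure.map Prod.snd (π.restrict ((Set.Iic x) ×ˢ (Set.univ : Set ℝ))))

/-- `π` is left-monotone. -/
def IsLeftMonotone (π : MeasureTheory.Measure (ℝ × ℝ)) : Prop :=
  ∃ Γ : Set (ℝ × ℝ), MeasurableSet Γ ∧ π Γᶜ = 0 ∧
    ∀ x x' ym yp y' : ℝ, (x, ym) ∈ Γ → (x, yp) ∈ Γ → (x', y') ∈ Γ →
      x < x' → ym < y' → y' < yp → False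

/-- The sufficient integrability condition on the cost function. -/
def SuffInt (c : ℝ → ℝ → ℝ) (μ ν : MeasureTheory.Measure ℝ) : Prop :=
  ∃ a b : ℝ → ℝ, MeasureTheory.Integrable a μ ∧ MeasureTheory.Integrable b ν ∧
    ∀ x y : ℝ, a x + b y ≤ c x y

/-- `π` is an optimal martingale transport plan (with finite cost) for the cost `c`. -/
def IsOptimalMart (c : ℝ → ℝ → ℝ) (μ ν : MeasureTheory.Measure ℝ)
    (π : MeasureTheory.Measure (ℝ × ℝ)) : Prop :=
  IsMartingaleCoupling μ ν π ∧
  MeasureTheory.Integrable (fun p : ℝ × ℝ => c p.1 p.2) π ∧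
  ∀ π' : MeasureTheory.Measure (ℝ × ℝ), IsMartingaleCoupling μ ν π' →
    MeasureTheory.Integrable (fun p : ℝ × ℝ => c p.1 p.2) π' →
    (∫ p : ℝ × ℝ, c p.1 p.2 ∂π) ≤ ∫ p : ℝ × ℝ, c p.1 p.2 ∂π'

/-! ### Part A: convex order for Lipschitz convex functions -/

def pwl (ψ : ℝ → ℝ) (k s : ℕ → ℝ) : ℕ → ℝ → ℝ
  | 0 => fun x => ψ (k 0) + s 0 * (x - k 0)
  | n + 1 => fun x => pwl ψ k s n x + (s (n + 1) - s n) * max (x - k (n + 1)) 0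

lemma pwl_right (ψ : ℝ → ℝ) (k s : ℕ → ℝ) (hk : Monotone k)
    (hs : ∀ n, s n * (k (n + 1) - k n) = ψ (k (n + 1)) - ψ (k n)) (n : ℕ) (x : ℝ) (hx : k n ≤ x) :
    pwl ψ k s n x = ψ (k n) + s n * (x - k n) := by
  induction n with
  | zero => rfl
  | succ n ih =>
    have h1 : k n ≤ k (n + 1) := hk (Nat.le_succ n)
    simp only [pwl]
    rw [ih (h1.trans hx), max_eq_left (by linarith)]
    have := hs n
    linear_combination this

lemma pwl_left (ψ : ℝ → ℝ) (k s : ℕ → ℝ) (hk : Monotone k) (m n : ℕ) (hmn : m ≤ n) (x : ℝ)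
    (hx : x ≤ k (m + 1)) : pwl ψ k s n x = pwl ψ k s m x := by
  induction n, hmn using Nat.le_induction with
  | base => rfl
  | succ n hmn ih =>
    have h1 : k (m + 1) ≤ k (n + 1) := hk (by omega)
    simp only [pwl]
    rw [ih, max_eq_right (by linarith)]; ring

lemma integrable_call {μ : Measure ℝ} [IsFiniteMeasure μ] (hμ : Integrable (fun x : ℝ => x) μ)
    (a : ℝ) : Integrable (fun x : ℝ => max (x - a) 0) μ :=
  (hμ.sub (integrable_const a)).pos_part

lemma integrable_pwl {μ : Measure ℝ} [IsFiniteMeasure μ] (hμ : Integrable (fun x : ℝ => x) μ)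
    (ψ : ℝ → ℝ) (k s : ℕ → ℝ) (n : ℕ) : Integrable (pwl ψ k s n) μ := by
  induction n with
  | zero => exact (integrable_const _).add ((hμ.sub (integrable_const _)).const_mul _)
  | succ n ih => exact ih.add ((integrable_call hμ _).const_mul _)

lemma pwl_order {μ ν : Measure ℝ} [IsProbabilityMeasure μ] [IsProbabilityMeasure ν]
    (hμ : Integrable (fun x : ℝ => x) μ) (hν : Integrable (fun x : ℝ => x) ν)
    (hord : ConvexOrder μ ν) (ψ : ℝ → ℝ) (k s : ℕ → ℝ) (hs : Monotone s) (n : ℕ) :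
    ∫ x, pwl ψ k s n x ∂μ ≤ ∫ x, pwl ψ k s n x ∂ν := by
  induction n with
  | zero =>
    simp only [pwl]
    have h : ∀ {m : Measure ℝ} [IsProbabilityMeasure m], Integrable (fun x : ℝ => x) m →
        ∫ x, (ψ (k 0) + s 0 * (x - k 0)) ∂m = ψ (k 0) + s 0 * ((∫ x, x ∂m) - k 0) := by
      intro m _ hm
      have h0 : Integrable (fun x : ℝ => x - k 0) m := hm.sub (integrable_const _)
      rw [integral_add (integrable_const _) (h0.const_mul _),
        integral_const_mul, integral_sub hm (integrable_const _)]
      simp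
    rw [h hμ, h hν, hord.2.1]
  | succ n ih =>
    simp only [pwl]
    rw [integral_add (integrable_pwl hμ _ _ _ _) ((integrable_call hμ _).const_mul _),
      integral_add (integrable_pwl hν _ _ _ _) ((integrable_call hν _).const_mul _),
      integral_const_mul, integral_const_mul]
    have h1 := hs (Nat.le_succ n)
    have h2 := hord.2.2 (k (n + 1))
    have := mul_le_mul_of_nonneg_left h2 (sub_nonneg.2 h1)
    simp only [Nat.succ_eq_add_one] at *
    linarith

lemma convexOrder_lip {μ ν : Measure ℝ} [IsProbabilityMeasure μ] [IsProbabilityMeasure ν]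
    (hμ : Integrable (fun x : ℝ => x) μ) (hν : Integrable (fun x : ℝ => x) ν)
    (hord : ConvexOrder μ ν) (ψ : ℝ → ℝ) (hψ : ConvexOn ℝ univ ψ) (K : ℝ)
    (hK : ∀ x y, |ψ x - ψ y| ≤ K * |x - y|) :
    ∫ x, ψ x ∂μ ≤ ∫ x, ψ x ∂ν := by
  have hK0 : 0 ≤ K := by
    have := hK 1 0
    simp at this
    exact (abs_nonneg _).trans this
  have hcont : Continuous ψ := by
    have : LipschitzWith ⟨K, hK0⟩ ψ := by
      apply LipschitzWith.of_dist_le_mul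
      intro x y
      exact hK x y
    exact this.continuous
  -- grid
  let h : ℕ → ℝ := fun N => 1 / ((N : ℝ) + 1)
  have hh : ∀ N, 0 < h N := fun N => by positivity
  have hh1 : ∀ N, h N ≤ 1 := fun N => by
    simp only [h]; rw [div_le_one (by positivity)]; linarith [Nat.cast_nonneg (α := ℝ) N]
  let k : ℕ → ℕ → ℝ := fun N j => -(N : ℝ) + j * h N
  have hkd : ∀ N j, k N (j + 1) - k N j = h N := fun N j => by simp only [k]; push_cast; ring
  have hkm : ∀ N, Monotone (k N) := fun N => monotone_nat_of_le_succ fun j => by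
    linarith [hkd N j, hh N]
  let s : ℕ → ℕ → ℝ := fun N j => (ψ (k N (j + 1)) - ψ (k N j)) / h N
  have hs : ∀ N j, s N j * (k N (j + 1) - k N j) = ψ (k N (j + 1)) - ψ (k N j) := fun N j => by
    rw [hkd]; simp only [s]; field_simp [(hh N).ne']
  have hsm : ∀ N, Monotone (s N) := fun N => monotone_nat_of_le_succ fun j => by
    have := hψ.slope_mono_adjacent (x := k N j) (y := k N (j + 1)) (z := k N (j + 1 + 1))
      (mem_univ _) (mem_univ _) (by linarith [hkd N j, hh N]) (by linarith [hkd N (j + 1), hh N])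
    rw [hkd, hkd] at this
    exact this
  have hsK : ∀ N j, |s N j| ≤ K := fun N j => by
    have := hK (k N (j + 1)) (k N j)
    rw [hkd, abs_of_pos (hh N)] at this
    simp only [s]
    rw [abs_div, abs_of_pos (hh N), div_le_iff₀ (hh N)]
    exact this
  -- last index
  let J : ℕ → ℕ := fun N => 2 * N * (N + 1)
  have hkJ : ∀ N, k N (J N) = N := fun N => by
    simp only [k, J, h]; push_cast; field_simp; ring
  let φ : ℕ → ℝ → ℝ := fun N => pwl ψ (k N) (s N) (J N)
  have hline : ∀ N j x, |ψ (k N j) + s N j * (x - k N j) - ψ x| ≤ 2 * K * |x - k N j| := by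
    intro N j x
    have h1 := hK (k N j) x
    have h2 : |s N j * (x - k N j)| ≤ K * |x - k N j| := by
      rw [abs_mul]; exact mul_le_mul_of_nonneg_right (hsK N j) (abs_nonneg _)
    rw [abs_sub_comm (k N j) x] at h1
    rw [abs_le] at *
    constructor <;> linarith [h1.1, h1.2, h2.1, h2.2]
  have hin : ∀ (N : ℕ) (x : ℝ), |x| ≤ N → |φ N x - ψ x| ≤ 2 * K * h N := by
    intro N x hx
    rw [abs_le] at hx
    -- index of the cell
    let j := ⌊(x + N) / h N⌋₊
    have hnn : 0 ≤ (x + N) / h N := div_nonneg (by linarith) (hh N).le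
    have hj1 : k N j ≤ x := by
      have := Nat.floor_le hnn
      rw [le_div_iff₀ (hh N)] at this
      simp only [k]; linarith
    have hj2 : x ≤ k N (j + 1) := by
      have := (Nat.lt_floor_add_one ((x + N) / h N)).le
      rw [div_le_iff₀ (hh N)] at this
      simp only [k]; push_cast; linarith
    have hjJ : j ≤ J N := by
      by_contra hcon
      push Not at hcon
      have h1 : k N (J N + 1) ≤ k N j := hkm N hcon
      have := hkd N (J N)
      rw [hkJ] at this
      linarith [hh N, hx.2]
    simp only [φ]
    rw [pwl_left ψ _ _ (hkm N) j (J N) hjJ x hj2, pwl_right ψ _ _ (hkm N) (hs N) j x hj1]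
    refine (hline N j x).trans (mul_le_mul_of_nonneg_left ?_ (by positivity))
    rw [abs_of_nonneg (by linarith)]
    linarith [hkd N j]
  have hout : ∀ (N : ℕ) (x : ℝ), |φ N x - ψ x| ≤ 2 * K * (|x| + 1) := by
    intro N x
    by_cases hx : |x| ≤ N
    · refine (hin N x hx).trans (mul_le_mul_of_nonneg_left ?_ (by positivity))
      linarith [hh1 N, abs_nonneg x]
    · push Not at hx
      rcases lt_abs.1 hx with h1 | h1
      · simp only [φ]
        rw [pwl_right ψ _ _ (hkm N) (hs N) (J N) x (by rw [hkJ]; exact h1.le)]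
        refine (hline N _ x).trans (mul_le_mul_of_nonneg_left ?_ (by positivity))
        rw [hkJ, abs_of_nonneg (by linarith)]
        linarith [le_abs_self x, Nat.cast_nonneg (α := ℝ) N]
      · simp only [φ]
        have hk0 : k N 0 = -N := by simp [k]
        rw [pwl_left ψ _ _ (hkm N) 0 (J N) (Nat.zero_le _) x (by
          have := hkd N 0; linarith [hh N])]
        refine (hline N 0 x).trans (mul_le_mul_of_nonneg_left ?_ (by positivity))
        rw [hk0, abs_of_nonpos (by linarith)]
        linarith [neg_le_abs x, Nat.cast_nonneg (α := ℝ) N]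
  have hψb : ∀ x, |ψ x| ≤ |ψ 0| + K * |x| := fun x => by
    have h1 := hK x 0
    rw [sub_zero] at h1
    have h2 := abs_sub_abs_le_abs_sub (ψ x) (ψ 0)
    linarith
  have hlim : ∀ {m : Measure ℝ} [IsProbabilityMeasure m], Integrable (fun x : ℝ => x) m →
      Tendsto (fun N => ∫ x, φ N x ∂m) atTop (𝓝 (∫ x, ψ x ∂m)) := by
    intro m _ hm
    apply tendsto_integral_of_dominated_convergence
      (fun x => 2 * K * (|x| + 1) + (|ψ 0| + K * |x|))
    · exact fun N => (integrable_pwl hm _ _ _ _).aestronglyMeasurable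
    · exact ((hm.abs.add (integrable_const 1)).const_mul _).add
        ((integrable_const _).add (hm.abs.const_mul _))
    · intro N
      refine ae_of_all _ fun x => ?_
      rw [Real.norm_eq_abs]
      have h1 := hout N x
      have h2 := abs_sub_abs_le_abs_sub (φ N x) (ψ x)
      linarith [hψb x]
    · refine ae_of_all _ fun x => ?_
      rw [tendsto_iff_norm_sub_tendsto_zero]
      have hz : Tendsto (fun N => 2 * K * h N) atTop (𝓝 0) := by
        have := (tendsto_one_div_add_atTop_nhds_zero_nat (𝕜 := ℝ)).const_mul (2 * K)
        simpa [h] using this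
      refine squeeze_zero' (Eventually.of_forall fun N => norm_nonneg _) ?_ hz
      obtain ⟨N0, hN0⟩ := exists_nat_ge |x|
      filter_upwards [eventually_ge_atTop N0] with N hN
      exact hin N x (hN0.trans (by exact_mod_cast hN))
  exact le_of_tendsto_of_tendsto' (hlim hμ) (hlim hν) fun N =>
    pwl_order hμ hν hord ψ (k N) (s N) (hsm N) (J N)

/-! ### Part B: existence of an optimal martingale coupling -/

def growthSp : Submodule ℝ (ℝ × ℝ → ℝ) where
  carrier := {F | ∃ C : ℝ, 0 ≤ C ∧ ∀ p : ℝ × ℝ, |F p| ≤ C * (1 + |p.1| + |p.2|)}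
  zero_mem' := ⟨0, le_rfl, fun p => by simp⟩
  add_mem' := by
    rintro F G ⟨C, hC, hF⟩ ⟨D, hD, hG⟩
    refine ⟨C + D, by positivity, fun p => ?_⟩
    have := abs_add_le (F p) (G p)
    simp only [Pi.add_apply]
    linarith [hF p, hG p]
  smul_mem' := by
    rintro c F ⟨C, hC, hF⟩
    refine ⟨|c| * C, by positivity, fun p => ?_⟩
    simp only [Pi.smul_apply, smul_eq_mul, abs_mul]
    rw [mul_assoc]
    exact mul_le_mul_of_nonneg_left (hF p) (abs_nonneg _)

def SuperVals (μ ν : Measure ℝ) (F : ℝ × ℝ → ℝ) : Set ℝ :=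
  {r | ∃ f h ρ : ℝ → ℝ, Integrable f μ ∧ Integrable h ν ∧ Continuous ρ ∧ (∃ M, ∀ x, |ρ x| ≤ M) ∧
    (∀ x y, F (x, y) ≤ f x + h y + ρ x * (y - x)) ∧ r = ∫ x, f x ∂μ + ∫ y, h y ∂ν}

lemma supSet_nonneg {μ ν : Measure ℝ} [IsProbabilityMeasure μ] [IsProbabilityMeasure ν]
    (hμ : Integrable (fun x : ℝ => x) μ) (hν : Integrable (fun x : ℝ => x) ν)
    (hord : ConvexOrder μ ν) (F : ℝ × ℝ → ℝ) (hF : ∀ p, 0 ≤ F p) {r : ℝ}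
    (hr : r ∈ SuperVals μ ν F) : 0 ≤ r := by
  obtain ⟨f, h, ρ, hf, hh, -, ⟨M, hM⟩, hle, rfl⟩ := hr
  let ψ : ℝ → ℝ := fun y => ⨆ x, (-f x - ρ x * (y - x))
  have hbd : ∀ y x, -f x - ρ x * (y - x) ≤ h y := fun y x => by
    have := (hF (x, y)).trans (hle x y); linarith
  have hB : ∀ y, BddAbove (range fun x => (-f x - ρ x * (y - x))) := fun y =>
    ⟨h y, by rintro _ ⟨x, rfl⟩; exact hbd y x⟩
  have hψh : ∀ y, ψ y ≤ h y := fun y => ciSup_le (hbd y)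
  have hψx : ∀ y x, -f x - ρ x * (y - x) ≤ ψ y := fun y x => le_ciSup (hB y) x
  have hψf : ∀ x, -f x ≤ ψ x := fun x => by have := hψx x x; simpa using this
  have hconv : ConvexOn ℝ univ ψ := by
    refine ⟨convex_univ, fun y1 _ y2 _ a b ha hb hab => ?_⟩
    refine ciSup_le fun x => ?_
    have h1 := mul_le_mul_of_nonneg_left (hψx y1 x) ha
    have h2 := mul_le_mul_of_nonneg_left (hψx y2 x) hb
    simp only [smul_eq_mul]
    have hb' : b = 1 - a := by linarith
    subst hb'
    refine le_trans (le_of_eq ?_) (add_le_add h1 h2)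
    ring
  have hlip1 : ∀ x y, ψ x - ψ y ≤ M * |x - y| := fun y1 y2 => by
    rw [sub_le_iff_le_add]
    refine ciSup_le fun x => ?_
    have h1 := hψx y2 x
    have h2 : -(ρ x * (y1 - y2)) ≤ M * |y1 - y2| := by
      refine (neg_le_abs _).trans ?_
      rw [abs_mul]
      exact mul_le_mul_of_nonneg_right (hM x) (abs_nonneg _)
    linarith
  have hlip : ∀ x y, |ψ x - ψ y| ≤ M * |x - y| := fun x y => by
    rw [abs_le]
    have := hlip1 y x
    rw [abs_sub_comm] at this
    exact ⟨by linarith, hlip1 x y⟩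
  have hM0 : 0 ≤ M := (abs_nonneg _).trans (hM 0)
  have hcont : Continuous ψ := by
    have : LipschitzWith ⟨M, hM0⟩ ψ := by
      apply LipschitzWith.of_dist_le_mul
      intro x y
      exact hlip x y
    exact this.continuous
  have hint : ∀ {m : Measure ℝ} [IsProbabilityMeasure m], Integrable (fun x : ℝ => x) m →
      Integrable ψ m := by
    intro m _ hm
    refine Integrable.mono' (g := fun x => |ψ 0| + M * |x|)
      ((integrable_const _).add (hm.abs.const_mul _)) hcont.aestronglyMeasurable
      (ae_of_all _ fun x => ?_)
    have h1 := hlip x 0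
    have h2 := abs_sub_abs_le_abs_sub (ψ x) (ψ 0)
    rw [sub_zero] at h1
    rw [Real.norm_eq_abs]; linarith
  have key := convexOrder_lip hμ hν hord ψ hconv M hlip
  have h1 : ∫ x, -f x ∂μ ≤ ∫ x, ψ x ∂μ := integral_mono hf.neg (hint hμ) hψf
  have h2 : ∫ x, ψ x ∂ν ≤ ∫ x, h x ∂ν := integral_mono (hint hν) hh hψh
  rw [integral_neg] at h1
  linarith

lemma supSet_add {μ ν : Measure ℝ} {F G : ℝ × ℝ → ℝ} {r s : ℝ} (hr : r ∈ SuperVals μ ν F)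
    (hs : s ∈ SuperVals μ ν G) : r + s ∈ SuperVals μ ν (F + G) := by
  obtain ⟨f, h, ρ, hf, hh, hρ, ⟨M, hM⟩, hle, rfl⟩ := hr
  obtain ⟨f', h', ρ', hf', hh', hρ', ⟨M', hM'⟩, hle', rfl⟩ := hs
  refine ⟨fun x => f x + f' x, fun x => h x + h' x, fun x => ρ x + ρ' x, hf.add hf', hh.add hh',
    hρ.add hρ', ⟨M + M', fun x => ?_⟩, fun x y => ?_, ?_⟩
  · exact (abs_add_le _ _).trans (add_le_add (hM x) (hM' x))
  · have := hle x y
    have := hle' x y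
    simp only [Pi.add_apply]
    linarith
  · rw [integral_add hf hf', integral_add hh hh']; ring

lemma supSet_smul {μ ν : Measure ℝ} {F : ℝ × ℝ → ℝ} {r : ℝ} (hr : r ∈ SuperVals μ ν F)
    (c : ℝ) (hc : 0 ≤ c) : c * r ∈ SuperVals μ ν (c • F) := by
  obtain ⟨f, h, ρ, hf, hh, hρ, ⟨M, hM⟩, hle, rfl⟩ := hr
  refine ⟨fun x => c * f x, fun x => c * h x, fun x => c * ρ x, hf.const_mul c, hh.const_mul c,
    continuous_const.mul hρ, ⟨c * M, fun x => ?_⟩, fun x y => ?_, ?_⟩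
  · rw [abs_mul, abs_of_nonneg hc]; exact mul_le_mul_of_nonneg_left (hM x) hc
  · have := mul_le_mul_of_nonneg_left (hle x y) hc
    simp only [Pi.smul_apply, smul_eq_mul]
    linarith
  · rw [integral_const_mul, integral_const_mul]; ring

lemma supSet_growth {μ ν : Measure ℝ} [IsProbabilityMeasure μ] [IsProbabilityMeasure ν]
    (hμ : Integrable (fun x : ℝ => x) μ) (hν : Integrable (fun x : ℝ => x) ν)
    {F : ℝ × ℝ → ℝ} (hF : F ∈ growthSp) : (SuperVals μ ν F).Nonempty := by
  obtain ⟨C, hC, h⟩ := hF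
  refine ⟨_, fun x => C * (1 + |x|), fun y => C * |y|, fun _ => 0,
    ((integrable_const _).add hμ.abs).const_mul _, hν.abs.const_mul _, continuous_const,
    ⟨0, by simp⟩, fun x y => ?_, rfl⟩
  have := (le_abs_self _).trans (h (x, y))
  simp only at this
  linarith

lemma supSet_bdd {μ ν : Measure ℝ} [IsProbabilityMeasure μ] [IsProbabilityMeasure ν]
    (hμ : Integrable (fun x : ℝ => x) μ) (hν : Integrable (fun x : ℝ => x) ν)
    (hord : ConvexOrder μ ν)
    {F : ℝ × ℝ → ℝ} (hF : F ∈ growthSp) : BddBelow (SuperVals μ ν F) := by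
  obtain ⟨s, hs⟩ := supSet_growth hμ hν (growthSp.neg_mem hF)
  refine ⟨-s, fun r hr => ?_⟩
  have := supSet_nonneg hμ hν hord (F + -F) (by simp) (supSet_add hr hs)
  linarith

def costF : ℝ × ℝ → ℝ := fun p => |p.2 - p.1|

lemma costF_mem : costF ∈ growthSp := by
  refine ⟨1, zero_le_one, fun p => ?_⟩
  simp only [costF, abs_abs]
  have := abs_sub p.2 p.1
  linarith

lemma exists_functional {μ ν : Measure ℝ} [IsProbabilityMeasure μ] [IsProbabilityMeasure ν]
    (hμ : Integrable (fun x : ℝ => x) μ) (hν : Integrable (fun x : ℝ => x) ν)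
    (hord : ConvexOrder μ ν) :
    ∃ L : growthSp →ₗ[ℝ] ℝ, (∀ F : growthSp, ∀ r ∈ SuperVals μ ν F, L F ≤ r) ∧
      L ⟨costF, costF_mem⟩ = - sInf (SuperVals μ ν (-costF)) := by
  let N : growthSp → ℝ := fun F => sInf (SuperVals μ ν F)
  have hne : ∀ F : growthSp, (SuperVals μ ν F).Nonempty := fun F => supSet_growth hμ hν F.2
  have hbd : ∀ F : growthSp, BddBelow (SuperVals μ ν F) := fun F => supSet_bdd hμ hν hord F.2
  have Nadd : ∀ F G, N (F + G) ≤ N F + N G := by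
    intro F G
    have : ∀ r ∈ SuperVals μ ν F, ∀ s ∈ SuperVals μ ν G, N (F + G) ≤ r + s := fun r hr s hs =>
      csInf_le (hbd _) (supSet_add hr hs)
    have h1 : ∀ r ∈ SuperVals μ ν F, N (F + G) - r ≤ N G := fun r hr =>
      le_csInf (hne G) fun s hs => by linarith [this r hr s hs]
    have h2 : N (F + G) - N G ≤ N F := le_csInf (hne F) fun r hr => by linarith [h1 r hr]
    linarith
  have Nhom1 : ∀ c : ℝ, 0 < c → ∀ F, N (c • F) ≤ c * N F := by
    intro c hc F
    rw [← div_le_iff₀' hc]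
    refine le_csInf (hne F) fun r hr => ?_
    rw [div_le_iff₀' hc]
    exact csInf_le (hbd _) (supSet_smul hr c hc.le)
  have Nhom : ∀ c : ℝ, 0 < c → ∀ F, N (c • F) = c * N F := by
    intro c hc F
    refine le_antisymm (Nhom1 c hc F) ?_
    have := Nhom1 c⁻¹ (inv_pos.2 hc) (c • F)
    rw [smul_smul, inv_mul_cancel₀ hc.ne', one_smul] at this
    have h2 := mul_le_mul_of_nonneg_left this hc.le
    rwa [← mul_assoc, mul_inv_cancel₀ hc.ne', one_mul] at h2
  have N0 : N 0 = 0 := by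
    have := Nhom 2 (by norm_num) 0
    rw [smul_zero] at this; linarith
  let c : growthSp := ⟨costF, costF_mem⟩
  have hc : c ≠ 0 := by
    intro h
    have := congrArg (fun F : growthSp => (F : ℝ × ℝ → ℝ) (0, 1)) h
    simp [c, costF] at this
  obtain ⟨L, hL1, hL2⟩ := exists_extension_of_le_sublinear
    (LinearPMap.mkSpanSingleton (σ := RingHom.id ℝ) c (-N (-c)) hc) N Nhom Nadd (by
      rintro ⟨x, hx⟩
      obtain ⟨t, rfl⟩ := Submodule.mem_span_singleton.1 hx
      rw [LinearPMap.mkSpanSingleton'_apply]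
      simp only [RingHom.id_apply, smul_eq_mul]
      rcases lt_trichotomy t 0 with ht | ht | ht
      · have := Nhom (-t) (by linarith) (-c)
        rw [smul_neg, neg_smul, neg_neg] at this
        rw [this]; linarith
      · subst ht; simp [N0]
      · rw [Nhom t ht]
        have := Nadd c (-c)
        rw [add_neg_cancel, N0] at this
        exact mul_le_mul_of_nonneg_left (by linarith) ht.le)
  refine ⟨L, fun F r hr => (hL2 F).trans (csInf_le (hbd F) hr), ?_⟩
  have := hL1 ⟨c, Submodule.mem_span_singleton_self c⟩
  exact this.trans (LinearPMap.mkSpanSingleton'_apply_self _ _ _ _)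

def cutR (R x : ℝ) : ℝ := max 0 (min 1 (R + 1 - |x|))

lemma cutR_nonneg (R x : ℝ) : 0 ≤ cutR R x := le_max_left _ _
lemma cutR_le_one (R x : ℝ) : cutR R x ≤ 1 := max_le zero_le_one (min_le_left _ _)
lemma cutR_eq_one {R x : ℝ} (h : |x| ≤ R) : cutR R x = 1 := by
  unfold cutR; rw [min_eq_left (by linarith)]; simp
lemma cutR_eq_zero {R x : ℝ} (h : R + 1 ≤ |x|) : cutR R x = 0 := by
  unfold cutR; rw [max_eq_left]; exact (min_le_right _ _).trans (by linarith)
lemma cutR_cont (R : ℝ) : Continuous (cutR R) := by unfold cutR; fun_prop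

def cut2 (R : ℝ) (p : ℝ × ℝ) : ℝ := cutR R p.1 * cutR R p.2

lemma cut2_nonneg (R : ℝ) (p : ℝ × ℝ) : 0 ≤ cut2 R p :=
  mul_nonneg (cutR_nonneg _ _) (cutR_nonneg _ _)
lemma cut2_le_one (R : ℝ) (p : ℝ × ℝ) : cut2 R p ≤ 1 :=
  mul_le_one₀ (cutR_le_one _ _) (cutR_nonneg _ _) (cutR_le_one _ _)
lemma cut2_cont (R : ℝ) : Continuous (cut2 R) := by
  unfold cut2; exact ((cutR_cont R).comp continuous_fst).mul ((cutR_cont R).comp continuous_snd)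

lemma cut2_compact (R : ℝ) (F : ℝ × ℝ → ℝ) : HasCompactSupport (fun p => F p * cut2 R p) := by
  apply HasCompactSupport.intro (K := Icc (-(R + 1)) (R + 1) ×ˢ Icc (-(R + 1)) (R + 1))
    (isCompact_Icc.prod isCompact_Icc)
  intro p hp
  simp only [mem_prod, mem_Icc, ← abs_le] at hp
  unfold cut2
  by_cases h : |p.1| ≤ R + 1
  · have : ¬ |p.2| ≤ R + 1 := fun h' => hp ⟨h, h'⟩
    rw [cutR_eq_zero (x := p.2) (by linarith)]; simp
  · rw [cutR_eq_zero (x := p.1) (by linarith)]; simp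

lemma growth_mul_cut {F : ℝ × ℝ → ℝ} (hF : F ∈ growthSp) (R : ℝ) :
    (fun p => F p * cut2 R p) ∈ growthSp := by
  obtain ⟨C, hC, h⟩ := hF
  refine ⟨C, hC, fun p => ?_⟩
  rw [abs_mul, abs_of_nonneg (cut2_nonneg R p)]
  exact (mul_le_of_le_one_right (abs_nonneg _) (cut2_le_one _ _)).trans (h p)

def tailF (R x : ℝ) : ℝ := (Iic R)ᶜ.indicator (fun _ => 1 + 2 * |x|) |x|

lemma tailF_tendsto {μ : Measure ℝ} [IsProbabilityMeasure μ]
    (hμ : Integrable (fun x : ℝ => x) μ) :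
    (∀ R, Integrable (tailF R) μ) ∧
    Tendsto (fun n : ℕ => ∫ x, tailF n x ∂μ) atTop (𝓝 0) := by
  have hm : ∀ R, Measurable (tailF R) := fun R => by
    have : tailF R = ({x : ℝ | |x| ≤ R}ᶜ).indicator (fun x => 1 + 2 * |x|) := by
      ext x; simp [tailF, indicator]
    rw [this]
    apply Measurable.indicator (by fun_prop)
    exact (measurableSet_le (by fun_prop) (by fun_prop)).compl
  have hb : ∀ R x, ‖tailF R x‖ ≤ 1 + 2 * |x| := fun R x => by
    have : 0 ≤ 1 + 2 * |x| := by positivity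
    unfold tailF
    by_cases h : |x| ∈ (Iic R)ᶜ
    · rw [indicator_of_mem h, Real.norm_eq_abs, abs_of_nonneg this]
    · rw [indicator_of_notMem h]; simpa using this
  have hi : Integrable (fun x : ℝ => 1 + 2 * |x|) μ :=
    (integrable_const 1).add (hμ.abs.const_mul 2)
  refine ⟨fun R => Integrable.mono' hi (hm R).aestronglyMeasurable (ae_of_all _ (hb R)), ?_⟩
  have := tendsto_integral_of_dominated_convergence (μ := μ) (F := fun n : ℕ => tailF n)
    (f := fun _ => 0) (fun x => 1 + 2 * |x|) (fun n => (hm n).aestronglyMeasurable) hi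
    (fun n => ae_of_all _ (hb n)) (ae_of_all _ fun x => ?_)
  · simpa using this
  · obtain ⟨N, hN⟩ := exists_nat_ge |x|
    refine tendsto_const_nhds.congr' ?_
    filter_upwards [eventually_ge_atTop N] with n hn
    unfold tailF
    rw [indicator_of_notMem]
    simp only [mem_compl_iff, mem_Iic, not_not]
    exact hN.trans (by exact_mod_cast hn)

lemma tail_bound (R : ℝ) (p : ℝ × ℝ) :
    (1 + |p.1| + |p.2|) * (1 - cut2 R p) ≤ tailF R p.1 + tailF R p.2 := by
  have hn : ∀ x, 0 ≤ tailF R x := fun x => by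
    unfold tailF; exact indicator_nonneg (fun _ _ => by positivity) _
  have ht : ∀ x, R < |x| → tailF R x = 1 + 2 * |x| := fun x hx => by
    unfold tailF; rw [indicator_of_mem]; simpa using hx
  have h0 := cut2_nonneg R p
  have h1 := abs_nonneg p.1
  have h2 := abs_nonneg p.2
  have hle : (1 + |p.1| + |p.2|) * (1 - cut2 R p) ≤ (1 + |p.1| + |p.2|) :=
    mul_le_of_le_one_right (by positivity) (by linarith)
  by_cases hx : |p.1| ≤ R
  · by_cases hy : |p.2| ≤ R
    · have : cut2 R p = 1 := by unfold cut2; rw [cutR_eq_one hx, cutR_eq_one hy, one_mul]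
      rw [this]; simp; linarith [hn p.1, hn p.2]
    · push Not at hy
      rw [ht p.2 hy]; linarith [hn p.1]
  · push Not at hx
    by_cases hy : |p.2| ≤ R
    · rw [ht p.1 hx]; linarith [hn p.2]
    · push Not at hy
      rw [ht p.1 hx, ht p.2 hy]; linarith

open scoped CompactlySupported in
lemma exists_rep {μ ν : Measure ℝ} [IsProbabilityMeasure μ] [IsProbabilityMeasure ν]
    (hμ : Integrable (fun x : ℝ => x) μ) (hν : Integrable (fun x : ℝ => x) ν)
    (L : growthSp →ₗ[ℝ] ℝ) (hL : ∀ F : growthSp, ∀ r ∈ SuperVals μ ν F, L F ≤ r) :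
    ∃ π : Measure (ℝ × ℝ), ∀ F : growthSp, Continuous (F : ℝ × ℝ → ℝ) →
      Integrable (F : ℝ × ℝ → ℝ) π ∧ ∫ p, (F : ℝ × ℝ → ℝ) p ∂π = L F := by
  have hpos : ∀ F : growthSp, (∀ p, 0 ≤ (F : ℝ × ℝ → ℝ) p) → 0 ≤ L F := by
    intro F hF
    have := hL (-F) 0 ⟨fun _ => 0, fun _ => 0, fun _ => 0, integrable_const _, integrable_const _,
      continuous_const, ⟨0, by simp⟩, fun x y => by simpa using hF (x, y), by simp⟩
    rw [map_neg] at this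
    linarith
  have hcc : ∀ f : C_c(ℝ × ℝ, ℝ), (f : ℝ × ℝ → ℝ) ∈ growthSp := by
    intro f
    obtain ⟨C, hC⟩ := f.hasCompactSupport.exists_bound_of_continuous f.continuous
    have hC0 : 0 ≤ C := (norm_nonneg _).trans (hC 0)
    refine ⟨C, hC0, fun p => (hC p).trans ?_⟩
    apply le_mul_of_one_le_right hC0
    linarith [abs_nonneg p.1, abs_nonneg p.2]
  let Λ0 : C_c(ℝ × ℝ, ℝ) →ₗ[ℝ] ℝ :=
    { toFun := fun f => L ⟨f, hcc f⟩
      map_add' := fun f g => by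
        rw [← map_add]; rfl
      map_smul' := fun c f => by
        rw [← map_smul]; rfl }
  let Λ : C_c(ℝ × ℝ, ℝ) →ₚ[ℝ] ℝ := PositiveLinearMap.mk₀ Λ0 (fun f hf => hpos _ (fun p => hf p))
  let π := RealRMK.rieszMeasure Λ
  have hΛ : ∀ f : C_c(ℝ × ℝ, ℝ), ∫ p, f p ∂π = L ⟨f, hcc f⟩ := fun f =>
    RealRMK.integral_rieszMeasure Λ f
  have hcut : ∀ (F : growthSp), Continuous (F : ℝ × ℝ → ℝ) → ∀ R,
      Integrable (fun p => (F : ℝ × ℝ → ℝ) p * cut2 R p) π ∧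
      ∫ p, (F : ℝ × ℝ → ℝ) p * cut2 R p ∂π = L ⟨_, growth_mul_cut F.2 R⟩ := by
    intro F hF R
    let f : C_c(ℝ × ℝ, ℝ) := ⟨⟨fun p => (F : ℝ × ℝ → ℝ) p * cut2 R p, hF.mul (cut2_cont R)⟩,
      cut2_compact R F⟩
    exact ⟨f.continuous.integrable_of_hasCompactSupport f.hasCompactSupport, hΛ f⟩
  have hcut1 : ∀ p : ℝ × ℝ, ∃ N : ℕ, ∀ n ≥ N, cut2 n p = 1 := by
    intro p
    obtain ⟨N, hN⟩ := exists_nat_ge (max |p.1| |p.2|)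
    refine ⟨N, fun n hn => ?_⟩
    have hn' : (N : ℝ) ≤ n := by exact_mod_cast hn
    unfold cut2
    rw [cutR_eq_one ((le_max_left _ _).trans (hN.trans hn')),
      cutR_eq_one ((le_max_right _ _).trans (hN.trans hn')), one_mul]
  -- the weight
  let w : ℝ × ℝ → ℝ := fun p => 1 + |p.1| + |p.2|
  have hw0 : ∀ p, 0 ≤ w p := fun p => by positivity
  have hw : w ∈ growthSp := ⟨1, zero_le_one, fun p => by
    rw [abs_of_nonneg (hw0 p), one_mul]⟩
  have hwc : Continuous w := by fun_prop
  have hwi : Integrable w π := by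
    refine ⟨hwc.aestronglyMeasurable, ?_⟩
    rw [hasFiniteIntegral_iff_ofReal (ae_of_all _ hw0)]
    refine lt_of_le_of_lt ?_ (ENNReal.ofReal_lt_top (r := L ⟨w, hw⟩))
    have hF : ∫⁻ p, ENNReal.ofReal (w p) ∂π ≤
        ∫⁻ p, liminf (fun n : ℕ => ENNReal.ofReal (w p * cut2 n p)) atTop ∂π := by
      refine lintegral_mono fun p => ?_
      obtain ⟨N, hN⟩ := hcut1 p
      have : Tendsto (fun n : ℕ => ENNReal.ofReal (w p * cut2 n p)) atTop
          (𝓝 (ENNReal.ofReal (w p))) := by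
        refine tendsto_const_nhds.congr' ?_
        filter_upwards [eventually_ge_atTop N] with n hn
        rw [hN n hn, mul_one]
      rw [this.liminf_eq]
    refine hF.trans ((lintegral_liminf_le fun n => ?_).trans ?_)
    · exact ((hwc.mul (cut2_cont n)).measurable).ennreal_ofReal
    · refine liminf_le_of_le ?_ ?_
      · isBoundedDefault
      · intro b hb
        obtain ⟨n, hn⟩ := hb.exists
        refine hn.trans ?_
        have h1 := hcut ⟨w, hw⟩ hwc n
        simp only at h1
        rw [← ofReal_integral_eq_lintegral_ofReal h1.1
          (ae_of_all _ fun p => mul_nonneg (hw0 p) (cut2_nonneg _ _)), h1.2]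
        apply ENNReal.ofReal_le_ofReal
        rw [← sub_nonneg, ← map_sub]
        apply hpos
        intro p
        simp only [Submodule.coe_sub, Pi.sub_apply, sub_nonneg]
        exact mul_le_of_le_one_right (hw0 p) (cut2_le_one _ _)
  refine ⟨π, fun F hF => ?_⟩
  obtain ⟨C, hC, hFC⟩ := F.2
  have hFi : Integrable (F : ℝ × ℝ → ℝ) π :=
    Integrable.mono' (hwi.const_mul C) hF.aestronglyMeasurable (ae_of_all _ hFC)
  refine ⟨hFi, ?_⟩
  have hlim1 : Tendsto (fun n : ℕ => ∫ p, (F : ℝ × ℝ → ℝ) p * cut2 n p ∂π) atTop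
      (𝓝 (∫ p, (F : ℝ × ℝ → ℝ) p ∂π)) := by
    apply tendsto_integral_of_dominated_convergence (fun p => |(F : ℝ × ℝ → ℝ) p|)
    · exact fun n => (hF.mul (cut2_cont n)).aestronglyMeasurable
    · exact hFi.abs
    · refine fun n => ae_of_all _ fun p => ?_
      rw [Real.norm_eq_abs, abs_mul, abs_of_nonneg (cut2_nonneg _ p)]
      exact mul_le_of_le_one_right (abs_nonneg _) (cut2_le_one _ _)
    · refine ae_of_all _ fun p => ?_
      obtain ⟨N, hN⟩ := hcut1 p
      refine tendsto_const_nhds.congr' ?_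
      filter_upwards [eventually_ge_atTop N] with n hn
      rw [hN n hn, mul_one]
  have htail : ∀ G : growthSp, (∀ p, |(G : ℝ × ℝ → ℝ) p| ≤ C * w p) → ∀ n : ℕ,
      L G - L ⟨_, growth_mul_cut G.2 n⟩ ≤
        C * (∫ x, tailF n x ∂μ + ∫ x, tailF n x ∂ν) := by
    intro G hG n
    rw [← map_sub]
    apply hL
    refine ⟨fun x => C * tailF n x, fun x => C * tailF n x, fun _ => 0,
      ((tailF_tendsto hμ).1 n).const_mul C, ((tailF_tendsto hν).1 n).const_mul C,
      continuous_const, ⟨0, by simp⟩, fun x y => ?_, ?_⟩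
    · simp only [Submodule.coe_sub, Pi.sub_apply]
      have h1 := (le_abs_self _).trans (hG (x, y))
      have h2 := tail_bound n (x, y)
      have h3 := cut2_le_one n (x, y)
      have h4 := mul_le_mul_of_nonneg_right h1 (sub_nonneg.2 h3)
      have h5 := mul_le_mul_of_nonneg_left h2 hC
      simp only [w] at h4 h5
      linarith
    · rw [integral_const_mul, integral_const_mul]; ring
  have hlim2 : Tendsto (fun n : ℕ => L ⟨_, growth_mul_cut F.2 (n : ℝ)⟩) atTop (𝓝 (L F)) := by
    rw [tendsto_iff_norm_sub_tendsto_zero]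
    have hz : Tendsto (fun n : ℕ => C * (∫ x, tailF n x ∂μ + ∫ x, tailF n x ∂ν)) atTop (𝓝 0) := by
      have := ((tailF_tendsto hμ).2.add (tailF_tendsto hν).2).const_mul C
      simpa using this
    refine squeeze_zero (fun n => norm_nonneg _) (fun n => ?_) hz
    have h1 := htail F hFC n
    have h2 := htail (-F) (fun p => by simpa using hFC p) n
    have h3 : L ⟨_, growth_mul_cut (-F).2 n⟩ = - L ⟨_, growth_mul_cut F.2 (n : ℝ)⟩ := by
      rw [← map_neg]; congr 1; ext p; simp
    rw [map_neg, h3] at h2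
    rw [Real.norm_eq_abs, abs_le]
    constructor <;> linarith
  exact tendsto_nhds_unique hlim1 (hlim2.congr fun n => (hcut F hF n).2.symm)

lemma coupling_prob {μ ν : Measure ℝ} [IsProbabilityMeasure μ] {π : Measure (ℝ × ℝ)}
    (h : IsCoupling μ ν π) : IsProbabilityMeasure π := by
  constructor
  have := congrArg (fun m => m univ) h.1
  simp only [Measure.map_apply measurable_fst MeasurableSet.univ, preimage_univ, measure_univ]
    at this
  exact this

lemma coupling_int_fst {μ ν : Measure ℝ} {π : Measure (ℝ × ℝ)} (h : IsCoupling μ ν π)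
    {f : ℝ → ℝ} (hf : Integrable f μ) :
    Integrable (fun p : ℝ × ℝ => f p.1) π ∧ ∫ p, f p.1 ∂π = ∫ x, f x ∂μ := by
  have hf' := hf
  rw [← h.1] at hf'
  refine ⟨hf'.comp_measurable measurable_fst, ?_⟩
  conv_rhs => rw [← h.1]
  rw [integral_map measurable_fst.aemeasurable hf'.aestronglyMeasurable]

lemma coupling_int_snd {μ ν : Measure ℝ} {π : Measure (ℝ × ℝ)} (h : IsCoupling μ ν π)
    {f : ℝ → ℝ} (hf : Integrable f ν) :
    Integrable (fun p : ℝ × ℝ => f p.2) π ∧ ∫ p, f p.2 ∂π = ∫ x, f x ∂ν := by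
  have hf' := hf
  rw [← h.2] at hf'
  refine ⟨hf'.comp_measurable measurable_snd, ?_⟩
  conv_rhs => rw [← h.2]
  rw [integral_map measurable_snd.aemeasurable hf'.aestronglyMeasurable]

lemma coupling_int_sub {μ ν : Measure ℝ} {π : Measure (ℝ × ℝ)} (h : IsCoupling μ ν π)
    (hμ : Integrable (fun x : ℝ => x) μ) (hν : Integrable (fun x : ℝ => x) ν) :
    Integrable (fun p : ℝ × ℝ => p.2 - p.1) π :=
  (coupling_int_snd h hν).1.sub (coupling_int_fst h hμ).1

lemma coupling_int_rho {μ ν : Measure ℝ} {π : Measure (ℝ × ℝ)} (h : IsCoupling μ ν π)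
    (hμ : Integrable (fun x : ℝ => x) μ) (hν : Integrable (fun x : ℝ => x) ν)
    {ρ : ℝ → ℝ} (hρ : Continuous ρ) (hb : ∃ M, ∀ x, |ρ x| ≤ M) :
    Integrable (fun p : ℝ × ℝ => ρ p.1 * (p.2 - p.1)) π := by
  obtain ⟨M, hM⟩ := hb
  exact (coupling_int_sub h hμ hν).bdd_mul (c := M)
    (hρ.comp continuous_fst).aestronglyMeasurable (ae_of_all _ fun p => hM p.1)

lemma exists_optimal {μ ν : Measure ℝ} [IsProbabilityMeasure μ] [IsProbabilityMeasure ν]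
    (hμ : Integrable (fun x : ℝ => x) μ) (hν : Integrable (fun x : ℝ => x) ν)
    (hord : ConvexOrder μ ν) :
    ∃ π, IsOptimalMart (fun x y => |y - x|) μ ν π := by
  obtain ⟨L, hL, hLc⟩ := exists_functional hμ hν hord
  obtain ⟨π, hπ⟩ := exists_rep hμ hν L hL
  have hLe : ∀ (F : growthSp) (r : ℝ), r ∈ SuperVals μ ν F → -r ∈ SuperVals μ ν (-F : growthSp) →
      L F = r := by
    intro F r h1 h2
    have h3 := hL _ _ h1
    have h4 := hL _ _ h2
    rw [map_neg] at h4
    linarith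
  have hbdd : ∀ F : ℝ × ℝ → ℝ, ∀ M, (∀ p, |F p| ≤ M) → F ∈ growthSp := by
    intro F M hM
    have hM0 : 0 ≤ M := (abs_nonneg _).trans (hM 0)
    refine ⟨M, hM0, fun p => (hM p).trans ?_⟩
    apply le_mul_of_one_le_right hM0
    linarith [abs_nonneg p.1, abs_nonneg p.2]
  have hfin : IsFiniteMeasure π := by
    have h1 : (fun _ : ℝ × ℝ => (1 : ℝ)) ∈ growthSp := hbdd _ 1 (by simp)
    have := (hπ ⟨_, h1⟩ continuous_const).1
    simp only at this
    rw [integrable_const_iff] at this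
    simpa using this
  have hc1 : π.map Prod.fst = μ := by
    have : IsFiniteMeasure (π.map Prod.fst) := inferInstance
    apply ext_of_forall_integral_eq_of_IsFiniteMeasure
    intro f
    rw [integral_map measurable_fst.aemeasurable f.continuous.aestronglyMeasurable]
    have hg : (fun p : ℝ × ℝ => f p.1) ∈ growthSp := hbdd _ ‖f‖ fun p => f.norm_coe_le_norm _
    rw [(hπ ⟨_, hg⟩ (f.continuous.comp continuous_fst)).2]
    apply hLe
    · exact ⟨f, fun _ => 0, fun _ => 0, f.integrable μ, integrable_const _, continuous_const,
        ⟨0, by simp⟩, fun x y => by simp, by simp⟩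
    · exact ⟨-f, fun _ => 0, fun _ => 0, (f.integrable μ).neg, integrable_const _,
        continuous_const, ⟨0, by simp⟩, fun x y => by simp, by simp [integral_neg]⟩
  have hc2 : π.map Prod.snd = ν := by
    have : IsFiniteMeasure (π.map Prod.snd) := inferInstance
    apply ext_of_forall_integral_eq_of_IsFiniteMeasure
    intro f
    rw [integral_map measurable_snd.aemeasurable f.continuous.aestronglyMeasurable]
    have hg : (fun p : ℝ × ℝ => f p.2) ∈ growthSp := hbdd _ ‖f‖ fun p => f.norm_coe_le_norm _
    rw [(hπ ⟨_, hg⟩ (f.continuous.comp continuous_snd)).2]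
    apply hLe
    · exact ⟨fun _ => 0, f, fun _ => 0, integrable_const _, f.integrable ν, continuous_const,
        ⟨0, by simp⟩, fun x y => by simp, by simp⟩
    · exact ⟨fun _ => 0, -f, fun _ => 0, integrable_const _, (f.integrable ν).neg,
        continuous_const, ⟨0, by simp⟩, fun x y => by simp, by simp [integral_neg]⟩
  have hcc : Continuous costF := by
    unfold costF
    fun_prop
  have hcost := hπ ⟨costF, costF_mem⟩ hcc
  refine ⟨π, ⟨⟨hc1, hc2⟩, ?_⟩, hcost.1, ?_⟩
  · rintro ρ hρ ⟨M, hM⟩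
    have hM0 : 0 ≤ M := (abs_nonneg _).trans (hM 0)
    have hg : (fun p : ℝ × ℝ => ρ p.1 * (p.2 - p.1)) ∈ growthSp := by
      refine ⟨M, hM0, fun p => ?_⟩
      rw [abs_mul]
      refine mul_le_mul (hM _) ?_ (abs_nonneg _) hM0
      linarith [abs_sub p.2 p.1]
    rw [(hπ ⟨_, hg⟩ (by simp only; fun_prop)).2]
    apply hLe
    · exact ⟨fun _ => 0, fun _ => 0, ρ, integrable_const _, integrable_const _, hρ, ⟨M, hM⟩,
        fun x y => by simp, by simp⟩
    · exact ⟨fun _ => 0, fun _ => 0, fun x => -ρ x, integrable_const _, integrable_const _,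
        hρ.neg, ⟨M, fun x => by simpa using hM x⟩, fun x y => by simp, by simp⟩
  · intro π' hπ' hint
    have h1 : ∫ p : ℝ × ℝ, |p.2 - p.1| ∂π = - sInf (SuperVals μ ν (-costF)) := hcost.2.trans hLc
    rw [h1]
    have h2 : -∫ p : ℝ × ℝ, |p.2 - p.1| ∂π' ≤ sInf (SuperVals μ ν (-costF)) := by
      refine le_csInf (supSet_growth hμ hν (growthSp.neg_mem costF_mem)) ?_
      rintro r ⟨f, h, ρ, hf, hh, hρ, hb, hle, rfl⟩
      have e1 := coupling_int_fst hπ'.1 hf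
      have e2 := coupling_int_snd hπ'.1 hh
      have e3 := coupling_int_rho hπ'.1 hμ hν hρ hb
      have e4 := hπ'.2 ρ hρ hb
      rw [← e1.2, ← e2.2, ← integral_neg]
      calc ∫ p : ℝ × ℝ, -|p.2 - p.1| ∂π' ≤ ∫ p, (f p.1 + h p.2 + ρ p.1 * (p.2 - p.1)) ∂π' :=
            integral_mono hint.neg ((e1.1.add e2.1).add e3) fun p => hle p.1 p.2
        _ = _ := by
            have e12 : Integrable (fun p : ℝ × ℝ => f p.1 + h p.2) π' := e1.1.add e2.1
            rw [integral_add e12 e3, integral_add e1.1 e2.1, e4, add_zero]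
    linarith

lemma optimal_swap {μ ν : Measure ℝ} [IsProbabilityMeasure μ]
    (hμ : Integrable (fun x : ℝ => x) μ) (hν : Integrable (fun x : ℝ => x) ν)
    {π : Measure (ℝ × ℝ)} (hopt : IsOptimalMart (fun x y => |y - x|) μ ν π)
    (Q A : Measure (ℝ × ℝ)) (hR : Q ≤ π)
    (h1 : A.map Prod.fst = Q.map Prod.fst) (h2 : A.map Prod.snd = Q.map Prod.snd)
    (hm : ∀ ρ : ℝ → ℝ, Continuous ρ → (∃ M : ℝ, ∀ x, |ρ x| ≤ M) →
      ∫ p : ℝ × ℝ, ρ p.1 * (p.2 - p.1) ∂A = ∫ p : ℝ × ℝ, ρ p.1 * (p.2 - p.1) ∂Q) :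
    ∫ p : ℝ × ℝ, |p.2 - p.1| ∂Q ≤ ∫ p : ℝ × ℝ, |p.2 - p.1| ∂A := by
  have hpr := coupling_prob hopt.1.1
  have hRfin : IsFiniteMeasure Q := ⟨(hR univ).trans_lt (measure_lt_top _ _)⟩
  have hcan : π - Q + Q = π := Measure.sub_add_cancel_of_le hR
  have hc : IsCoupling μ ν (π - Q + A) := by
    constructor
    · rw [Measure.map_add _ _ measurable_fst, h1, ← Measure.map_add _ _ measurable_fst, hcan,
        hopt.1.1.1]
    · rw [Measure.map_add _ _ measurable_snd, h2, ← Measure.map_add _ _ measurable_snd, hcan,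
        hopt.1.1.2]
  have hAle : A ≤ π - Q + A := Measure.le_add_left le_rfl
  have hSle : π - Q ≤ π - Q + A := Measure.le_add_right le_rfl
  have key : ∀ f : ℝ × ℝ → ℝ, Integrable f π → Integrable f (π - Q + A) →
      ∫ p, f p ∂(π - Q + A) - ∫ p, f p ∂π = ∫ p, f p ∂A - ∫ p, f p ∂Q := by
    intro f hf hf'
    rw [integral_add_measure (hf'.mono_measure hSle) (hf'.mono_measure hAle)]
    conv_lhs => rw [← hcan]
    have e : π - Q + Q - Q = π - Q := by rw [hcan]
    rw [e, integral_add_measure (hf'.mono_measure hSle) (hf.mono_measure hR)]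
    ring
  have hi1 := coupling_int_sub hopt.1.1 hμ hν
  have hi2 := coupling_int_sub hc hμ hν
  have hmc : IsMartingaleCoupling μ ν (π - Q + A) := by
    refine ⟨hc, fun ρ hρ hb => ?_⟩
    have := key _ (coupling_int_rho hopt.1.1 hμ hν hρ hb) (coupling_int_rho hc hμ hν hρ hb)
    rw [hopt.1.2 ρ hρ hb, hm ρ hρ hb] at this
    linarith
  have h3 := hopt.2.2 _ hmc hi2.abs
  have h4 := key _ hi1.abs hi2.abs
  simp only at h3
  linarith

lemma swap_null {μ ν : Measure ℝ} [IsProbabilityMeasure μ]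
    (hμ : Integrable (fun x : ℝ => x) μ) (hν : Integrable (fun x : ℝ => x) ν)
    {π : Measure (ℝ × ℝ)} (hopt : IsOptimalMart (fun x y => |y - x|) μ ν π)
    {Ω : Type*} [MeasurableSpace Ω] (N : Measure Ω) [IsProbabilityMeasure N]
    (u ym yp u' y' : Ω → ℝ) (mu : Measurable u) (mym : Measurable ym) (myp : Measurable yp)
    (mu' : Measurable u') (my' : Measurable y')
    (hN1 : N.map (fun ω => (u ω, ym ω)) = π) (hN2 : N.map (fun ω => (u ω, yp ω)) = π)
    (hN3 : N.map (fun ω => (u' ω, y' ω)) = π) :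
    N {ω | ym ω < y' ω ∧ y' ω < yp ω ∧
      (yp ω - ym ω) * (|y' ω - u ω| - |y' ω - u' ω|) <
        (yp ω - y' ω) * (|ym ω - u ω| - |ym ω - u' ω|) +
        (y' ω - ym ω) * (|yp ω - u ω| - |yp ω - u' ω|)} = 0 := by
  set B := {ω | ym ω < y' ω ∧ y' ω < yp ω ∧
      (yp ω - ym ω) * (|y' ω - u ω| - |y' ω - u' ω|) <
        (yp ω - y' ω) * (|ym ω - u ω| - |ym ω - u' ω|) +
        (y' ω - ym ω) * (|yp ω - u ω| - |yp ω - u' ω|)} with hB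
  have hBm : MeasurableSet B := by
    have q3 : MeasurableSet {ω | (yp ω - ym ω) * (|y' ω - u ω| - |y' ω - u' ω|) <
        (yp ω - y' ω) * (|ym ω - u ω| - |ym ω - u' ω|) +
        (y' ω - ym ω) * (|yp ω - u ω| - |yp ω - u' ω|)} :=
      measurableSet_lt (by fun_prop) (by fun_prop)
    exact (measurableSet_lt mym my').inter ((measurableSet_lt my' myp).inter q3)
  -- weights
  set w1 : Ω → ℝ := B.indicator (fun ω => (yp ω - y' ω) / (yp ω - ym ω) / 3) with hw1
  set w2 : Ω → ℝ := B.indicator (fun ω => (y' ω - ym ω) / (yp ω - ym ω) / 3) with hw2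
  have mw1 : Measurable w1 := Measurable.indicator (by fun_prop) hBm
  have mw2 : Measurable w2 := Measurable.indicator (by fun_prop) hBm
  have hBd : ∀ ω ∈ B, 0 < yp ω - ym ω := fun ω h => by linarith [h.1, h.2.1]
  have w1n : ∀ ω, 0 ≤ w1 ω := fun ω => indicator_nonneg (fun ω h => by
    have := hBd ω h
    have := h.2.1
    have : 0 ≤ yp ω - y' ω := by linarith
    positivity) ω
  have w2n : ∀ ω, 0 ≤ w2 ω := fun ω => indicator_nonneg (fun ω h => by
    have := hBd ω h
    have := h.1
    have : 0 ≤ y' ω - ym ω := by linarith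
    positivity) ω
  have wsum : ∀ ω, w1 ω + w2 ω ≤ 1 / 3 := by
    intro ω
    by_cases h : ω ∈ B
    · have := hBd ω h
      simp only [hw1, hw2, indicator_of_mem h]
      apply le_of_eq
      field_simp
      ring
    · simp [hw1, hw2, indicator_of_notMem h]
  have wbal : ∀ ω, w1 ω * (ym ω - y' ω) + w2 ω * (yp ω - y' ω) = 0 := by
    intro ω
    by_cases h : ω ∈ B
    · have := hBd ω h
      simp only [hw1, hw2, indicator_of_mem h]
      field_simp
      ring
    · simp [hw1, hw2, indicator_of_notMem h]
  set W1 := N.withDensity (fun ω => ENNReal.ofReal (w1 ω)) with hW1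
  set W2 := N.withDensity (fun ω => ENNReal.ofReal (w2 ω)) with hW2
  have hWsum : W1 + W2 ≤ ENNReal.ofReal (1 / 3) • N := by
    rw [hW1, hW2, ← withDensity_add_left (by fun_prop), ← withDensity_const]
    apply withDensity_mono
    refine ae_of_all _ fun ω => ?_
    simp only [Pi.add_apply]
    rw [← ENNReal.ofReal_add (w1n ω) (w2n ω)]
    exact ENNReal.ofReal_le_ofReal (wsum ω)
  have hW1le : W1 ≤ ENNReal.ofReal (1 / 3) • N := (Measure.le_add_right le_rfl).trans hWsum
  have hW2le : W2 ≤ ENNReal.ofReal (1 / 3) • N := (Measure.le_add_left le_rfl).trans hWsum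
  -- integrability
  have hI : ∀ f : Ω → ℝ, Integrable f N → Integrable f W1 ∧ Integrable f W2 := by
    intro f hf
    have : Integrable f (ENNReal.ofReal (1 / 3) • N) := hf.smul_measure ENNReal.ofReal_ne_top
    exact ⟨this.mono_measure hW1le, this.mono_measure hW2le⟩
  have hval1 : ∀ f : Ω → ℝ, ∫ ω, f ω ∂W1 = ∫ ω, w1 ω * f ω ∂N := by
    intro f
    rw [hW1, integral_withDensity_eq_integral_toReal_smul (by fun_prop)
      (ae_of_all _ fun _ => ENNReal.ofReal_lt_top)]
    refine integral_congr_ae (ae_of_all _ fun ω => ?_)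
    simp [ENNReal.toReal_ofReal (w1n ω)]
  have hval2 : ∀ f : Ω → ℝ, ∫ ω, f ω ∂W2 = ∫ ω, w2 ω * f ω ∂N := by
    intro f
    rw [hW2, integral_withDensity_eq_integral_toReal_smul (by fun_prop)
      (ae_of_all _ fun _ => ENNReal.ofReal_lt_top)]
    refine integral_congr_ae (ae_of_all _ fun ω => ?_)
    simp [ENNReal.toReal_ofReal (w2n ω)]
  have hwint : ∀ f : Ω → ℝ, Integrable f N →
      Integrable (fun ω => w1 ω * f ω) N ∧ Integrable (fun ω => w2 ω * f ω) N := by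
    intro f hf
    refine ⟨hf.bdd_mul (c := 1) mw1.aestronglyMeasurable (ae_of_all _ fun ω => ?_),
      hf.bdd_mul (c := 1) mw2.aestronglyMeasurable (ae_of_all _ fun ω => ?_)⟩
    · rw [Real.norm_of_nonneg (w1n ω)]
      linarith [wsum ω, w2n ω]
    · rw [Real.norm_of_nonneg (w2n ω)]
      linarith [wsum ω, w1n ω]
  -- coordinates integrable
  have hx := (coupling_int_fst hopt.1.1 hμ).1
  have hy := (coupling_int_snd hopt.1.1 hν).1
  have iu : Integrable u N := by
    rw [← hN1] at hx
    exact hx.comp_measurable (mu.prodMk mym)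
  have iym : Integrable ym N := by
    rw [← hN1] at hy
    exact hy.comp_measurable (mu.prodMk mym)
  have iyp : Integrable yp N := by
    have hy := (coupling_int_snd hopt.1.1 hν).1
    rw [← hN2] at hy
    exact hy.comp_measurable (mu.prodMk myp)
  have iu' : Integrable u' N := by
    have hx := (coupling_int_fst hopt.1.1 hμ).1
    rw [← hN3] at hx
    exact hx.comp_measurable (mu'.prodMk my')
  have iy' : Integrable y' N := by
    have hy := (coupling_int_snd hopt.1.1 hν).1
    rw [← hN3] at hy
    exact hy.comp_measurable (mu'.prodMk my')
  set Q : Measure (ℝ × ℝ) := W1.map (fun ω => (u ω, ym ω)) + W2.map (fun ω => (u ω, yp ω)) +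
    (W1.map (fun ω => (u' ω, y' ω)) + W2.map (fun ω => (u' ω, y' ω))) with hR
  set A : Measure (ℝ × ℝ) := W1.map (fun ω => (u' ω, ym ω)) + W2.map (fun ω => (u' ω, yp ω)) +
    (W1.map (fun ω => (u ω, y' ω)) + W2.map (fun ω => (u ω, y' ω))) with hA
  have hRle : Q ≤ π := by
    have t1 : W1.map (fun ω => (u ω, ym ω)) ≤ ENNReal.ofReal (1 / 3) • π := by
      refine (Measure.map_mono hW1le (mu.prodMk mym)).trans ?_
      rw [Measure.map_smul, hN1]
    have t2 : W2.map (fun ω => (u ω, yp ω)) ≤ ENNReal.ofReal (1 / 3) • π := by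
      refine (Measure.map_mono hW2le (mu.prodMk myp)).trans ?_
      rw [Measure.map_smul, hN2]
    have t3 : W1.map (fun ω => (u' ω, y' ω)) + W2.map (fun ω => (u' ω, y' ω)) ≤
        ENNReal.ofReal (1 / 3) • π := by
      rw [← Measure.map_add _ _ (mu'.prodMk my')]
      refine (Measure.map_mono hWsum (mu'.prodMk my')).trans ?_
      rw [Measure.map_smul, hN3]
    calc Q ≤ ENNReal.ofReal (1 / 3) • π + ENNReal.ofReal (1 / 3) • π +
          ENNReal.ofReal (1 / 3) • π := add_le_add (add_le_add t1 t2) t3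
      _ = π := by
        rw [← add_smul, ← add_smul, ← ENNReal.ofReal_add (by norm_num) (by norm_num),
          ← ENNReal.ofReal_add (by norm_num) (by norm_num)]
        norm_num
  have hmap : ∀ (W : Measure Ω) (g : ℝ × ℝ → ℝ) (_ : Measurable g) (a b : Ω → ℝ)
      (_ : Measurable a) (_ : Measurable b), (W.map (fun ω => (a ω, b ω))).map g =
        W.map (fun ω => g (a ω, b ω)) := by
    intro W g hg a b ha hb
    rw [Measure.map_map hg (ha.prodMk hb)]
    rfl
  have e1 : A.map Prod.fst = Q.map Prod.fst := by
    rw [hA, hR]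
    simp only [Measure.map_add _ _ measurable_fst]
    rw [hmap _ _ measurable_fst _ _ mu' mym, hmap _ _ measurable_fst _ _ mu' myp,
      hmap _ _ measurable_fst _ _ mu my', hmap _ _ measurable_fst _ _ mu my',
      hmap _ _ measurable_fst _ _ mu mym, hmap _ _ measurable_fst _ _ mu myp,
      hmap _ _ measurable_fst _ _ mu' my', hmap _ _ measurable_fst _ _ mu' my', add_comm]
  have e2 : A.map Prod.snd = Q.map Prod.snd := by
    rw [hA, hR]
    simp only [Measure.map_add _ _ measurable_snd]
    rw [hmap _ _ measurable_snd _ _ mu' mym, hmap _ _ measurable_snd _ _ mu' myp,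
      hmap _ _ measurable_snd _ _ mu my', hmap _ _ measurable_snd _ _ mu my',
      hmap _ _ measurable_snd _ _ mu mym, hmap _ _ measurable_snd _ _ mu myp,
      hmap _ _ measurable_snd _ _ mu' my', hmap _ _ measurable_snd _ _ mu' my']
  -- integrals
  have hint : ∀ (W : Measure Ω) (f : ℝ × ℝ → ℝ) (_ : Measurable f) (a b : Ω → ℝ)
      (_ : Measurable a) (_ : Measurable b) (_ : Integrable (fun ω => f (a ω, b ω)) W),
      Integrable f (W.map (fun ω => (a ω, b ω))) ∧
      ∫ p, f p ∂(W.map (fun ω => (a ω, b ω))) = ∫ ω, f (a ω, b ω) ∂W := by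
    intro W f hf a b ha hb hi
    refine ⟨(integrable_map_measure hf.aestronglyMeasurable (ha.prodMk hb).aemeasurable).2 hi, ?_⟩
    rw [integral_map (ha.prodMk hb).aemeasurable hf.aestronglyMeasurable]
  have hdiff : ∀ f : ℝ × ℝ → ℝ, Measurable f →
      (∀ a b : Ω → ℝ, Measurable a → Measurable b → Integrable a N → Integrable b N →
        Integrable (fun ω => f (a ω, b ω)) N) →
      ∫ p, f p ∂Q - ∫ p, f p ∂A = ∫ ω, (w1 ω * (f (u ω, ym ω) - f (u' ω, ym ω)) +
        w2 ω * (f (u ω, yp ω) - f (u' ω, yp ω)) -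
        (w1 ω + w2 ω) * (f (u ω, y' ω) - f (u' ω, y' ω))) ∂N := by
    intro f hf hfi
    have J1 := hfi u ym mu mym iu iym
    have J2 := hfi u yp mu myp iu iyp
    have J3 := hfi u' ym mu' mym iu' iym
    have J4 := hfi u' yp mu' myp iu' iyp
    have J5 := hfi u y' mu my' iu iy'
    have J6 := hfi u' y' mu' my' iu' iy'
    have K1 := hint W1 f hf u ym mu mym (hI _ J1).1
    have K2 := hint W2 f hf u yp mu myp (hI _ J2).2
    have K3 := hint W1 f hf u' ym mu' mym (hI _ J3).1
    have K4 := hint W2 f hf u' yp mu' myp (hI _ J4).2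
    have K5 := hint W1 f hf u y' mu my' (hI _ J5).1
    have K5' := hint W2 f hf u y' mu my' (hI _ J5).2
    have K6 := hint W1 f hf u' y' mu' my' (hI _ J6).1
    have K6' := hint W2 f hf u' y' mu' my' (hI _ J6).2
    rw [hR, hA, integral_add_measure (K1.1.add_measure K2.1) (K6.1.add_measure K6'.1),
      integral_add_measure K1.1 K2.1, integral_add_measure K6.1 K6'.1,
      integral_add_measure (K3.1.add_measure K4.1) (K5.1.add_measure K5'.1),
      integral_add_measure K3.1 K4.1, integral_add_measure K5.1 K5'.1,
      K1.2, K2.2, K3.2, K4.2, K5.2, K5'.2, K6.2, K6'.2]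
    simp only [hval1, hval2]
    have L1 := (hwint _ J1).1
    have L2 := (hwint _ J2).2
    have L3 := (hwint _ J3).1
    have L4 := (hwint _ J4).2
    have L5 := (hwint _ J5).1
    have L5' := (hwint _ J5).2
    have L6 := (hwint _ J6).1
    have L6' := (hwint _ J6).2
    rw [← integral_add' L1 L2, ← integral_add' L6 L6', ← integral_add' L3 L4, ← integral_add' L5 L5',
      ← integral_add' (L1.add L2) (L6.add L6'), ← integral_add' (L3.add L4) (L5.add L5'),
      ← integral_sub' ((L1.add L2).add (L6.add L6')) ((L3.add L4).add (L5.add L5'))]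
    refine integral_congr_ae (ae_of_all _ fun ω => ?_)
    simp only [Pi.add_apply, Pi.sub_apply]
    ring
  have e3 : ∀ ρ : ℝ → ℝ, Continuous ρ → (∃ M : ℝ, ∀ x, |ρ x| ≤ M) →
      ∫ p : ℝ × ℝ, ρ p.1 * (p.2 - p.1) ∂A = ∫ p : ℝ × ℝ, ρ p.1 * (p.2 - p.1) ∂Q := by
    rintro ρ hρ ⟨M, hM⟩
    have hρm := hρ.measurable
    have := hdiff (fun p => ρ p.1 * (p.2 - p.1)) (by fun_prop) (by
      intro a b ha hb ia ib
      exact (ib.sub ia).bdd_mul (c := M) (hρm.comp ha).aestronglyMeasurable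
        (ae_of_all _ fun ω => hM (a ω)))
    have z : ∀ ω, (w1 ω * (ρ (u ω) * (ym ω - u ω) - ρ (u' ω) * (ym ω - u' ω)) +
        w2 ω * (ρ (u ω) * (yp ω - u ω) - ρ (u' ω) * (yp ω - u' ω)) -
        (w1 ω + w2 ω) * (ρ (u ω) * (y' ω - u ω) - ρ (u' ω) * (y' ω - u' ω))) = 0 := by
      intro ω
      linear_combination (ρ (u ω) - ρ (u' ω)) * wbal ω
    simp only [z, integral_zero] at this
    linarith
  have fin := optimal_swap hμ hν hopt Q A hRle e1 e2 e3
  have hd := hdiff (fun p => |p.2 - p.1|) (by fun_prop) (fun a b _ _ ia ib => (ib.sub ia).abs)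
  simp only at hd
  set G : Ω → ℝ := fun ω => (w1 ω * (|ym ω - u ω| - |ym ω - u' ω|) +
        w2 ω * (|yp ω - u ω| - |yp ω - u' ω|) -
        (w1 ω + w2 ω) * (|y' ω - u ω| - |y' ω - u' ω|)) with hG
  have hGi : Integrable G N := by
    refine ((hwint _ ((iym.sub iu).abs.sub (iym.sub iu').abs)).1.add
      (hwint _ ((iyp.sub iu).abs.sub (iyp.sub iu').abs)).2).sub ?_
    have q := (iy'.sub iu).abs.sub (iy'.sub iu').abs
    refine ((hwint _ q).1.add (hwint _ q).2).congr (ae_of_all _ fun ω => ?_)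
    simp only [Pi.add_apply, Pi.sub_apply]
    ring
  have hGpos : ∀ ω ∈ B, 0 < G ω := by
    intro ω h
    have hd := hBd ω h
    have h3 := h.2.2
    have : G ω = ((yp ω - y' ω) * (|ym ω - u ω| - |ym ω - u' ω|) +
        (y' ω - ym ω) * (|yp ω - u ω| - |yp ω - u' ω|) -
        (yp ω - ym ω) * (|y' ω - u ω| - |y' ω - u' ω|)) / (yp ω - ym ω) / 3 := by
      simp only [hG, hw1, hw2, indicator_of_mem h]
      field_simp
      ring
    rw [this]
    apply div_pos _ (by norm_num)
    apply div_pos _ hd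
    linarith
  have hG0 : ∀ ω, ω ∉ B → G ω = 0 := by
    intro ω h
    simp [hG, hw1, hw2, indicator_of_notMem h]
  have hGn : ∀ ω, 0 ≤ G ω := fun ω => by
    by_cases h : ω ∈ B
    · exact (hGpos ω h).le
    · exact (hG0 ω h).ge
  have hz : ∫ ω, G ω ∂N = 0 := le_antisymm (by linarith) (integral_nonneg hGn)
  rw [integral_eq_zero_iff_of_nonneg hGn hGi] at hz
  refine measure_mono_null (fun ω h => ?_) (ae_iff.1 hz)
  exact (hGpos ω h).ne'

open ProbabilityTheory in
lemma mart_kernel {μ ν : Measure ℝ} [IsProbabilityMeasure μ]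
    (hμ : Integrable (fun x : ℝ => x) μ) (hν : Integrable (fun x : ℝ => x) ν)
    {π : Measure (ℝ × ℝ)} (h : IsMartingaleCoupling μ ν π)
    (κ : Kernel ℝ ℝ) [IsMarkovKernel κ] (hκ : μ ⊗ₘ κ = π) :
    ∀ᵐ u ∂μ, Integrable (fun y => y - u) (κ u) ∧ ∫ y, (y - u) ∂(κ u) = 0 := by
  have hi := coupling_int_sub h.1 hμ hν
  rw [← hκ] at hi
  have h1 := ((Measure.integrable_compProd_iff hi.aestronglyMeasurable).1 hi).1
  have h2 : ∀ᵐ u ∂μ, ∫ y, (y - u) ∂(κ u) = 0 := by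
    refine ae_eq_zero_of_integral_contDiff_smul_eq_zero ?_ ?_
    · refine Integrable.locallyIntegrable ?_
      refine ((Measure.integrable_compProd_iff hi.aestronglyMeasurable).1 hi).2.mono' ?_
        (ae_of_all _ fun u => norm_integral_le_integral_norm _)
      refine StronglyMeasurable.aestronglyMeasurable ?_
      refine StronglyMeasurable.integral_kernel_prod_right (f := fun u y => y - u) ?_
      exact (measurable_snd.sub measurable_fst).stronglyMeasurable
    · intro g hg hgs
      have hgb : ∃ M, ∀ x, |g x| ≤ M := hgs.exists_bound_of_continuous hg.continuous
      have h3 := h.2 g hg.continuous hgb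
      have h4 := coupling_int_rho h.1 hμ hν hg.continuous hgb
      rw [← hκ] at h3 h4
      rw [Measure.integral_compProd h4] at h3
      simp only [integral_const_mul] at h3
      simpa using h3
  filter_upwards [h1, h2] with u a b using ⟨a, b⟩

lemma countable_left (S : Set (ℝ × ℝ)) :
    {u : ℝ | ∃ y, (u, y) ∈ S ∧ ∃ ε > 0, ∀ u' y', (u', y') ∈ S → u' < u → u - ε < u' →
      |y' - y| < ε → False}.Countable := by
  have : {u : ℝ | ∃ y, (u, y) ∈ S ∧ ∃ ε > 0, ∀ u' y', (u', y') ∈ S → u' < u → u - ε < u' →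
      |y' - y| < ε → False} ⊆ ⋃ t : ℚ × ℚ × ℚ, {u : ℝ | (∃ y, (u, y) ∈ S ∧ (t.1 : ℝ) < y ∧
        y < t.2.1 ∧ t.2.2 < u) ∧ ∀ u' y', (u', y') ∈ S → (t.1 : ℝ) < y' → y' < t.2.1 →
        t.2.2 < u' → u ≤ u'} := by
    rintro u ⟨y, hy, ε, hε, H⟩
    obtain ⟨a, ha1, ha2⟩ := exists_rat_btwn (show y - ε < y by linarith)
    obtain ⟨b, hb1, hb2⟩ := exists_rat_btwn (show y < y + ε by linarith)
    obtain ⟨c, hc1, hc2⟩ := exists_rat_btwn (show u - ε < u by linarith)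
    refine mem_iUnion.2 ⟨(a, b, c), ⟨y, hy, ha2, hb1, hc2⟩, fun u' y' h h1 h2 h3 => ?_⟩
    by_contra hlt
    push Not at hlt
    refine H u' y' h hlt (hc1.trans h3) (abs_lt.2 ⟨?_, ?_⟩)
    · simp only at h1
      linarith
    · simp only at h2
      linarith
  refine Set.Countable.mono this (countable_iUnion fun t => Set.Subsingleton.countable ?_)
  rintro u ⟨⟨y, h, h1, h2, h3⟩, H⟩ v ⟨⟨y', h', h1', h2', h3'⟩, H'⟩
  exact le_antisymm (H _ _ h' h1' h2' h3') (H' _ _ h h1 h2 h3)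

lemma countable_right (S : Set (ℝ × ℝ)) :
    {u : ℝ | ∃ y, (u, y) ∈ S ∧ ∃ ε > 0, ∀ u' y', (u', y') ∈ S → u < u' → u' < u + ε →
      |y' - y| < ε → False}.Countable := by
  have := (countable_left {p | (-p.1, p.2) ∈ S}).image (fun x => -x)
  refine this.mono ?_
  rintro u ⟨y, hy, ε, hε, H⟩
  refine ⟨-u, ⟨y, by simpa using hy, ε, hε, fun u' y' h h1 h2 h3 => ?_⟩, by simp⟩
  exact H (-u') y' h (by linarith) (by linarith) h3

open ProbabilityTheory in
lemma key_support {μ ν : Measure ℝ} [IsProbabilityMeasure μ]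
    (hμ : Integrable (fun x : ℝ => x) μ) (hν : Integrable (fun x : ℝ => x) ν)
    {π : Measure (ℝ × ℝ)} (hopt : IsOptimalMart (fun x y => |y - x|) μ ν π)
    (κ : Kernel ℝ ℝ) [IsMarkovKernel κ] (hκ : μ ⊗ₘ κ = π) {u ym yp u' y' : ℝ}
    (h3 : (u, ym, yp) ∈ (μ ⊗ₘ (κ ×ₖ κ)).support) (h2 : (u', y') ∈ π.support)
    (hm : ym < y') (hp : y' < yp)
    (hlt : (yp - ym) * (|y' - u| - |y' - u'|) <
        (yp - y') * (|ym - u| - |ym - u'|) + (y' - ym) * (|yp - u| - |yp - u'|)) : False := by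
  have hpr := coupling_prob hopt.1.1
  have e1 : (μ ⊗ₘ (κ ×ₖ κ)).map (fun t => (t.1, t.2.1)) = π := by
    rw [← hκ]
    conv_rhs => rw [← Kernel.fst_prod κ κ, Kernel.fst_eq, Measure.compProd_map measurable_fst]
    rfl
  have e2 : (μ ⊗ₘ (κ ×ₖ κ)).map (fun t => (t.1, t.2.2)) = π := by
    rw [← hκ]
    conv_rhs => rw [← Kernel.snd_prod κ κ, Kernel.snd_eq, Measure.compProd_map measurable_snd]
    rfl
  have nul := swap_null hμ hν hopt ((μ ⊗ₘ (κ ×ₖ κ)).prod π)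
    (fun ω => ω.1.1) (fun ω => ω.1.2.1) (fun ω => ω.1.2.2) (fun ω => ω.2.1) (fun ω => ω.2.2)
    (by fun_prop) (by fun_prop) (by fun_prop) (by fun_prop) (by fun_prop)
    (by
      rw [← e1]
      conv_rhs => rw [← Measure.fst_prod (μ := μ ⊗ₘ (κ ×ₖ κ)) (ν := π), Measure.fst,
        Measure.map_map (by fun_prop) (by fun_prop)]
      rw [e1]
      rfl)
    (by
      rw [← e2]
      conv_rhs => rw [← Measure.fst_prod (μ := μ ⊗ₘ (κ ×ₖ κ)) (ν := π), Measure.fst,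
        Measure.map_map (by fun_prop) (by fun_prop)]
      rw [e2]
      rfl)
    (by
      conv_rhs => rw [← Measure.snd_prod (μ := μ ⊗ₘ (κ ×ₖ κ)) (ν := π), Measure.snd]
      )
  have hopen : IsOpen {ω : (ℝ × ℝ × ℝ) × ℝ × ℝ | ω.1.2.1 < ω.2.2 ∧ ω.2.2 < ω.1.2.2 ∧
      (ω.1.2.2 - ω.1.2.1) * (|ω.2.2 - ω.1.1| - |ω.2.2 - ω.2.1|) <
        (ω.1.2.2 - ω.2.2) * (|ω.1.2.1 - ω.1.1| - |ω.1.2.1 - ω.2.1|) +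
        (ω.2.2 - ω.1.2.1) * (|ω.1.2.2 - ω.1.1| - |ω.1.2.2 - ω.2.1|)} := by
    have q3 : IsOpen {ω : (ℝ × ℝ × ℝ) × ℝ × ℝ |
      (ω.1.2.2 - ω.1.2.1) * (|ω.2.2 - ω.1.1| - |ω.2.2 - ω.2.1|) <
        (ω.1.2.2 - ω.2.2) * (|ω.1.2.1 - ω.1.1| - |ω.1.2.1 - ω.2.1|) +
        (ω.2.2 - ω.1.2.1) * (|ω.1.2.2 - ω.1.1| - |ω.1.2.2 - ω.2.1|)} :=
      isOpen_lt (by fun_prop) (by fun_prop)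
    have q1 : IsOpen {ω : (ℝ × ℝ × ℝ) × ℝ × ℝ | ω.1.2.1 < ω.2.2} :=
      isOpen_lt (by fun_prop) (by fun_prop)
    have q2 : IsOpen {ω : (ℝ × ℝ × ℝ) × ℝ × ℝ | ω.2.2 < ω.1.2.2} :=
      isOpen_lt (by fun_prop) (by fun_prop)
    exact q1.inter (q2.inter q3)
  have hnhds := hopen.mem_nhds (show ((u, ym, yp), (u', y')) ∈ _ from ⟨hm, hp, hlt⟩)
  obtain ⟨U, hU, V, hV, hUV⟩ := mem_nhds_prod_iff.1 hnhds
  have := measure_mono_null hUV nul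
  rw [Measure.prod_prod, mul_eq_zero] at this
  rcases this with h | h
  · exact ((Measure.mem_support_iff_forall _).1 h3 U hU).ne' h
  · exact ((Measure.mem_support_iff_forall _).1 h2 V hV).ne' h

open ProbabilityTheory in
lemma good_points {μ ν : Measure ℝ} [IsProbabilityMeasure μ]
    (hμ : Integrable (fun x : ℝ => x) μ) (hν : Integrable (fun x : ℝ => x) ν)
    (hat : ∀ x : ℝ, μ {x} = 0)
    {π : Measure (ℝ × ℝ)} (hopt : IsOptimalMart (fun x y => |y - x|) μ ν π)
    (κ : Kernel ℝ ℝ) [IsMarkovKernel κ] (hκ : μ ⊗ₘ κ = π) :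
    ∀ᵐ u ∂μ, (κ u (Ioi u) = 0 → ∀ᵐ y ∂(κ u), y = u) ∧
      (∃ t, ∀ᵐ y ∂(κ u), u < y → y = t) ∧ (∃ t, ∀ᵐ y ∂(κ u), y < u → y = t) ∧
      (κ u (Ioi u) ≠ 0 → ∀ u', (u', u) ∈ π.support → u' = u) := by
  have hpr := coupling_prob hopt.1.1
  have hna : NullSingletonClass μ := ⟨hat⟩
  have g1 := mart_kernel hμ hν hopt.1 κ hκ
  have g2 : ∀ᵐ u ∂μ, ∀ᵐ q ∂((κ u).prod (κ u)), (u, q) ∈ (μ ⊗ₘ (κ ×ₖ κ)).support := by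
    have : ∀ᵐ t ∂(μ ⊗ₘ (κ ×ₖ κ)), t ∈ (μ ⊗ₘ (κ ×ₖ κ)).support := Measure.support_mem_ae
    have := Measure.ae_ae_of_ae_compProd this
    filter_upwards [this] with u hu
    rwa [Kernel.prod_apply] at hu
  have g3 : ∀ᵐ u ∂μ, ∀ᵐ y ∂(κ u), (u, y) ∈ π.support := by
    have : ∀ᵐ t ∂(μ ⊗ₘ κ), t ∈ π.support := by
      rw [hκ]
      exact Measure.support_mem_ae
    exact Measure.ae_ae_of_ae_compProd this
  have g4 := measure_eq_zero_iff_ae_notMem.1 ((countable_left π.support).measure_zero μ)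
  have g5 := measure_eq_zero_iff_ae_notMem.1 ((countable_right π.support).measure_zero μ)
  filter_upwards [g1, g2, g3, g4, g5] with u h1 h2 h3 h4 h5
  have hA : κ u (Ioi u) = 0 → ∀ᵐ y ∂(κ u), y = u := by
    intro hz
    have hle : ∀ᵐ y ∂(κ u), y ≤ u := by
      filter_upwards [measure_eq_zero_iff_ae_notMem.1 hz] with y hy
      simpa using hy
    have hn : 0 ≤ᵐ[κ u] fun y => u - y := by
      filter_upwards [hle] with y hy
      simpa using hy
    have hi : Integrable (fun y => u - y) (κ u) := h1.1.neg.congr (ae_of_all _ fun y => by simp)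
    have : ∫ y, (u - y) ∂(κ u) = 0 := by
      have e : ∫ y, (u - y) ∂(κ u) = - ∫ y, (y - u) ∂(κ u) := by
        rw [← integral_neg]
        simp
      rw [e, h1.2, neg_zero]
    filter_upwards [(integral_eq_zero_iff_of_nonneg_ae hn hi).1 this] with y hy
    simp only [Pi.zero_apply] at hy
    linarith
  have hB : κ u (Iio u) = 0 → ∀ᵐ y ∂(κ u), y = u := by
    intro hz
    have hn : 0 ≤ᵐ[κ u] fun y => y - u := by
      filter_upwards [measure_eq_zero_iff_ae_notMem.1 hz] with y hy
      simpa using hy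
    filter_upwards [(integral_eq_zero_iff_of_nonneg_ae hn h1.1).1 h1.2] with y hy
    simp only [Pi.zero_apply] at hy
    linarith
  have hAB : κ u (Ioi u) ≠ 0 → κ u (Iio u) ≠ 0 := by
    intro h h'
    apply h
    rw [measure_eq_zero_iff_ae_notMem]
    filter_upwards [hB h'] with y hy
    simp [hy]
  have hBA : κ u (Iio u) ≠ 0 → κ u (Ioi u) ≠ 0 := by
    intro h h'
    apply h
    rw [measure_eq_zero_iff_ae_notMem]
    filter_upwards [hA h'] with y hy
    simp [hy]
  have hpq : ∀ᵐ a ∂(κ u), ∀ᵐ b ∂(κ u), (u, a, b) ∈ (μ ⊗ₘ (κ ×ₖ κ)).support :=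
    Measure.ae_ae_of_ae_prod h2
  have hqp : ∀ᵐ b ∂(κ u), ∀ᵐ a ∂(κ u), (u, a, b) ∈ (μ ⊗ₘ (κ ×ₖ κ)).support := by
    have := h2
    rw [← Measure.prod_swap] at this
    have := ae_of_ae_map measurable_swap.aemeasurable this
    exact Measure.ae_ae_of_ae_prod this
  have pick : ∀ {s : Set ℝ} {p : ℝ → Prop}, κ u s ≠ 0 → (∀ᵐ y ∂(κ u), p y) → ∃ y ∈ s, p y := by
    intro s p hs hp
    by_contra! hcon
    exact hs (measure_mono_null (fun y hy => hcon y hy) (ae_iff.1 hp))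
  have subs : ∀ {p : ℝ → Prop}, (∀ᵐ y ∂(κ u), p y) → ∀ q : ℝ → Prop,
      (∀ y1 y2, p y1 → p y2 → q y1 → q y2 → y1 < y2 → False) →
      ∃ t, ∀ᵐ y ∂(κ u), q y → y = t := by
    intro p hp q H
    by_cases hex : ∃ t, p t ∧ q t
    · obtain ⟨t, ht⟩ := hex
      refine ⟨t, ?_⟩
      filter_upwards [hp] with y hy hqy
      rcases lt_trichotomy y t with h | h | h
      · exact (H y t hy ht.1 hqy ht.2 h).elim
      · exact h
      · exact (H t y ht.1 hy ht.2 hqy h).elim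
    · push Not at hex
      refine ⟨0, ?_⟩
      filter_upwards [hp] with y hy hqy
      exact (hex y hy hqy).elim
  refine ⟨hA, ?_, ?_, ?_⟩
  · by_cases hz : κ u (Ioi u) = 0
    · refine ⟨u, ?_⟩
      filter_upwards [hA hz] with y hy _ using hy
    obtain ⟨a, ha, hab⟩ := pick (hAB hz) hpq
    refine subs (hab.and h3) (fun y => u < y) ?_
    rintro y1 y2 ⟨-, p1⟩ ⟨p2, -⟩ q1 q2 hlt
    simp only [mem_ofPred_eq, not_exists, not_and] at h4
    simp only [mem_Iio] at ha
    have hε : 0 < min (u - a) (min (y1 - u) (y2 - y1)) := by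
      refine lt_min (by linarith) (lt_min (by linarith) (by linarith))
    refine h4 y1 p1 _ hε fun u' y' hs l1 l2 l3 => ?_
    have m1 := min_le_left (u - a) (min (y1 - u) (y2 - y1))
    have m2 := (min_le_right (u - a) (min (y1 - u) (y2 - y1))).trans (min_le_left _ _)
    have m3 := (min_le_right (u - a) (min (y1 - u) (y2 - y1))).trans (min_le_right _ _)
    obtain ⟨l4, l5⟩ := abs_lt.1 l3
    refine key_support hμ hν hopt κ hκ p2 hs (by linarith) (by linarith) ?_
    rw [abs_of_pos (show 0 < y' - u by linarith), abs_of_pos (show 0 < y' - u' by linarith),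
      abs_of_neg (show a - u < 0 by linarith), abs_of_neg (show a - u' < 0 by linarith),
      abs_of_pos (show 0 < y2 - u by linarith), abs_of_pos (show 0 < y2 - u' by linarith)]
    nlinarith [mul_pos (show 0 < y2 - y' by linarith) (show 0 < u - u' by linarith)]
  · by_cases hz : κ u (Iio u) = 0
    · refine ⟨u, ?_⟩
      filter_upwards [hB hz] with y hy _ using hy
    obtain ⟨b, hb, hab⟩ := pick (hBA hz) hqp
    refine subs (hab.and h3) (fun y => y < u) ?_
    rintro y1 y2 ⟨p1, -⟩ ⟨-, p2⟩ q1 q2 hlt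
    simp only [mem_ofPred_eq, not_exists, not_and] at h5
    simp only [mem_Ioi] at hb
    have hε : 0 < min (b - u) (min (u - y2) (y2 - y1)) := by
      refine lt_min (by linarith) (lt_min (by linarith) (by linarith))
    refine h5 y2 p2 _ hε fun u' y' hs l1 l2 l3 => ?_
    have m1 := min_le_left (b - u) (min (u - y2) (y2 - y1))
    have m2 := (min_le_right (b - u) (min (u - y2) (y2 - y1))).trans (min_le_left _ _)
    have m3 := (min_le_right (b - u) (min (u - y2) (y2 - y1))).trans (min_le_right _ _)
    obtain ⟨l4, l5⟩ := abs_lt.1 l3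
    refine key_support hμ hν hopt κ hκ p1 hs (by linarith) (by linarith) ?_
    rw [abs_of_neg (show y' - u < 0 by linarith), abs_of_neg (show y' - u' < 0 by linarith),
      abs_of_neg (show y1 - u < 0 by linarith), abs_of_neg (show y1 - u' < 0 by linarith),
      abs_of_pos (show 0 < b - u by linarith), abs_of_pos (show 0 < b - u' by linarith)]
    nlinarith [mul_pos (show 0 < y' - y1 by linarith) (show 0 < u' - u by linarith)]
  · intro hz u' hs
    obtain ⟨a, ha, hab⟩ := pick (hAB hz) hpq
    obtain ⟨b, hb, hab⟩ := pick hz hab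
    simp only [mem_Iio] at ha
    simp only [mem_Ioi] at hb
    by_contra hne
    refine key_support hμ hν hopt κ hκ hab hs ha hb ?_
    rw [sub_self, abs_zero, abs_of_neg (show a - u < 0 by linarith),
      abs_of_pos (show 0 < b - u by linarith)]
    rcases lt_or_gt_of_ne hne with h | h
    · have k1 : |b - u'| = b - u' := abs_of_pos (by linarith)
      have k2 : |u - u'| = u - u' := abs_of_pos (by linarith)
      have k3 : |a - u'| < (u - a) + (u - u') := abs_lt.2 ⟨by linarith, by linarith⟩
      rw [k1, k2]
      nlinarith [mul_pos (show 0 < b - u by linarith) (sub_pos.2 k3)]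
    · have k1 : |a - u'| = u' - a := by
        rw [abs_of_neg (by linarith)]
        ring
      have k2 : |u - u'| = u' - u := by
        rw [abs_of_neg (by linarith)]
        ring
      have k3 : |b - u'| < (b - u) + (u' - u) := abs_lt.2 ⟨by linarith, by linarith⟩
      rw [k1, k2]
      nlinarith [mul_pos (show 0 < u - a by linarith) (sub_pos.2 k3)]

lemma meas_diag : MeasurableSet {p : ℝ × ℝ | p.2 = p.1} :=
  measurableSet_eq_fun measurable_snd measurable_fst

lemma restrict_diag (π : Measure (ℝ × ℝ)) :
    π.restrict {p : ℝ × ℝ | p.2 = p.1} =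
      ((π.restrict {p : ℝ × ℝ | p.2 = p.1}).map Prod.fst).map (fun x : ℝ => (x, x)) ∧
    (π.restrict {p : ℝ × ℝ | p.2 = p.1}).map Prod.snd =
      (π.restrict {p : ℝ × ℝ | p.2 = p.1}).map Prod.fst := by
  have hae : ∀ᵐ p ∂(π.restrict {p : ℝ × ℝ | p.2 = p.1}), p.2 = p.1 :=
    ae_restrict_mem meas_diag
  constructor
  · rw [Measure.map_map (by fun_prop) measurable_fst]
    conv_lhs => rw [← Measure.map_id (μ := π.restrict {p : ℝ × ℝ | p.2 = p.1})]
    apply Measure.map_congr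
    filter_upwards [hae] with p hp
    exact Prod.ext rfl hp
  · exact Measure.map_congr hae

open ProbabilityTheory in
lemma atom_formula {m : Measure ℝ} [IsProbabilityMeasure m] (s : Set ℝ) (hs : MeasurableSet s)
    (h : ∃ t, ∀ᵐ y ∂m, y ∈ s → y = t) :
    ∀ᵐ y ∂m, y ∈ s →
      y = (∫ y, s.indicator (fun y => y) y ∂m) / (∫ y, s.indicator (fun _ => (1 : ℝ)) y ∂m) := by
  obtain ⟨t, ht⟩ := h
  by_cases hz : m s = 0
  · filter_upwards [measure_eq_zero_iff_ae_notMem.1 hz] with y hy hys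
    exact (hy hys).elim
  have e : ∫ y, s.indicator (fun y => y) y ∂m = t * ∫ y, s.indicator (fun _ => (1 : ℝ)) y ∂m := by
    rw [← integral_const_mul]
    apply integral_congr_ae
    filter_upwards [ht] with y hy
    by_cases hys : y ∈ s
    · rw [indicator_of_mem hys, indicator_of_mem hys, mul_one]
      exact hy hys
    · simp [hys]
  have e1 : ∫ y, s.indicator (fun _ => (1 : ℝ)) y ∂m ≠ 0 := by
    rw [integral_indicator hs]
    simp [measureReal_def, ENNReal.toReal_eq_zero_iff, hz]
  rw [e, mul_div_assoc, div_self e1, mul_one]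
  exact ht

open ProbabilityTheory in
lemma structure_opt {μ ν : Measure ℝ} [IsProbabilityMeasure μ] [IsProbabilityMeasure ν]
    (hμ : Integrable (fun x : ℝ => x) μ) (hν : Integrable (fun x : ℝ => x) ν)
    (hat : ∀ x : ℝ, μ {x} = 0)
    {π : Measure (ℝ × ℝ)} (hopt : IsOptimalMart (fun x y => |y - x|) μ ν π) :
    (∃ T1 T2 : ℝ → ℝ, Measurable T1 ∧ Measurable T2 ∧
      ∀ᵐ p ∂π, p.2 = p.1 ∨ (p.2 < p.1 ∧ p.2 = T1 p.1) ∨ (p.1 < p.2 ∧ p.2 = T2 p.1)) ∧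
    π.restrict {p : ℝ × ℝ | p.2 = p.1} = (μ ⊓ ν).map (fun x : ℝ => (x, x)) := by
  have hpr := coupling_prob hopt.1.1
  obtain ⟨κ, hκm, hκ⟩ : ∃ κ : Kernel ℝ ℝ, IsMarkovKernel κ ∧ μ ⊗ₘ κ = π := by
    refine ⟨π.condKernel, inferInstance, ?_⟩
    have := π.disintegrate π.condKernel
    rwa [Measure.fst, hopt.1.1.1] at this
  have good := good_points hμ hν hat hopt κ hκ
  constructor
  · have mi : ∀ s : Set (ℝ × ℝ), MeasurableSet s → ∀ g : ℝ → ℝ, Measurable g →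
        Measurable (fun u => ∫ y, ({y | (u, y) ∈ s} : Set ℝ).indicator g y ∂(κ u)) := by
      intro s hs g hg
      refine StronglyMeasurable.measurable ?_
      refine StronglyMeasurable.integral_kernel_prod_right
        (f := fun u y => ({y | (u, y) ∈ s} : Set ℝ).indicator g y) ?_
      have : Function.uncurry (fun u y => ({y | (u, y) ∈ s} : Set ℝ).indicator g y) =
          s.indicator (fun p => g p.2) := by
        ext p
        simp [Function.uncurry, indicator]
      rw [this]
      exact ((hg.comp measurable_snd).indicator hs).stronglyMeasurable
    have m1 : MeasurableSet {p : ℝ × ℝ | p.2 < p.1} := measurableSet_lt measurable_snd measurable_fst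
    have m2 : MeasurableSet {p : ℝ × ℝ | p.1 < p.2} := measurableSet_lt measurable_fst measurable_snd
    set T1 : ℝ → ℝ := fun u =>
      (∫ y, ({y | (u, y) ∈ {p : ℝ × ℝ | p.2 < p.1}} : Set ℝ).indicator (fun y => y) y ∂(κ u)) /
      (∫ y, ({y | (u, y) ∈ {p : ℝ × ℝ | p.2 < p.1}} : Set ℝ).indicator (fun _ => (1 : ℝ)) y ∂(κ u))
      with hT1
    set T2 : ℝ → ℝ := fun u =>
      (∫ y, ({y | (u, y) ∈ {p : ℝ × ℝ | p.1 < p.2}} : Set ℝ).indicator (fun y => y) y ∂(κ u)) /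
      (∫ y, ({y | (u, y) ∈ {p : ℝ × ℝ | p.1 < p.2}} : Set ℝ).indicator (fun _ => (1 : ℝ)) y ∂(κ u))
      with hT2
    have mT1 : Measurable T1 := (mi _ m1 _ measurable_id).div (mi _ m1 _ measurable_const)
    have mT2 : Measurable T2 := (mi _ m2 _ measurable_id).div (mi _ m2 _ measurable_const)
    refine ⟨T1, T2, mT1, mT2, ?_⟩
    have hm : MeasurableSet {p : ℝ × ℝ | p.2 = p.1 ∨ (p.2 < p.1 ∧ p.2 = T1 p.1) ∨
        (p.1 < p.2 ∧ p.2 = T2 p.1)} :=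
      meas_diag.union ((m1.inter (measurableSet_eq_fun measurable_snd (mT1.comp measurable_fst))).union
        (m2.inter (measurableSet_eq_fun measurable_snd (mT2.comp measurable_fst))))
    rw [← hκ, Measure.ae_compProd_iff hm]
    filter_upwards [good] with u hu
    have a1 := atom_formula {y | (u, y) ∈ {p : ℝ × ℝ | p.2 < p.1}} measurableSet_Iio hu.2.2.1
    have a2 := atom_formula {y | (u, y) ∈ {p : ℝ × ℝ | p.1 < p.2}} measurableSet_Ioi hu.2.1
    filter_upwards [a1, a2] with y h1 h2
    rcases lt_trichotomy y u with h | h | h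
    · exact Or.inr (Or.inl ⟨h, h1 h⟩)
    · exact Or.inl h
    · exact Or.inr (Or.inr ⟨h, h2 h⟩)
  · obtain ⟨hr1, hr2⟩ := restrict_diag π
    set D := {p : ℝ × ℝ | p.2 = p.1} with hD
    set δ := (π.restrict D).map Prod.fst with hδ
    suffices h : δ = μ ⊓ ν by rw [hr1, h]
    apply le_antisymm
    · refine le_inf ?_ ?_
      · rw [← hopt.1.1.1]
        exact Measure.map_mono Measure.restrict_le_self measurable_fst
      · rw [← hr2, ← hopt.1.1.2]
        exact Measure.map_mono Measure.restrict_le_self measurable_snd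
    · have mG0 : Measurable (fun u => κ u (Ioi u)) :=
        Kernel.measurable_kernel_prodMk_left
          (measurableSet_lt measurable_fst measurable_snd : MeasurableSet {p : ℝ × ℝ | p.1 < p.2})
      have mG : MeasurableSet {u | κ u (Ioi u) = 0} := mG0 (measurableSet_singleton 0)
      have q1 : ∀ᵐ p ∂π, κ p.1 (Ioi p.1) = 0 → p.2 = p.1 := by
        have hm : MeasurableSet {p : ℝ × ℝ | κ p.1 (Ioi p.1) = 0 → p.2 = p.1} := by
          have : {p : ℝ × ℝ | κ p.1 (Ioi p.1) = 0 → p.2 = p.1} =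
              (Prod.fst ⁻¹' {u | κ u (Ioi u) = 0})ᶜ ∪ D := by
            ext p
            simp [hD, imp_iff_not_or]
          rw [this]
          exact (measurable_fst mG).compl.union meas_diag
        rw [← hκ, Measure.ae_compProd_iff hm]
        filter_upwards [good] with u hu
        by_cases hz : κ u (Ioi u) = 0
        · filter_upwards [hu.1 hz] with y hy _ using hy
        · exact ae_of_all _ fun y h => (hz h).elim
      set Z := toMeasurable μ {u | ¬ (κ u (Ioi u) ≠ 0 → ∀ u', (u', u) ∈ π.support → u' = u)} with hZ
      have mZ : MeasurableSet Z := measurableSet_toMeasurable _ _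
      have hZ0 : μ Z = 0 := by
        rw [hZ, measure_toMeasurable, ← ae_iff]
        filter_upwards [good] with u hu using hu.2.2.2
      have hZs : ∀ u, u ∉ Z → κ u (Ioi u) ≠ 0 → ∀ u', (u', u) ∈ π.support → u' = u := by
        intro u hu
        by_contra hcon
        exact hu (subset_toMeasurable _ _ hcon)
      have q2 : ∀ᵐ p ∂π, p.2 ∉ Z → κ p.2 (Ioi p.2) ≠ 0 → p.2 = p.1 := by
        have : ∀ᵐ p ∂π, p ∈ π.support := Measure.support_mem_ae
        filter_upwards [this] with p hp h1 h2
        exact (hZs _ h1 h2 p.1 hp).symm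
      refine Measure.le_intro fun A hA _ => ?_
      have δval : ∀ E, MeasurableSet E → δ E = π (Prod.fst ⁻¹' E ∩ D) ∧
          δ E = π (Prod.snd ⁻¹' E ∩ D) := by
        intro E hE
        refine ⟨?_, ?_⟩
        · rw [hδ, Measure.map_apply measurable_fst hE, Measure.restrict_apply (measurable_fst hE)]
        · rw [← hr2, Measure.map_apply measurable_snd hE,
            Measure.restrict_apply (measurable_snd hE)]
      have hA1 : MeasurableSet (A ∩ {u | κ u (Ioi u) = 0}) := hA.inter mG
      have hA2 : MeasurableSet (A ∩ ({u | κ u (Ioi u) = 0}ᶜ ∩ Zᶜ)) :=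
        hA.inter (mG.compl.inter mZ.compl)
      have b1 : (μ ⊓ ν) (A ∩ {u | κ u (Ioi u) = 0}) ≤ δ (A ∩ {u | κ u (Ioi u) = 0}) := by
        refine ((inf_le_left : μ ⊓ ν ≤ μ) _).trans ?_
        rw [(δval _ hA1).1, ← hopt.1.1.1, Measure.map_apply measurable_fst hA1]
        refine measure_mono_ae ?_
        filter_upwards [q1] with p hp h
        exact ⟨h, hp h.2⟩
      have b2 : (μ ⊓ ν) (A ∩ ({u | κ u (Ioi u) = 0}ᶜ ∩ Zᶜ)) ≤
          δ (A ∩ ({u | κ u (Ioi u) = 0}ᶜ ∩ Zᶜ)) := by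
        refine ((inf_le_right : μ ⊓ ν ≤ ν) _).trans ?_
        rw [(δval _ hA2).2]
        conv_lhs => rw [← hopt.1.1.2, Measure.map_apply measurable_snd hA2]
        refine measure_mono_ae ?_
        filter_upwards [q2] with p hp h
        exact ⟨h, hp h.2.2 h.2.1⟩
      have b3 : (μ ⊓ ν) Z = 0 := le_antisymm (((inf_le_left : μ ⊓ ν ≤ μ) _).trans hZ0.le) bot_le
      have cov : A ⊆ (A ∩ {u | κ u (Ioi u) = 0}) ∪ (A ∩ ({u | κ u (Ioi u) = 0}ᶜ ∩ Zᶜ)) ∪ Z := by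
        intro x hx
        by_cases h1 : κ x (Ioi x) = 0
        · exact Or.inl (Or.inl ⟨hx, h1⟩)
        · by_cases h2 : x ∈ Z
          · exact Or.inr h2
          · exact Or.inl (Or.inr ⟨hx, h1, h2⟩)
      calc (μ ⊓ ν) A ≤ _ := measure_mono cov
        _ ≤ (μ ⊓ ν) (A ∩ {u | κ u (Ioi u) = 0}) +
            (μ ⊓ ν) (A ∩ ({u | κ u (Ioi u) = 0}ᶜ ∩ Zᶜ)) + (μ ⊓ ν) Z :=
          (measure_union_le _ _).trans (add_le_add_left (measure_union_le _ _) _)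
        _ ≤ δ (A ∩ {u | κ u (Ioi u) = 0}) + δ (A ∩ ({u | κ u (Ioi u) = 0}ᶜ ∩ Zᶜ)) := by
          rw [b3, add_zero]
          exact add_le_add b1 b2
        _ = δ ((A ∩ {u | κ u (Ioi u) = 0}) ∪ (A ∩ ({u | κ u (Ioi u) = 0}ᶜ ∩ Zᶜ))) := by
          rw [measure_union _ hA2]
          rw [Set.disjoint_left]
          rintro x ⟨_, h1⟩ ⟨_, h2, _⟩
          exact h2 h1
        _ ≤ δ A := measure_mono (union_subset inter_subset_left inter_subset_left)

open ProbabilityTheory in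
lemma mart_meas {μ ν : Measure ℝ} [IsProbabilityMeasure μ]
    (hμ : Integrable (fun x : ℝ => x) μ) (hν : Integrable (fun x : ℝ => x) ν)
    {π : Measure (ℝ × ℝ)} (h : IsMartingaleCoupling μ ν π) (β : ℝ → ℝ)
    (hi : Integrable (fun p : ℝ × ℝ => β p.1 * (p.2 - p.1)) π) :
    ∫ p : ℝ × ℝ, β p.1 * (p.2 - p.1) ∂π = 0 := by
  have hpr := coupling_prob h.1
  obtain ⟨κ, hκm, hκ⟩ : ∃ κ : Kernel ℝ ℝ, IsMarkovKernel κ ∧ μ ⊗ₘ κ = π := by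
    refine ⟨π.condKernel, inferInstance, ?_⟩
    have := π.disintegrate π.condKernel
    rwa [Measure.fst, h.1.1] at this
  have hk := mart_kernel hμ hν h κ hκ
  rw [← hκ] at hi ⊢
  rw [Measure.integral_compProd hi]
  rw [← integral_zero ℝ ℝ (μ := μ)]
  apply integral_congr_ae
  filter_upwards [hk] with u hu
  rw [integral_const_mul, hu.2, mul_zero]

lemma unique_of_graph {μ ν : Measure ℝ} [IsProbabilityMeasure μ]
    (hμ : Integrable (fun x : ℝ => x) μ) (hν : Integrable (fun x : ℝ => x) ν)
    {π1 π2 : Measure (ℝ × ℝ)} (h1 : IsMartingaleCoupling μ ν π1)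
    (h2 : IsMartingaleCoupling μ ν π2) (T1 T2 : ℝ → ℝ) (mT1 : Measurable T1)
    (mT2 : Measurable T2) (l1 : ∀ x, T1 x < x) (l2 : ∀ x, x < T2 x)
    (a1 : ∀ᵐ p ∂π1, p.2 = p.1 ∨ p.2 = T1 p.1 ∨ p.2 = T2 p.1)
    (a2 : ∀ᵐ p ∂π2, p.2 = p.1 ∨ p.2 = T1 p.1 ∨ p.2 = T2 p.1)
    (hD : π1.restrict {p : ℝ × ℝ | p.2 = p.1} = π2.restrict {p : ℝ × ℝ | p.2 = p.1}) :
    π1 = π2 := by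
  have p1 := coupling_prob h1.1
  have p2 := coupling_prob h2.1
  ext A hA
  set F : ℝ × ℝ → ℝ := A.indicator (fun _ => (1 : ℝ)) with hF
  have mF : Measurable F := measurable_const.indicator hA
  have F0 : ∀ p, 0 ≤ F p := fun p => indicator_nonneg (fun _ _ => zero_le_one) p
  have F1 : ∀ p, F p ≤ 1 := fun p => indicator_le_self' (fun _ _ => zero_le_one) p
  set β : ℝ → ℝ := fun x => (F (x, T2 x) - F (x, T1 x)) / (T2 x - T1 x) with hβ
  set α : ℝ → ℝ := fun x => F (x, T1 x) + β x * (x - T1 x) with hα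
  have mβ : Measurable β := by
    refine Measurable.div (Measurable.sub ?_ ?_) (mT2.sub mT1)
    · exact mF.comp (measurable_id.prodMk mT2)
    · exact mF.comp (measurable_id.prodMk mT1)
  have mα : Measurable α :=
    (mF.comp (measurable_id.prodMk mT1)).add (mβ.mul (measurable_id.sub mT1))
  have bβ : ∀ x t, |t| ≤ T2 x - T1 x → |β x * t| ≤ 1 := by
    intro x t ht
    have hpos : 0 < T2 x - T1 x := by linarith [l1 x, l2 x]
    rw [abs_mul, hβ]
    simp only
    rw [abs_div, abs_of_pos hpos, div_mul_eq_mul_div, div_le_one hpos]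
    have : |F (x, T2 x) - F (x, T1 x)| ≤ 1 := abs_le.2
      ⟨by linarith [F0 (x, T2 x), F1 (x, T1 x)], by linarith [F1 (x, T2 x), F0 (x, T1 x)]⟩
    nlinarith [abs_nonneg (F (x, T2 x) - F (x, T1 x)), abs_nonneg t]
  have bα : ∀ x, |α x| ≤ 2 := by
    intro x
    have := bβ x (x - T1 x) (abs_le.2 ⟨by linarith [l1 x, l2 x], by linarith [l2 x]⟩)
    have q := abs_le.1 this
    exact abs_le.2 ⟨by linarith [F0 (x, T1 x)], by linarith [F1 (x, T1 x)]⟩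
  have main : ∀ π : Measure (ℝ × ℝ), IsMartingaleCoupling μ ν π →
      (∀ᵐ p ∂π, p.2 = p.1 ∨ p.2 = T1 p.1 ∨ p.2 = T2 p.1) →
      π.real A = ∫ x, α x ∂μ + ∫ p, (F p - α p.1) ∂(π.restrict {p : ℝ × ℝ | p.2 = p.1}) := by
    intro π h a
    have hp := coupling_prob h.1
    have iF : Integrable F π := Integrable.of_bound mF.aestronglyMeasurable 1
      (ae_of_all _ fun p => by rw [Real.norm_of_nonneg (F0 p)]; exact F1 p)
    have iα : Integrable α μ := Integrable.of_bound mα.aestronglyMeasurable 2 (ae_of_all _ bα)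
    have jα := coupling_int_fst h.1 iα
    have iβ : Integrable (fun p : ℝ × ℝ => β p.1 * (p.2 - p.1)) π := by
      refine Integrable.of_bound (Measurable.aestronglyMeasurable ?_) 1 ?_
      · exact (mβ.comp measurable_fst).mul (measurable_snd.sub measurable_fst)
      · filter_upwards [a] with p hp
        apply bβ
        have := l1 p.1
        have := l2 p.1
        rcases hp with h | h | h <;> rw [h] <;> exact abs_le.2 ⟨by linarith, by linarith⟩
    have iD : Integrable (({p : ℝ × ℝ | p.2 = p.1}).indicator (fun p => F p - α p.1)) π :=
      (iF.sub jα.1).indicator meas_diag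
    have e : ∫ p, F p ∂π = ∫ p, (α p.1 + β p.1 * (p.2 - p.1) +
        ({p : ℝ × ℝ | p.2 = p.1}).indicator (fun p => F p - α p.1) p) ∂π := by
      apply integral_congr_ae
      filter_upwards [a] with p hp
      obtain ⟨x, y⟩ := p
      have k1 := l1 x
      have k2 := l2 x
      have hpos : T2 x - T1 x ≠ 0 := by
        have : 0 < T2 x - T1 x := by linarith
        exact this.ne'
      simp only at hp
      rcases hp with h | h | h
      · subst h
        simp
      · have hn : (x, y) ∉ {p : ℝ × ℝ | p.2 = p.1} := by
          intro h'
          have : y = x := h'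
          linarith
        rw [indicator_of_notMem hn]
        subst h
        simp only [hα]
        ring
      · have hn : (x, y) ∉ {p : ℝ × ℝ | p.2 = p.1} := by
          intro h'
          have : y = x := h'
          linarith
        rw [indicator_of_notMem hn]
        subst h
        have hb : β x * (T2 x - T1 x) = F (x, T2 x) - F (x, T1 x) := by
          simp only [hβ]
          field_simp
        simp only [hα]
        linear_combination -hb
    have i12 : Integrable (fun p : ℝ × ℝ => α p.1 + β p.1 * (p.2 - p.1)) π := jα.1.add iβ
    rw [integral_add i12 iD, integral_add jα.1 iβ, mart_meas hμ hν h β iβ, jα.2, add_zero,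
      integral_indicator meas_diag] at e
    rw [← e, hF, integral_indicator hA]
    simp
  have e1 := main π1 h1 a1
  have e2 := main π2 h2 a2
  rw [hD, ← e2] at e1
  exact (measureReal_eq_measureReal_iff).1 e1

lemma half_optimal {μ ν : Measure ℝ} [IsProbabilityMeasure μ]
    (hμ : Integrable (fun x : ℝ => x) μ) (hν : Integrable (fun x : ℝ => x) ν)
    {π1 π2 : Measure (ℝ × ℝ)}
    (h1 : IsOptimalMart (fun x y => |y - x|) μ ν π1)
    (h2 : IsOptimalMart (fun x y => |y - x|) μ ν π2) :
    IsOptimalMart (fun x y => |y - x|) μ ν ((2⁻¹ : ENNReal) • (π1 + π2)) := by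
  have hh : ∀ {X : Type} [MeasurableSpace X] (m : Measure X), (2⁻¹ : ENNReal) • (m + m) = m := by
    intro X _ m
    rw [← two_smul ENNReal m, smul_smul, ENNReal.inv_mul_cancel (by norm_num) (by norm_num),
      one_smul]
  have hI : ∀ f : ℝ × ℝ → ℝ, Integrable f π1 → Integrable f π2 →
      Integrable f ((2⁻¹ : ENNReal) • (π1 + π2)) ∧
      ∫ p, f p ∂((2⁻¹ : ENNReal) • (π1 + π2)) = (∫ p, f p ∂π1 + ∫ p, f p ∂π2) / 2 := by
    intro f i1 i2
    refine ⟨(i1.add_measure i2).smul_measure (by norm_num), ?_⟩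
    rw [integral_smul_measure, integral_add_measure i1 i2]
    simp
    ring
  have c1 := hI _ h1.2.1 h2.2.1
  refine ⟨⟨⟨?_, ?_⟩, ?_⟩, c1.1, ?_⟩
  · rw [Measure.map_smul, Measure.map_add _ _ measurable_fst, h1.1.1.1, h2.1.1.1, hh]
  · rw [Measure.map_smul, Measure.map_add _ _ measurable_snd, h1.1.1.2, h2.1.1.2, hh]
  · intro ρ hρ hb
    rw [(hI _ (coupling_int_rho h1.1.1 hμ hν hρ hb) (coupling_int_rho h2.1.1 hμ hν hρ hb)).2,
      h1.1.2 ρ hρ hb, h2.1.2 ρ hρ hb]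
    simp
  · intro π' hπ' hi
    have q1 := h1.2.2 π' hπ' hi
    have q2 := h2.2.2 π' hπ' hi
    rw [c1.2]
    linarith

lemma unique_opt {μ ν : Measure ℝ} [IsProbabilityMeasure μ] [IsProbabilityMeasure ν]
    (hμ : Integrable (fun x : ℝ => x) μ) (hν : Integrable (fun x : ℝ => x) ν)
    (hat : ∀ x : ℝ, μ {x} = 0) {π1 π2 : Measure (ℝ × ℝ)}
    (h1 : IsOptimalMart (fun x y => |y - x|) μ ν π1)
    (h2 : IsOptimalMart (fun x y => |y - x|) μ ν π2) : π1 = π2 := by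
  obtain ⟨⟨T1, T2, m1, m2, hT⟩, -⟩ := structure_opt hμ hν hat (half_optimal hμ hν h1 h2)
  have d1 := (structure_opt hμ hν hat h1).2
  have d2 := (structure_opt hμ hν hat h2).2
  have hT' := (Measure.ae_ennreal_smul_measure_iff (by norm_num : (2⁻¹ : ENNReal) ≠ 0)).1 hT
  rw [ae_add_measure_iff] at hT'
  set S1 : ℝ → ℝ := fun x => if T1 x < x then T1 x else x - 1 with hS1
  set S2 : ℝ → ℝ := fun x => if x < T2 x then T2 x else x + 1 with hS2
  have conv : ∀ π : Measure (ℝ × ℝ), (∀ᵐ p ∂π, p.2 = p.1 ∨ (p.2 < p.1 ∧ p.2 = T1 p.1) ∨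
      (p.1 < p.2 ∧ p.2 = T2 p.1)) → ∀ᵐ p ∂π, p.2 = p.1 ∨ p.2 = S1 p.1 ∨ p.2 = S2 p.1 := by
    intro π h
    filter_upwards [h] with p hp
    rcases hp with h | ⟨h, h'⟩ | ⟨h, h'⟩
    · exact Or.inl h
    · refine Or.inr (Or.inl ?_)
      rw [h'] at h
      simp only [hS1, if_pos h, h']
    · refine Or.inr (Or.inr ?_)
      rw [h'] at h
      simp only [hS2, if_pos h, h']
  refine unique_of_graph hμ hν h1.1 h2.1 S1 S2 ?_ ?_ ?_ ?_ (conv _ hT'.1) (conv _ hT'.2)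
    (d1.trans d2.symm)
  · exact Measurable.ite (measurableSet_lt m1 measurable_id) m1 (by fun_prop)
  · exact Measurable.ite (measurableSet_lt measurable_id m2) m2 (by fun_prop)
  · intro x
    simp only [hS1]
    split_ifs with h
    · exact h
    · linarith
  · intro x
    simp only [hS2]
    split_ifs with h
    · exact h
    · linarith

/-- for the cost `c(x,y) = |y-x|` and continuous `μ`, there is exactly
one optimal martingale transport plan; it decomposes as `π_stay + π_go` where
`π_stay` is `μ ⊓ ν` put on the diagonal and `π_go` lives on two graphs; in particular
`π` is concentrated on a set with vertical fibers of at most `3` points. -/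
theorem hobson_klimmek
    (μ ν : MeasureTheory.Measure ℝ)
    [MeasureTheory.IsProbabilityMeasure μ] [MeasureTheory.IsProbabilityMeasure ν]
    (hμ : MeasureTheory.Integrable (fun x : ℝ => x) μ)
    (hν : MeasureTheory.Integrable (fun x : ℝ => x) ν)
    (hord : ConvexOrder μ ν)
    (hatomless : ∀ x : ℝ, μ {x} = 0) :
    (∃! π : MeasureTheory.Measure (ℝ × ℝ),
      IsOptimalMart (fun x y => |y - x|) μ ν π) ∧
    ∀ π : MeasureTheory.Measure (ℝ × ℝ), IsOptimalMart (fun x y => |y - x|) μ ν π →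
      (∃ (T₁ T₂ : ℝ → ℝ) (πgo : MeasureTheory.Measure (ℝ × ℝ)),
        π = MeasureTheory.Measure.map (fun x : ℝ => (x, x)) (μ ⊓ ν) + πgo ∧
        πgo ({p : ℝ × ℝ | p.2 = T₁ p.1 ∨ p.2 = T₂ p.1}ᶜ) = 0) ∧
      (∃ Γ : Set (ℝ × ℝ), π Γ = 1 ∧
        ∀ x : ℝ, ({y : ℝ | (x, y) ∈ Γ}).encard ≤ (3 : ℕ∞)) := by
  refine ⟨?_, ?_⟩
  · obtain ⟨π, hπ⟩ := exists_optimal hμ hν hord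
    exact ⟨π, hπ, fun π' hπ' => unique_opt hμ hν hatomless hπ' hπ⟩
  · intro π hπ
    have hpr := coupling_prob hπ.1.1
    obtain ⟨⟨T1, T2, m1, m2, hT⟩, hD⟩ := structure_opt hμ hν hatomless hπ
    constructor
    · refine ⟨T1, T2, π.restrict {p : ℝ × ℝ | p.2 = p.1}ᶜ, ?_, ?_⟩
      · rw [← hD, Measure.restrict_add_restrict_compl meas_diag]
      · have hae : ∀ᵐ p ∂(π.restrict {p : ℝ × ℝ | p.2 = p.1}ᶜ), p.2 = T1 p.1 ∨ p.2 = T2 p.1 := by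
          filter_upwards [ae_restrict_of_ae hT, ae_restrict_mem meas_diag.compl] with p h1 h2
          rcases h1 with h | h | h
          · exact (h2 h).elim
          · exact Or.inl h.2
          · exact Or.inr h.2
        exact ae_iff.1 hae
    · refine ⟨{p : ℝ × ℝ | p.2 = p.1 ∨ p.2 = T1 p.1 ∨ p.2 = T2 p.1}, ?_, ?_⟩
      · have : {p : ℝ × ℝ | p.2 = p.1 ∨ p.2 = T1 p.1 ∨ p.2 = T2 p.1} =ᵐ[π] univ := by
          rw [eventuallyEq_univ]
          filter_upwards [hT] with p hp
          rcases hp with h | h | h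
          · exact Or.inl h
          · exact Or.inr (Or.inl h.2)
          · exact Or.inr (Or.inr h.2)
        rw [measure_congr this, measure_univ]
      · intro x
        have : {y : ℝ | (x, y) ∈ {p : ℝ × ℝ | p.2 = p.1 ∨ p.2 = T1 p.1 ∨ p.2 = T2 p.1}} =
            {x, T1 x, T2 x} := by
          ext y
          simp
        rw [this]
        refine (Set.encard_insert_le _ _).trans ?_
        refine (add_le_add_left (Set.encard_insert_le _ _) _).trans ?_
        rw [Set.encard_singleton]
        norm_num
end
end

section
/- For μ ∈ 𝓜 define the potential function u_μ(x) = ∫ |y−x| dμ(y). If μ ∈ 𝓜 is nonzero with mass k = μ(ℝ) and barycenter m = (1/k)∫ y dμ(y), then u_μ is convex and u_μ(x) − k|x−m| → 0 both as x → +∞ and as x → −∞. Conversely, given k ∈ [0,∞) and m ∈ ℝ, if f : ℝ → ℝ is convex and f(x) − k|x−m| → 0 as x → +∞ and as x → −∞, then there exists a unique μ ∈ 𝓜 such that f(x) = ∫ |y−x| dμ(y) for all x ∈ ℝ. -/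
open MeasureTheory Set Filter Topology

noncomputable section

lemma pf_int_abs {μ : Measure ℝ} [IsFiniteMeasure μ] (h : Integrable (fun x : ℝ => x) μ) (x : ℝ) :
    Integrable (fun y => |y - x|) μ := (h.sub (integrable_const x)).abs

lemma pf_int_max {μ : Measure ℝ} [IsFiniteMeasure μ] (h : Integrable (fun x : ℝ => x) μ) (x : ℝ) :
    Integrable (fun y => max (y - x) 0) μ := (h.sub (integrable_const x)).pos_part

lemma pf_convex {μ : Measure ℝ} [IsFiniteMeasure μ] (h : Integrable (fun x : ℝ => x) μ) :
    ConvexOn ℝ univ (fun x : ℝ => ∫ y, |y - x| ∂μ) := by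
  refine ⟨convex_univ, ?_⟩
  intro x _ z _ a b ha hb hab
  simp only [smul_eq_mul]
  rw [← integral_const_mul, ← integral_const_mul, ← integral_add ((pf_int_abs h x).const_mul a)
    ((pf_int_abs h z).const_mul b)]
  refine integral_mono (pf_int_abs h _) (((pf_int_abs h x).const_mul a).add
    ((pf_int_abs h z).const_mul b)) ?_
  intro y
  simp only
  have : y - (a * x + b * z) = a * (y - x) + b * (y - z) := by
    linear_combination -(y * hab)
  rw [this]
  calc _ ≤ |a * (y - x)| + |b * (y - z)| := abs_add_le _ _
    _ = _ := by rw [abs_mul, abs_mul, abs_of_nonneg ha, abs_of_nonneg hb]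

lemma pf_tail {μ : Measure ℝ} [IsFiniteMeasure μ] (h : Integrable (fun x : ℝ => x) μ) :
    Tendsto (fun x : ℝ => ∫ y, max (y - x) 0 ∂μ) atTop (𝓝 0) := by
  have : Tendsto (fun x : ℝ => ∫ y, max (y - x) 0 ∂μ) atTop (𝓝 (∫ y, (0:ℝ) ∂μ)) := ?_
  · simpa using this
  refine tendsto_integral_filter_of_dominated_convergence (fun y => |y|) ?_ ?_ h.abs ?_
  · exact Eventually.of_forall fun x => (pf_int_max h x).aestronglyMeasurable
  · filter_upwards [eventually_ge_atTop (0:ℝ)] with x hx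
    refine Eventually.of_forall fun y => ?_
    rw [Real.norm_of_nonneg (le_max_right _ _)]
    exact max_le (by linarith [le_abs_self y]) (abs_nonneg y)
  · refine Eventually.of_forall fun y => ?_
    refine tendsto_const_nhds.congr' ?_
    filter_upwards [eventually_ge_atTop y] with x hx
    rw [max_eq_right (by linarith)]

lemma pf_lim_top {μ : Measure ℝ} [IsFiniteMeasure μ] (h : Integrable (fun x : ℝ => x) μ)
    (h0 : μ ≠ 0) :
    Tendsto (fun x : ℝ => (∫ y, |y - x| ∂μ) -
          (μ univ).toReal * |x - (∫ y, y ∂μ) / (μ univ).toReal|) atTop (𝓝 0) := by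
  have hk : 0 < (μ univ).toReal := by
    rw [ENNReal.toReal_pos_iff]
    exact ⟨by simpa [pos_iff_ne_zero] using h0, measure_lt_top _ _⟩
  have := (pf_tail h).const_mul 2
  rw [mul_zero] at this
  refine this.congr' ?_
  filter_upwards [eventually_ge_atTop ((∫ y, y ∂μ) / (μ univ).toReal)] with x hx
  rw [abs_of_nonneg (by linarith), mul_sub, mul_div_cancel₀ _ hk.ne']
  have e : ∀ y : ℝ, |y - x| = 2 * max (y - x) 0 + (x - y) := by
    intro y
    rcases le_total y x with hy | hy
    · rw [abs_of_nonpos (by linarith), max_eq_right (by linarith)]; ring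
    · rw [abs_of_nonneg (by linarith), max_eq_left (by linarith)]; ring
  simp_rw [e]
  rw [integral_add ((pf_int_max h x).const_mul 2) (show Integrable (fun y => x - y) μ from (integrable_const x).sub h),
    integral_const_mul, integral_sub (integrable_const x) h]
  simp [Measure.real]

lemma pf_lim_bot {μ : Measure ℝ} [IsFiniteMeasure μ] (h : Integrable (fun x : ℝ => x) μ)
    (h0 : μ ≠ 0) :
    Tendsto (fun x : ℝ => (∫ y, |y - x| ∂μ) -
          (μ univ).toReal * |x - (∫ y, y ∂μ) / (μ univ).toReal|) atBot (𝓝 0) := by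
  have hm : Measurable (fun x : ℝ => -x) := measurable_neg
  have hme : MeasurableEmbedding (fun x : ℝ => -x) := (Homeomorph.neg ℝ).measurableEmbedding
  have : IsFiniteMeasure (μ.map (fun x => -x)) := Measure.isFiniteMeasure_map μ _
  have h' : Integrable (fun x : ℝ => x) (μ.map (fun x => -x)) := by
    rw [hme.integrable_map_iff]; exact h.neg
  have h0' : μ.map (fun x => -x) ≠ 0 := by
    rwa [Ne, Measure.map_eq_zero_iff hm.aemeasurable]
  have := (pf_lim_top h' h0').comp tendsto_neg_atBot_atTop
  refine this.congr fun x => ?_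
  simp only [Function.comp]
  rw [hme.integral_map, hme.integral_map, Measure.map_apply hm MeasurableSet.univ, preimage_univ,
    integral_neg, neg_div, sub_neg_eq_add, ← abs_neg (x - _)]
  congr 1
  · refine integral_congr_ae (Eventually.of_forall fun y => ?_)
    simp only
    rw [← abs_neg]; congr 1; ring
  · congr 2; ring

lemma pf_D {μ : Measure ℝ} [IsFiniteMeasure μ] (h : Integrable (fun x : ℝ => x) μ) (x : ℝ) :
    Tendsto (fun t : ℝ => ((∫ y, |y - (x + t)| ∂μ) - ∫ y, |y - x| ∂μ) / t) (𝓝[>] 0)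
      (𝓝 (2 * μ.real (Iic x) - μ.real univ)) := by
  have e : 2 * μ.real (Iic x) - μ.real univ
      = ∫ y, (2 * (Iic x).indicator (fun _ => (1:ℝ)) y - 1) ∂μ := by
    rw [integral_sub, integral_const_mul, integral_indicator measurableSet_Iic]
    · simp
    · exact ((integrable_const 1).indicator measurableSet_Iic).const_mul 2
    · exact integrable_const 1
  rw [e]
  have e2 : ∀ t, ((∫ y, |y - (x + t)| ∂μ) - ∫ y, |y - x| ∂μ) / t =
      ∫ y, (|y - (x + t)| - |y - x|) / t ∂μ := by
    intro t
    rw [integral_div, integral_sub (pf_int_abs h _) (pf_int_abs h _)]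
  simp_rw [e2]
  refine tendsto_integral_filter_of_dominated_convergence (fun y => 1) ?_ ?_
    (integrable_const 1) ?_
  · exact Eventually.of_forall fun t =>
      (((pf_int_abs h _).sub (pf_int_abs h _)).div_const t).aestronglyMeasurable
  · filter_upwards [self_mem_nhdsWithin] with t (ht : 0 < t)
    refine Eventually.of_forall fun y => ?_
    rw [Real.norm_eq_abs, abs_div, abs_of_pos ht, div_le_one ht]
    refine (abs_abs_sub_abs_le_abs_sub _ _).trans ?_
    rw [show y - (x + t) - (y - x) = -t by ring, abs_neg, abs_of_pos ht]
  · refine Eventually.of_forall fun y => ?_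
    refine tendsto_const_nhds.congr' ?_
    by_cases hy : y ≤ x
    · filter_upwards [self_mem_nhdsWithin] with t (ht : 0 < t)
      rw [indicator_of_mem (by exact hy), abs_of_nonpos (by linarith), abs_of_nonpos (by linarith)]
      field_simp; ring
    · push Not at hy
      have : ∀ᶠ t in 𝓝[>] (0:ℝ), t < y - x :=
        nhdsWithin_le_nhds (eventually_lt_nhds (by linarith))
      filter_upwards [self_mem_nhdsWithin, this] with t (ht : 0 < t) ht2
      rw [indicator_of_notMem (by simpa using hy), abs_of_nonneg (by linarith),
        abs_of_nonneg (by linarith)]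
      field_simp; ring

lemma pf_unique {μ ν : Measure ℝ} [IsFiniteMeasure μ] [IsFiniteMeasure ν]
    (h : Integrable (fun x : ℝ => x) μ) (h' : Integrable (fun x : ℝ => x) ν)
    (e : ∀ x, ∫ y, |y - x| ∂μ = ∫ y, |y - x| ∂ν) : μ = ν := by
  have key : ∀ x, 2 * μ.real (Iic x) - μ.real univ = 2 * ν.real (Iic x) - ν.real univ := by
    intro x
    have h1 := pf_D h x
    have h2 := pf_D h' x
    simp_rw [e] at h1
    exact tendsto_nhds_unique h1 h2
  have lim : ∀ (ρ : Measure ℝ) [IsFiniteMeasure ρ],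
      Tendsto (fun x => 2 * ρ.real (Iic x) - ρ.real univ) atTop (𝓝 (ρ.real univ)) := by
    intro ρ _
    have := (((ENNReal.tendsto_toReal (measure_ne_top ρ univ)).comp
      (tendsto_measure_Iic_atTop ρ)).const_mul 2).sub_const (ρ.real univ)
    have e : 2 * (ρ univ).toReal - ρ.real univ = ρ.real univ := by
      simp only [Measure.real]; ring
    rw [e] at this
    exact this
  have hk : μ.real univ = ν.real univ := by
    have h1 := lim μ
    simp_rw [key] at h1
    exact tendsto_nhds_unique h1 (lim ν)
  refine Measure.ext_of_Iic μ ν fun a => ?_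
  have := key a
  rw [← ENNReal.toReal_eq_toReal_iff' (measure_ne_top _ _) (measure_ne_top _ _)]
  simp only [Measure.real] at *
  linarith

lemma pf_layer {μ : Measure ℝ} [IsFiniteMeasure μ] {φ : ℝ → ℝ}
    (h : ∀ a b, a ≤ b → ∫ t in a..b, μ.real (Ioi t) = φ a - φ b)
    (h0 : Tendsto φ atTop (𝓝 0)) (x : ℝ) :
    Integrable (fun y => max (y - x) 0) μ ∧ ∫ y, max (y - x) 0 ∂μ = φ x := by
  have hnn : 0 ≤ᵐ[μ] (fun y => max (y - x) 0) := Eventually.of_forall fun y => le_max_right _ _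
  have hanti : Antitone (fun t => μ.real (Ioi t)) := fun a b hab =>
    measureReal_mono (Ioi_subset_Ioi hab)
  have hlim : Tendsto (fun b => ∫ t in x..b, μ.real (Ioi t)) atTop (𝓝 (φ x)) := by
    have : Tendsto (fun b => φ x - φ b) atTop (𝓝 (φ x)) := by
      simpa using (tendsto_const_nhds (x := φ x)).sub h0
    refine this.congr' ?_
    filter_upwards [eventually_ge_atTop x] with b hb using (h x b hb).symm
  have hI : IntegrableOn (fun t => μ.real (Ioi t)) (Ioi x) := by
    refine integrableOn_Ioi_of_intervalIntegral_norm_tendsto (φ x) x (b := id) (l := atTop)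
      ?_ tendsto_id ?_
    · intro b
      exact (hanti.antitoneOn _).integrableOn_isCompact isCompact_Icc |>.mono_set Ioc_subset_Icc_self
    · simpa [abs_of_nonneg measureReal_nonneg] using hlim
  have hIv := tendsto_nhds_unique (intervalIntegral_tendsto_integral_Ioi x hI tendsto_id) hlim
  have hL : ∫⁻ y, ENNReal.ofReal (max (y - x) 0) ∂μ = ENNReal.ofReal (φ x) := by
    rw [lintegral_eq_lintegral_meas_lt μ hnn
      (by fun_prop)]
    rw [← hIv, ofReal_integral_eq_lintegral_ofReal hI
      (Eventually.of_forall fun t => measureReal_nonneg)]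
    have e := (measurePreserving_add_right (volume : Measure ℝ) x).setLIntegral_comp_preimage_emb
      (measurableEmbedding_addRight x) (fun t => ENNReal.ofReal (μ.real (Ioi t))) (Ioi x)
    rw [← e]
    have : (fun t : ℝ => t + x) ⁻¹' Ioi x = Ioi 0 := by ext; simp
    rw [this]
    refine setLIntegral_congr_fun measurableSet_Ioi fun t (ht : 0 < t) => ?_
    simp only [Measure.real]
    rw [ENNReal.ofReal_toReal (measure_ne_top _ _)]
    congr 1
    ext y
    simp only [mem_ofPred_eq, lt_max_iff, mem_Ioi]
    constructor
    · rintro (h | h) <;> linarith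
    · intro h; left; linarith
  have hInt : Integrable (fun y => max (y - x) 0) μ := by
    refine ⟨by fun_prop, ?_⟩
    rw [hasFiniteIntegral_iff_ofReal hnn, hL]
    exact ENNReal.ofReal_lt_top
  refine ⟨hInt, ?_⟩
  rw [integral_eq_lintegral_of_nonneg_ae hnn
    (by fun_prop), hL, ENNReal.toReal_ofReal]
  rw [← hIv]
  exact integral_nonneg fun t => measureReal_nonneg

lemma pf_exists {k m : ℝ} {f : ℝ → ℝ} (hf : ConvexOn ℝ univ f)
    (ht : Tendsto (fun x : ℝ => f x - k * |x - m|) atTop (𝓝 0))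
    (hb : Tendsto (fun x : ℝ => f x - k * |x - m|) atBot (𝓝 0)) :
    ∃ μ : Measure ℝ, IsFiniteMeasure μ ∧ Integrable (fun x : ℝ => x) μ ∧
        ∀ x : ℝ, f x = ∫ y, |y - x| ∂μ := by
  obtain ⟨F, hF⟩ : ∃ F : ℝ → ℝ, F = fun x => derivWithin f (Ioi x) x / 2 := ⟨_, rfl⟩
  have hder : ∀ x, HasDerivWithinAt f (2 * F x) (Ioi x) x := by
    intro x
    have := hf.hasDerivWithinAt_rightDeriv_of_mem_interior (x := x) (by simp)
    rw [hF]
    convert this using 1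
    ring
  have hmono : Monotone F := by
    intro a b hab
    have := hf.monotoneOn_rightDeriv (by simp : a ∈ interior univ) (by simp : b ∈ interior univ) hab
    simp only [hF]
    linarith
  have hup : ∀ x, 2 * F x ≤ f (x + 1) - f x := by
    intro x
    have := hf.le_slope_of_hasDerivWithinAt_Ioi (mem_univ x) (mem_univ (x + 1)) (by linarith)
      (hder x)
    simpa [slope_def_field] using this
  have hcont : Continuous f := by
    rw [← continuousOn_univ]; exact hf.continuousOn isOpen_univ
  have hFint : ∀ a b, IntervalIntegrable F volume a b := fun a b => hmono.intervalIntegrable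
  have hFTC : ∀ a b, a ≤ b → ∫ t in a..b, F t = (f b - f a) / 2 := by
    intro a b hab
    have := intervalIntegral.integral_eq_sub_of_hasDeriv_right_of_le hab hcont.continuousOn
      (fun x _ => hder x) ((hFint a b).const_mul 2)
    rw [intervalIntegral.integral_const_mul] at this
    linarith
  have hlow : ∀ x, f x - f (x - 1) ≤ 2 * F x := by
    intro x
    have h1 := hFTC (x - 1) x (by linarith)
    have h2 : ∫ t in (x-1)..x, F t ≤ ∫ t in (x-1)..x, F x :=
      intervalIntegral.integral_mono_on (by linarith) (hFint _ _) (by simp) fun t ht => hmono ht.2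
    simp at h2
    linarith
  have hd_top : Tendsto (fun x => f (x + 1) - f x) atTop (𝓝 k) := by
    have := ((ht.comp (tendsto_atTop_add_const_right atTop 1 tendsto_id)).sub ht).add_const k
    simp only [sub_zero, zero_add] at this
    refine this.congr' ?_
    filter_upwards [eventually_ge_atTop m] with x hx
    simp only [Function.comp, id]
    rw [abs_of_nonneg (by linarith), abs_of_nonneg (by linarith)]
    ring
  have hd_bot : Tendsto (fun x => f (x + 1) - f x) atBot (𝓝 (-k)) := by
    have := ((hb.comp (tendsto_atBot_add_const_right atBot 1 tendsto_id)).sub hb).add_const (-k)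
    simp only [sub_zero, zero_add] at this
    refine this.congr' ?_
    filter_upwards [eventually_le_atBot (m - 1)] with x hx
    simp only [Function.comp, id]
    rw [abs_of_nonpos (by linarith), abs_of_nonpos (by linarith)]
    ring
  have hF_top : Tendsto F atTop (𝓝 (k / 2)) := by
    refine tendsto_of_tendsto_of_tendsto_of_le_of_le
      ((hd_top.comp (tendsto_atTop_add_const_right atTop (-1) tendsto_id)).div_const 2)
      (hd_top.div_const 2) (fun x => ?_) (fun x => ?_)
    · have := hlow x
      simp only [Function.comp, id, ← sub_eq_add_neg, sub_add_cancel]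
      linarith
    · have := hup x
      simp only
      linarith
  have hF_bot : Tendsto F atBot (𝓝 (-(k / 2))) := by
    rw [← neg_div]
    refine tendsto_of_tendsto_of_tendsto_of_le_of_le
      ((hd_bot.comp (tendsto_atBot_add_const_right atBot (-1) tendsto_id)).div_const 2)
      (hd_bot.div_const 2) (fun x => ?_) (fun x => ?_)
    · have := hlow x
      simp only [Function.comp, id, ← sub_eq_add_neg, sub_add_cancel]
      linarith
    · have := hup x
      simp only
      linarith
  have hG_top : Tendsto hmono.stieltjesFunction atTop (𝓝 (k / 2)) :=
    tendsto_rightLim_atTop_of_tendsto hF_top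
  have hG_bot : Tendsto hmono.stieltjesFunction atBot (𝓝 (-(k / 2))) :=
    tendsto_rightLim_atBot_of_tendsto hF_bot
  have hfin : IsFiniteMeasure hmono.stieltjesFunction.measure :=
    StieltjesFunction.isFiniteMeasure _ hG_bot hG_top
  have hIoi := StieltjesFunction.measure_Ioi _ hG_top
  have hIio := StieltjesFunction.measure_Iio _ hG_bot
  have hFk : ∀ t, F t ≤ k / 2 := fun t => hmono.ge_of_tendsto hF_top t
  have hFk' : ∀ t, -(k / 2) ≤ F t := fun t => hmono.le_of_tendsto hF_bot t
  generalize hμ : hmono.stieltjesFunction.measure = μ at *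
  have hae : ∀ᵐ t, ContinuousAt F t := by
    have := hmono.countable_not_continuousAt.ae_notMem volume
    filter_upwards [this] with t ht
    simpa using ht
  have hIoi' : ∀ᵐ t, μ.real (Ioi t) = k / 2 - F t := by
    filter_upwards [hae] with t ht
    rw [Measure.real, hIoi, hmono.stieltjesFunction_eq, ht.continuousWithinAt.rightLim_eq,
      ENNReal.toReal_ofReal (by linarith [hFk t])]
  have hIio' : ∀ᵐ t, μ.real (Iio t) = k / 2 + F t := by
    filter_upwards [hae] with t ht
    have e : Function.leftLim hmono.stieltjesFunction t = F t := by
      have : Function.leftLim (Function.rightLim F) t = Function.leftLim F t :=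
        leftLim_rightLim (hmono.tendsto_leftLim t)
      rw [ht.continuousWithinAt.leftLim_eq] at this
      exact this
    rw [Measure.real, hIio, e, ENNReal.toReal_ofReal (by linarith [hFk' t])]
    ring
  have hP := pf_layer (μ := μ) (φ := fun x => (f x - k * (x - m)) / 2) (by
    intro a b hab
    rw [intervalIntegral.integral_congr_ae (hIoi'.mono fun t ht _ => ht),
      intervalIntegral.integral_sub (by simp) (hFint _ _), hFTC a b hab]
    simp
    ring) (by
    have := ht.div_const 2
    rw [zero_div] at this
    refine this.congr' ?_
    filter_upwards [eventually_ge_atTop m] with x hx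
    rw [abs_of_nonneg (by linarith)])
  have hme : MeasurableEmbedding (fun x : ℝ => -x) := (Homeomorph.neg ℝ).measurableEmbedding
  have : IsFiniteMeasure (μ.map (fun x => -x)) := Measure.isFiniteMeasure_map μ _
  have hQ := pf_layer (μ := μ.map (fun x => -x)) (φ := fun x => (f (-x) + k * (-x - m)) / 2) (by
    intro a b hab
    have e : ∀ t, (μ.map (fun x => -x)).real (Ioi t) = μ.real (Iio (-t)) := by
      intro t
      rw [Measure.real, Measure.map_apply measurable_neg measurableSet_Ioi, Measure.real]
      congr 2
      ext y
      simp
    simp_rw [e]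
    rw [intervalIntegral.integral_comp_neg (fun t => μ.real (Iio t)),
      intervalIntegral.integral_congr_ae (hIio'.mono fun t ht _ => ht),
      intervalIntegral.integral_add (by simp) (hFint _ _), hFTC _ _ (neg_le_neg hab)]
    simp
    ring) (by
    have := (hb.comp tendsto_neg_atTop_atBot).div_const 2
    rw [zero_div] at this
    refine this.congr' ?_
    filter_upwards [eventually_ge_atTop (-m)] with x hx
    simp only [Function.comp]
    rw [abs_of_nonpos (by linarith)]
    ring)
  have hQ' : ∀ x, Integrable (fun y => max (x - y) 0) μ ∧
      ∫ y, max (x - y) 0 ∂μ = (f x + k * (x - m)) / 2 := by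
    intro x
    have := hQ (-x)
    rw [hme.integrable_map_iff, hme.integral_map] at this
    simp only [Function.comp_def, neg_neg, sub_neg_eq_add, neg_add_eq_sub] at this
    exact this
  refine ⟨μ, hfin, ?_, fun x => ?_⟩
  · refine ((hP 0).1.sub (hQ' 0).1).congr (Eventually.of_forall fun y => ?_)
    simp only [Pi.sub_apply, sub_zero, zero_sub]
    exact max_zero_sub_max_neg_zero_eq_self y
  · have e : ∀ y : ℝ, |y - x| = max (y - x) 0 + max (x - y) 0 := by
      intro y
      rcases le_total y x with hy | hy
      · rw [abs_of_nonpos (by linarith), max_eq_right (by linarith), max_eq_left (by linarith)]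
        ring
      · rw [abs_of_nonneg (by linarith), max_eq_left (by linarith), max_eq_right (by linarith)]
        ring
    simp_rw [e]
    rw [integral_add (hP x).1 (hQ' x).1, (hP x).2, (hQ' x).2]
    ring

/-- characterization of potential functions `u_μ(x) = ∫ |y-x| dμ(y)`. -/
theorem potential_function_characterization :
    (∀ μ : MeasureTheory.Measure ℝ, MeasureTheory.IsFiniteMeasure μ →
      MeasureTheory.Integrable (fun x : ℝ => x) μ → μ ≠ 0 →
      ConvexOn ℝ Set.univ (fun x : ℝ => ∫ y, |y - x| ∂μ) ∧
      Filter.Tendsto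
        (fun x : ℝ => (∫ y, |y - x| ∂μ) -
          (μ Set.univ).toReal * |x - (∫ y, y ∂μ) / (μ Set.univ).toReal|)
        Filter.atTop (nhds 0) ∧
      Filter.Tendsto
        (fun x : ℝ => (∫ y, |y - x| ∂μ) -
          (μ Set.univ).toReal * |x - (∫ y, y ∂μ) / (μ Set.univ).toReal|)
        Filter.atBot (nhds 0)) ∧
    (∀ (k m : ℝ), 0 ≤ k → ∀ f : ℝ → ℝ, ConvexOn ℝ Set.univ f →
      Filter.Tendsto (fun x : ℝ => f x - k * |x - m|) Filter.atTop (nhds 0) →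
      Filter.Tendsto (fun x : ℝ => f x - k * |x - m|) Filter.atBot (nhds 0) →
      ∃! μ : MeasureTheory.Measure ℝ,
        MeasureTheory.IsFiniteMeasure μ ∧
        MeasureTheory.Integrable (fun x : ℝ => x) μ ∧
        ∀ x : ℝ, f x = ∫ y, |y - x| ∂μ) := by
  refine ⟨fun μ hμ h h0 => ⟨pf_convex h, pf_lim_top h h0, pf_lim_bot h h0⟩, ?_⟩
  intro k m _ f hf ht hb
  obtain ⟨μ, hfin, hint, he⟩ := pf_exists hf ht hb
  refine ⟨μ, ⟨hfin, hint, he⟩, ?_⟩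
  rintro ν ⟨hν, hνi, hνe⟩
  exact pf_unique hνi hint fun x => by rw [← hνe, ← he]
end
end

section
/- Let μ, ν ∈ 𝓜 with μ ≤E ν. Then there exists a measure θ ∈ 𝓜 with θ ≤ ν (setwise) and μ ≤C θ. -/
open MeasureTheory Set Filter Topology

noncomputable section

lemma aux_quantile (ν : Measure ℝ) [IsFiniteMeasure ν] (hn : 0 < ν.real univ) :
    ∃ q : ℝ → ℝ, MonotoneOn q (Ioo 0 (ν.real univ)) ∧
      (volume.restrict (Ioo 0 (ν.real univ))).map q = ν := by
  set n := ν.real univ with hndef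
  have : NeZero ν := ⟨by rintro rfl; simp at hndef; linarith⟩
  set p : Measure ℝ := (ν univ)⁻¹ • ν with hp
  have : IsProbabilityMeasure p := by rw [hp]; infer_instance
  set F : ℝ → ℝ := fun x => n * ProbabilityTheory.cdf p x with hF
  have hFν : ∀ x, F x = ν.real (Iic x) := by
    intro x
    simp only [hF, ProbabilityTheory.cdf_eq_real, hp]
    rw [measureReal_ennreal_smul_apply, ENNReal.toReal_inv]
    change n * (n⁻¹ * _) = _
    field_simp
  have hmono : Monotone F := fun a b hab =>
    mul_le_mul_of_nonneg_left (ProbabilityTheory.monotone_cdf p hab) hn.le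
  have hbot : Tendsto F atBot (𝓝 0) := by
    simpa using (ProbabilityTheory.tendsto_cdf_atBot p).const_mul n
  have htop : Tendsto F atTop (𝓝 n) := by
    simpa using (ProbabilityTheory.tendsto_cdf_atTop p).const_mul n
  have hrc : ∀ x, ContinuousWithinAt F (Ici x) x := fun x =>
    ContinuousWithinAt.mul continuousWithinAt_const ((ProbabilityTheory.cdf p).right_continuous x)
  have hne : ∀ t, t < n → {x | t ≤ F x}.Nonempty := by
    intro t ht
    obtain ⟨x, hx⟩ := (htop.eventually (lt_mem_nhds ht)).exists
    exact ⟨x, hx.le⟩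
  have hbd : ∀ t, 0 < t → BddBelow {x | t ≤ F x} := by
    intro t ht
    obtain ⟨x, hx⟩ := (hbot.eventually (gt_mem_nhds ht)).exists
    refine ⟨x, fun y hy => ?_⟩
    by_contra hc
    push Not at hc
    have := hmono hc.le
    have hy' : t ≤ F y := hy
    linarith
  have gal : ∀ t ∈ Ioo 0 n, ∀ x, sInf {x | t ≤ F x} ≤ x ↔ t ≤ F x := by
    intro t ht x
    constructor
    · intro hx
      by_contra hc
      push Not at hc
      have h1 : ∀ᶠ y in 𝓝[>] x, F y < t :=
        ((hrc x).mono Ioi_subset_Ici_self).eventually (gt_mem_nhds hc)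
      obtain ⟨y, hy, hxy⟩ := (h1.and self_mem_nhdsWithin).exists
      have : y ≤ sInf {x | t ≤ F x} := by
        refine le_csInf (hne t ht.2) fun z hz => ?_
        by_contra hc
        push Not at hc
        have := hmono hc.le
        have hz' : t ≤ F z := hz
        linarith
      have hxy' : x < y := hxy
      linarith
    · intro hx
      exact csInf_le (hbd t ht.1) hx
  have hqm : MonotoneOn (fun t => sInf {x | t ≤ F x}) (Ioo 0 n) := by
    intro t ht u hu htu
    exact csInf_le_csInf (hbd t ht.1) (hne u hu.2) fun x hx => le_trans htu hx
  refine ⟨fun t => sInf {x | t ≤ F x}, hqm, ?_⟩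
  have hae : AEMeasurable (fun t => sInf {x | t ≤ F x}) (volume.restrict (Ioo 0 n)) :=
    aemeasurable_restrict_of_monotoneOn measurableSet_Ioo hqm
  have hfin : IsFiniteMeasure (volume.restrict (Ioo 0 n)) :=
    ⟨by simp⟩
  refine Measure.ext_of_Iic _ _ fun x => ?_
  rw [Measure.map_apply_of_aemeasurable hae measurableSet_Iic,
    Measure.restrict_apply' measurableSet_Ioo]
  have hFn : F x ≤ n := by rw [hFν]; exact measureReal_mono (subset_univ _)
  have hset : (fun t => sInf {x | t ≤ F x}) ⁻¹' Iic x ∩ Ioo 0 n = Iic (F x) ∩ Ioo 0 n := by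
    ext t
    simp only [mem_inter_iff, mem_preimage, mem_Iic]
    constructor
    · rintro ⟨a, b⟩; exact ⟨(gal t b x).1 a, b⟩
    · rintro ⟨a, b⟩; exact ⟨(gal t b x).2 a, b⟩
  rw [hset]
  have hv : volume (Iic (F x) ∩ Ioo 0 n) = ENNReal.ofReal (F x) := by
    apply le_antisymm
    · calc volume (Iic (F x) ∩ Ioo 0 n) ≤ volume (Ioc 0 (F x)) :=
            measure_mono fun t ht => ⟨ht.2.1, ht.1⟩
        _ = _ := by simp
    · calc ENNReal.ofReal (F x) = volume (Ioo 0 (F x)) := by simp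
        _ ≤ volume (Iic (F x) ∩ Ioo 0 n) := measure_mono fun t ht => ⟨ht.2.le, ht.1, ht.2.trans_le hFn⟩
  rw [hv, hFν]
  exact ofReal_measureReal

lemma aux_int_call {μ : Measure ℝ} [IsFiniteMeasure μ] (hμ : Integrable (fun x : ℝ => x) μ)
    (k : ℝ) : Integrable (fun x : ℝ => max (x - k) 0) μ :=
  (hμ.sub (integrable_const k)).sup (integrable_const 0)

lemma aux_int_put {μ : Measure ℝ} [IsFiniteMeasure μ] (hμ : Integrable (fun x : ℝ => x) μ)
    (k : ℝ) : Integrable (fun x : ℝ => max (k - x) 0) μ :=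
  ((integrable_const k).sub hμ).sup (integrable_const 0)

lemma aux_parity {μ : Measure ℝ} [IsFiniteMeasure μ] (hμ : Integrable (fun x : ℝ => x) μ)
    (k : ℝ) : ∫ x, max (x - k) 0 ∂μ = ∫ x, max (k - x) 0 ∂μ + ∫ x, x ∂μ - k * μ.real univ := by
  have : ∀ x : ℝ, max (x - k) 0 = max (k - x) 0 + x - k := by
    intro x
    rcases le_total x k with h | h
    · rw [max_eq_right (by linarith), max_eq_left (by linarith)]; ring
    · rw [max_eq_left (by linarith), max_eq_right (by linarith)]; ring
  simp_rw [this]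
  have hi : Integrable (fun x : ℝ => max (k - x) 0 + x) μ := (aux_int_put hμ k).add hμ
  rw [integral_sub hi (integrable_const k), integral_add (aux_int_put hμ k) hμ]
  simp [mul_comm]

lemma aux_ext {μ ν : Measure ℝ} (h : ExtConvexOrder μ ν) {φ : ℝ → ℝ}
    (hc : ConvexOn ℝ univ φ) (h0 : ∀ x, 0 ≤ φ x) (hμ : Integrable φ μ) (hν : Integrable φ ν) :
    ∫ x, φ x ∂μ ≤ ∫ x, φ x ∂ν := by
  have := h φ hc h0
  rw [← ofReal_integral_eq_lintegral_ofReal hμ (ae_of_all _ h0),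
    ← ofReal_integral_eq_lintegral_ofReal hν (ae_of_all _ h0)] at this
  exact (ENNReal.ofReal_le_ofReal_iff (integral_nonneg h0)).1 this

lemma aux_call {μ ν : Measure ℝ} [IsFiniteMeasure μ] [IsFiniteMeasure ν]
    (hμ : Integrable (fun x : ℝ => x) μ) (hν : Integrable (fun x : ℝ => x) ν)
    (h : ExtConvexOrder μ ν) (k : ℝ) :
    ∫ x, max (x - k) 0 ∂μ ≤ ∫ x, max (x - k) 0 ∂ν := by
  refine aux_ext h ?_ (fun x => le_max_right _ _) (aux_int_call hμ k) (aux_int_call hν k)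
  exact ((convexOn_id convex_univ).sub (concaveOn_const k convex_univ)).sup
    (convexOn_const 0 convex_univ)

lemma aux_put {μ ν : Measure ℝ} [IsFiniteMeasure μ] [IsFiniteMeasure ν]
    (hμ : Integrable (fun x : ℝ => x) μ) (hν : Integrable (fun x : ℝ => x) ν)
    (h : ExtConvexOrder μ ν) (k : ℝ) :
    ∫ x, max (k - x) 0 ∂μ ≤ ∫ x, max (k - x) 0 ∂ν := by
  refine aux_ext h ?_ (fun x => le_max_right _ _) (aux_int_put hμ k) (aux_int_put hν k)
  exact ((convexOn_const k convex_univ).sub (concaveOn_id convex_univ)).sup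
    (convexOn_const 0 convex_univ)

lemma aux_mean {μ ν : Measure ℝ} [IsFiniteMeasure μ] [IsFiniteMeasure ν] {f : ℝ → ℝ}
    (hμ : Integrable f μ) (hν : Integrable f ν)
    (hm : μ.real univ = ν.real univ)
    (h : ∀ k : ℝ, ∫ x, max (f x - k) 0 ∂μ ≤ ∫ x, max (f x - k) 0 ∂ν) :
    ∫ x, f x ∂μ ≤ ∫ x, f x ∂ν := by
  have key : ∀ j : ℕ, ∫ x, f x ∂μ ≤ ∫ x, max (f x) (-(j : ℝ)) ∂ν := by
    intro j
    have h1 := h (-(j:ℝ))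
    have e1 : ∫ x, (f x - (-(j:ℝ))) ∂μ ≤ ∫ x, max (f x - (-(j:ℝ))) 0 ∂μ :=
      integral_mono (hμ.sub (integrable_const _))
        ((hμ.sub (integrable_const _)).sup (integrable_const 0)) fun x => le_max_left _ _
    have e2 : ∫ x, max (f x - (-(j:ℝ))) 0 ∂ν = ∫ x, (max (f x) (-(j:ℝ)) - (-(j:ℝ))) ∂ν := by
      congr 1; ext x
      rw [← max_sub_sub_right]; simp
    have hi : Integrable (fun x => max (f x) (-(j:ℝ))) ν := hν.sup (integrable_const _)
    rw [e2, integral_sub hi (integrable_const _)] at h1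
    rw [integral_sub hμ (integrable_const _)] at e1
    simp only [integral_const, smul_eq_mul, hm] at h1 e1
    linarith
  have lim : Tendsto (fun j : ℕ => ∫ x, max (f x) (-(j : ℝ)) ∂ν) atTop (𝓝 (∫ x, f x ∂ν)) := by
    refine tendsto_integral_of_dominated_convergence (fun x => |f x|) ?_ hν.abs ?_ ?_
    · intro j
      exact (hν.sup (integrable_const _)).aestronglyMeasurable
    · intro j
      refine ae_of_all _ fun x => ?_
      rw [Real.norm_eq_abs, abs_le]
      have := neg_abs_le (f x)
      have := le_abs_self (f x)
      have := abs_nonneg (f x)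
      refine ⟨le_trans (by assumption) (le_max_left _ _), max_le (by assumption) ?_⟩
      have : (0:ℝ) ≤ j := Nat.cast_nonneg j
      linarith
    · refine ae_of_all _ fun x => ?_
      obtain ⟨N, hN⟩ := exists_nat_ge (-(f x))
      refine tendsto_const_nhds.congr' ?_
      filter_upwards [eventually_ge_atTop N] with j hj
      have : (N:ℝ) ≤ j := by exact_mod_cast hj
      rw [max_eq_left]; linarith
  exact ge_of_tendsto' lim key

def auxTheta (q : ℝ → ℝ) (n s d : ℝ) : Measure ℝ :=
  (volume.restrict (Ioo 0 n \ Ioo s (s + d))).map q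

section
variable {ν : Measure ℝ} {q : ℝ → ℝ} {n s d : ℝ}

lemma aux_aem (hqm : MonotoneOn q (Ioo 0 n)) : AEMeasurable q (volume.restrict (Ioo 0 n)) :=
  aemeasurable_restrict_of_monotoneOn measurableSet_Ioo hqm

lemma auxTheta_le (hqm : MonotoneOn q (Ioo 0 n)) (hq : (volume.restrict (Ioo 0 n)).map q = ν) :
    auxTheta q n s d ≤ ν := by
  rw [← hq]
  exact Measure.map_mono_of_aemeasurable (Measure.restrict_mono sdiff_subset le_rfl) (aux_aem hqm)

lemma auxTheta_mass (hqm : MonotoneOn q (Ioo 0 n))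
    (hs : 0 ≤ s) (hd : 0 ≤ d) (hsd : s + d ≤ n) :
    auxTheta q n s d univ = ENNReal.ofReal (n - d) := by
  rw [auxTheta, Measure.map_apply_of_aemeasurable ((aux_aem hqm).mono_measure
    (Measure.restrict_mono sdiff_subset le_rfl)) MeasurableSet.univ]
  simp only [preimage_univ, Measure.restrict_apply_univ]
  rw [measure_sdiff (Ioo_subset_Ioo hs hsd) measurableSet_Ioo.nullMeasurableSet (by simp)]
  simp only [Real.volume_Ioo]
  rw [← ENNReal.ofReal_sub _ (by linarith)]
  congr 1; ring

lemma auxTheta_congr (hqm : MonotoneOn q (Ioo 0 n)) {f g : ℝ → ℝ} (hf : Continuous f)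
    (hg : Continuous g) (hfg : ∀ t ∈ Ioo 0 n \ Ioo s (s + d), f (q t) = g (q t)) :
    ∫ x, f x ∂(auxTheta q n s d) = ∫ x, g x ∂(auxTheta q n s d) := by
  have ha := (aux_aem hqm).mono_measure
    (Measure.restrict_mono (sdiff_subset : Ioo 0 n \ Ioo s (s + d) ⊆ _) le_rfl)
  rw [auxTheta, integral_map ha hf.aestronglyMeasurable, integral_map ha hg.aestronglyMeasurable]
  exact setIntegral_congr_fun (measurableSet_Ioo.diff measurableSet_Ioo) hfg

lemma auxTheta_integral (hqm : MonotoneOn q (Ioo 0 n))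
    (hq : (volume.restrict (Ioo 0 n)).map q = ν)
    (hs : 0 ≤ s) (hsd : s + d ≤ n) {f : ℝ → ℝ} (hf : Continuous f)
    (hi : Integrable f ν) :
    ∫ x, f x ∂(auxTheta q n s d) = ∫ x, f x ∂ν - ∫ t in Ioo s (s + d), f (q t) := by
  have ha := (aux_aem hqm).mono_measure
    (Measure.restrict_mono (sdiff_subset : Ioo 0 n \ Ioo s (s + d) ⊆ _) le_rfl)
  rw [auxTheta, integral_map ha hf.aestronglyMeasurable, ← hq,
    integral_map (aux_aem hqm) hf.aestronglyMeasurable]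
  refine setIntegral_sdiff measurableSet_Ioo ?_ (Ioo_subset_Ioo hs hsd)
  rw [← hq] at hi
  exact hi.comp_aemeasurable (aux_aem hqm)

end

/-- if `μ ≤E ν` then there is `θ ≤ ν` with `μ ≤C θ`. -/
theorem extConvexOrder_exists_intermediate
    (μ ν : MeasureTheory.Measure ℝ)
    [MeasureTheory.IsFiniteMeasure μ] [MeasureTheory.IsFiniteMeasure ν]
    (hμ : MeasureTheory.Integrable (fun x : ℝ => x) μ)
    (hν : MeasureTheory.Integrable (fun x : ℝ => x) ν)
    (h : ExtConvexOrder μ ν) :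
    ∃ θ : MeasureTheory.Measure ℝ, θ ≤ ν ∧ ConvexOrder μ θ := by
  by_cases hμ0 : μ = 0
  · refine ⟨0, Measure.zero_le _, ?_⟩
    subst hμ0
    exact ⟨rfl, rfl, fun k => le_rfl⟩
  have hm : 0 < μ.real univ := by
    rw [measureReal_def]
    exact ENNReal.toReal_pos (by simpa using hμ0) (measure_ne_top _ _)
  have hmn : μ.real univ ≤ ν.real univ := by
    have := aux_ext h (convexOn_const 1 convex_univ) (fun _ => zero_le_one)
      (integrable_const _) (integrable_const _)
    simpa using this
  obtain ⟨q, hqm, hq⟩ := aux_quantile ν (hm.trans_le hmn)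
  generalize hn : ν.real univ = n at *
  generalize hmm : μ.real univ = m at *
  have hn0 : 0 < n := hm.trans_le hmn
  obtain ⟨d, hd⟩ : ∃ d, d = n - m := ⟨_, rfl⟩
  have hd0 : 0 ≤ d := by linarith
  have hle : ∀ s, auxTheta q n s d ≤ ν := fun s => auxTheta_le hqm hq
  have hfin : ∀ s, IsFiniteMeasure (auxTheta q n s d) := fun s => isFiniteMeasure_of_le ν (hle s)
  have hint : ∀ s, Integrable (fun x : ℝ => x) (auxTheta q n s d) := fun s => hν.mono_measure (hle s)
  have hmass : ∀ s ∈ Icc 0 m, auxTheta q n s d univ = ENNReal.ofReal m := fun s hs => by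
    rw [auxTheta_mass hqm hs.1 hd0 (by linarith [hs.2])]; congr 1; linarith
  have hmassr : ∀ s ∈ Icc 0 m, (auxTheta q n s d).real univ = m := fun s hs => by
    rw [measureReal_def, hmass s hs, ENNReal.toReal_ofReal hm.le]
  have hcc : ∀ k : ℝ, Continuous (fun x : ℝ => max (x - k) 0) := fun k => by fun_prop
  have hcp : ∀ k : ℝ, Continuous (fun x : ℝ => max (k - x) 0) := fun k => by fun_prop
  -- calls
  have hcall : ∀ s ∈ Icc 0 m, ∀ k, (∀ t ∈ Ioo s (s + d), q t ≤ k) →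
      ∫ x, max (x - k) 0 ∂μ ≤ ∫ x, max (x - k) 0 ∂(auxTheta q n s d) := by
    intro s hs k hk
    rw [auxTheta_integral hqm hq hs.1 (by linarith [hs.2]) (hcc k) (aux_int_call hν k),
      setIntegral_eq_zero_of_forall_eq_zero, sub_zero]
    · exact aux_call hμ hν h k
    · intro t ht
      exact max_eq_right (by linarith [hk t ht])
  have hput : ∀ s ∈ Icc 0 m, ∀ k, (∀ t ∈ Ioo s (s + d), k ≤ q t) →
      ∫ x, max (k - x) 0 ∂μ ≤ ∫ x, max (k - x) 0 ∂(auxTheta q n s d) := by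
    intro s hs k hk
    rw [auxTheta_integral hqm hq hs.1 (by linarith [hs.2]) (hcp k) (aux_int_put hν k),
      setIntegral_eq_zero_of_forall_eq_zero, sub_zero]
    · exact aux_put hμ hν h k
    · intro t ht
      exact max_eq_right (by linarith [hk t ht])
  have hmean : ∀ s ∈ Icc 0 m, ∫ x, x ∂(auxTheta q n s d)
      = ∫ x, x ∂ν - ∫ t in Ioo s (s + d), q t := fun s hs =>
    auxTheta_integral hqm hq hs.1 (by linarith [hs.2]) continuous_id hν
  -- endpoints
  have hend0 : ∫ x, x ∂μ ≤ ∫ x, x ∂(auxTheta q n 0 d) := by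
    have h0 : (0:ℝ) ∈ Icc 0 m := ⟨le_rfl, hm.le⟩
    rcases hd0.eq_or_lt with hd' | hd'
    · rw [hmean 0 h0, ← hd']
      simp only [add_zero, Ioo_self, setIntegral_empty, sub_zero]
      exact aux_mean hμ hν (by rw [hn, hmm]; linarith) (aux_call hμ hν h)
    · have hdA : d ∈ Ioo 0 n := ⟨hd', by linarith⟩
      have h1 := hcall 0 h0 (q d) fun t ht =>
        hqm ⟨ht.1, by linarith [ht.2]⟩ hdA (by linarith [ht.2])
      have h2 := aux_parity (hint 0) (q d)
      have h3 := aux_parity hμ (q d)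
      have h4 : ∫ x, max (q d - x) 0 ∂(auxTheta q n 0 d) = ∫ x, (0:ℝ) ∂(auxTheta q n 0 d) := by
        refine auxTheta_congr hqm (hcp _) continuous_const fun t ht => ?_
        refine max_eq_right (sub_nonpos.2 (hqm hdA ht.1 ?_))
        by_contra hc
        push Not at hc
        exact ht.2 ⟨ht.1.1, by linarith⟩
      have h5 : 0 ≤ ∫ x, max (q d - x) 0 ∂μ := integral_nonneg fun x => le_max_right _ _
      rw [h4, hmassr 0 h0] at h2
      rw [hmm] at h3
      simp only [integral_zero] at h2
      linarith
  have hend1 : ∫ x, x ∂(auxTheta q n m d) ≤ ∫ x, x ∂μ := by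
    have h0 : m ∈ Icc 0 m := ⟨hm.le, le_rfl⟩
    rcases hd0.eq_or_lt with hd' | hd'
    · rw [hmean m h0, ← hd']
      simp only [add_zero, Ioo_self, setIntegral_empty, sub_zero]
      have := aux_mean hμ.neg hν.neg (by rw [hn, hmm]; linarith) (fun k => by
        have := aux_put hμ hν h (-k)
        simpa only [Pi.neg_apply, neg_sub_left, add_comm, neg_sub_comm, sub_eq_add_neg] using this)
      simp only [Pi.neg_apply] at this
      rw [MeasureTheory.integral_neg (fun x : ℝ => x), MeasureTheory.integral_neg (fun x : ℝ => x)] at this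
      linarith
    · have hdA : m ∈ Ioo 0 n := ⟨hm, by linarith⟩
      have h1 := hput m h0 (q m) fun t ht =>
        hqm hdA ⟨by linarith [ht.1], by linarith [ht.2]⟩ ht.1.le
      have h2 := aux_parity (hint m) (q m)
      have h3 := aux_parity hμ (q m)
      have h4 : ∫ x, max (x - q m) 0 ∂(auxTheta q n m d) = ∫ x, (0:ℝ) ∂(auxTheta q n m d) := by
        refine auxTheta_congr hqm (hcc _) continuous_const fun t ht => ?_
        refine max_eq_right (sub_nonpos.2 (hqm ht.1 hdA ?_))
        by_contra hc
        push Not at hc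
        exact ht.2 ⟨hc, by linarith [ht.1.2]⟩
      have h5 : 0 ≤ ∫ x, max (x - q m) 0 ∂μ := integral_nonneg fun x => le_max_right _ _
      rw [h4, hmassr m h0] at h2
      rw [hmm] at h3
      simp only [integral_zero] at h2
      linarith
  -- intermediate value theorem
  obtain ⟨s, hs, hsm⟩ : ∃ s ∈ Icc 0 m, ∫ x, x ∂(auxTheta q n s d) = ∫ x, x ∂μ := by
    have hqi : IntegrableOn q (Ioo 0 n) := by
      rw [← hq] at hν
      exact hν.comp_aemeasurable (aux_aem hqm)
    have hQ : Integrable ((Ioo 0 n).indicator q) := hqi.integrable_indicator measurableSet_Ioo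
    have hc := intervalIntegral.continuous_primitive
      (fun a b => hQ.intervalIntegrable (a := a) (b := b)) 0
    have heq : ∀ s ∈ Icc 0 m, ∫ x, x ∂(auxTheta q n s d) = ∫ x, x ∂ν -
        ((∫ t in (0:ℝ)..(s + d), (Ioo 0 n).indicator q t)
          - ∫ t in (0:ℝ)..s, (Ioo 0 n).indicator q t) := by
      intro s hs
      rw [hmean s hs, intervalIntegral.integral_interval_sub_left hQ.intervalIntegrable
        hQ.intervalIntegrable, intervalIntegral.integral_of_le (by linarith),
        integral_Ioc_eq_integral_Ioo]
      congr 1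
      refine setIntegral_congr_fun measurableSet_Ioo fun t ht => ?_
      rw [indicator_of_mem]
      exact ⟨by linarith [ht.1, hs.1], by linarith [ht.2, hs.2]⟩
    have hcont : ContinuousOn (fun s => ∫ x, x ∂(auxTheta q n s d)) (Icc 0 m) := by
      refine ContinuousOn.congr (Continuous.continuousOn ?_) heq
      exact continuous_const.sub ((hc.comp (continuous_id.add continuous_const)).sub hc)
    exact intermediate_value_Icc' hm.le hcont ⟨hend1, hend0⟩
  have hcall' : ∀ k, (∀ t ∈ Ioo s (s + d), k ≤ q t) →
      ∫ x, max (x - k) 0 ∂μ ≤ ∫ x, max (x - k) 0 ∂(auxTheta q n s d) := by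
    intro k hk
    have := hput s hs k hk
    rw [aux_parity hμ, aux_parity (hint s), hsm, hmassr s hs, hmm]
    linarith
  refine ⟨auxTheta q n s d, hle s, ?_, hsm.symm, ?_⟩
  · rw [hmass s hs, ← hmm]
    exact (ofReal_measureReal (μ := μ) (s := univ)).symm
  intro k
  by_cases hA : ∀ t ∈ Ioo s (s + d), q t ≤ k
  · exact hcall s hs k hA
  by_cases hB : ∀ t ∈ Ioo s (s + d), k ≤ q t
  · exact hcall' k hB
  push Not at hA hB
  obtain ⟨t2, ht2, hk2⟩ := hA
  obtain ⟨t1, ht1, hk1⟩ := hB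
  have hMA : ∀ t ∈ Ioo s (s + d), t ∈ Ioo 0 n := fun t ht =>
    ⟨by linarith [ht.1, hs.1], by linarith [ht.2, hs.2]⟩
  -- left endpoint facts
  have hL : 0 < s → q s < k ∧ (∀ t ∈ Ioo s (s + d), q s ≤ q t) ∧
      ∀ t ∈ Ioo 0 n, t ≤ s → q t ≤ q s := by
    intro h0
    have hsA : s ∈ Ioo 0 n := ⟨h0, by linarith [(hMA t1 ht1).2, ht1.1]⟩
    have h1 : ∀ t ∈ Ioo s (s + d), q s ≤ q t := fun t ht => hqm hsA (hMA t ht) ht.1.le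
    exact ⟨(h1 t1 ht1).trans_lt hk1, h1, fun t ht hts => hqm ht hsA hts⟩
  have hR : s + d < n → k < q (s + d) ∧ (∀ t ∈ Ioo s (s + d), q t ≤ q (s + d)) ∧
      ∀ t ∈ Ioo 0 n, s + d ≤ t → q (s + d) ≤ q t := by
    intro h0
    have hsA : s + d ∈ Ioo 0 n := ⟨by linarith [(hMA t1 ht1).1, ht1.2], h0⟩
    have h1 : ∀ t ∈ Ioo s (s + d), q t ≤ q (s + d) := fun t ht => hqm (hMA t ht) hsA ht.2.le
    exact ⟨hk2.trans_le (h1 t2 ht2), h1, fun t ht hts => hqm hsA ht hts⟩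
  have hout : ∀ t ∈ Ioo 0 n \ Ioo s (s + d), t ≤ s ∨ s + d ≤ t := by
    intro t ht
    by_contra hc
    push Not at hc
    exact ht.2 hc
  rcases hs.1.eq_or_lt with hs0 | hs0
  · -- left part empty
    obtain ⟨hkb, hb1, hb2⟩ := hR (by linarith)
    set b := q (s + d) with hb
    have hcb := hcall s hs b hb1
    have e1 : ∫ x, max (x - k) 0 ∂μ ≤ ∫ x, (max (x - b) 0 + (b - k)) ∂μ := by
      refine integral_mono (aux_int_call hμ k) ((aux_int_call hμ b).add (integrable_const _))
        fun x => ?_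
      exact max_le (by linarith [le_max_left (x - b) 0]) (by linarith [le_max_right (x - b) 0])
    have e2 : ∫ x, max (x - k) 0 ∂(auxTheta q n s d)
        = ∫ x, (max (x - b) 0 + (b - k)) ∂(auxTheta q n s d) := by
      refine auxTheta_congr hqm (hcc k) ((hcc b).add continuous_const) fun t ht => ?_
      have : b ≤ q t := hb2 t ht.1 (by
        rcases hout t ht with h' | h'
        · linarith [ht.1.1]
        · exact h')
      rw [max_eq_left (by linarith), max_eq_left (by linarith)]; ring
    rw [integral_add (aux_int_call hμ b) (integrable_const _)] at e1
    rw [integral_add (aux_int_call (hint s) b) (integrable_const _)] at e2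
    simp only [integral_const, smul_eq_mul, hmm, hmassr s hs] at e1 e2
    linarith
  obtain ⟨hka, ha1, ha2⟩ := hL hs0
  set a := q s with ha
  have hca := hcall' a ha1
  rcases hs.2.eq_or_lt with hs1 | hs1
  · have e1 : ∫ x, max (x - k) 0 ∂μ ≤ ∫ x, max (x - a) 0 ∂μ := by
      refine integral_mono (aux_int_call hμ k) (aux_int_call hμ a) fun x => ?_
      exact max_le_max (by linarith) le_rfl
    have e2 : ∫ x, max (x - k) 0 ∂(auxTheta q n s d)
        = ∫ x, max (x - a) 0 ∂(auxTheta q n s d) := by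
      refine auxTheta_congr hqm (hcc k) (hcc a) fun t ht => ?_
      have : q t ≤ a := ha2 t ht.1 (by
        rcases hout t ht with h' | h'
        · exact h'
        · linarith [ht.1.2])
      rw [max_eq_right (by linarith), max_eq_right (by linarith)]
    linarith
  obtain ⟨hkb, hb1, hb2⟩ := hR (by linarith)
  set b := q (s + d) with hb
  have hcb := hcall s hs b hb1
  have hab : 0 < b - a := by linarith
  obtain ⟨l, hl⟩ : ∃ l, l = (b - k) / (b - a) := ⟨_, rfl⟩
  have hl0 : 0 ≤ l := by rw [hl]; exact div_nonneg (by linarith) hab.le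
  have hl1 : 0 ≤ 1 - l := by
    rw [hl, sub_nonneg, div_le_one hab]; linarith
  have hlk : k = l * a + (1 - l) * b := by rw [hl]; field_simp; ring
  have e1 : ∫ x, max (x - k) 0 ∂μ ≤ ∫ x, (l * max (x - a) 0 + (1 - l) * max (x - b) 0) ∂μ := by
    refine integral_mono (aux_int_call hμ k)
      (((aux_int_call hμ a).const_mul _).add ((aux_int_call hμ b).const_mul _)) fun x => ?_
    have p1 := mul_le_mul_of_nonneg_left (le_max_left (x - a) 0) hl0
    have p2 := mul_le_mul_of_nonneg_left (le_max_left (x - b) 0) hl1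
    have p3 := mul_nonneg hl0 (le_max_right (x - a) 0)
    have p4 := mul_nonneg hl1 (le_max_right (x - b) 0)
    exact max_le (by linarith) (by linarith)
  have e2 : ∫ x, max (x - k) 0 ∂(auxTheta q n s d)
      = ∫ x, (l * max (x - a) 0 + (1 - l) * max (x - b) 0) ∂(auxTheta q n s d) := by
    refine auxTheta_congr hqm (hcc k)
      ((continuous_const.mul (hcc a)).add (continuous_const.mul (hcc b))) fun t ht => ?_
    rcases hout t ht with h' | h'
    · have := ha2 t ht.1 h'
      rw [max_eq_right (by linarith), max_eq_right (by linarith), max_eq_right (by linarith)]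
      ring
    · have := hb2 t ht.1 h'
      rw [max_eq_left (by linarith), max_eq_left (by linarith), max_eq_left (by linarith)]
      linarith
  rw [integral_add ((aux_int_call hμ a).const_mul _) ((aux_int_call hμ b).const_mul _),
    integral_const_mul, integral_const_mul] at e1
  rw [integral_add ((aux_int_call (hint s) a).const_mul _)
    ((aux_int_call (hint s) b).const_mul _), integral_const_mul, integral_const_mul] at e2
  have p1 := mul_le_mul_of_nonneg_left hca hl0
  have p2 := mul_le_mul_of_nonneg_left hcb hl1
  linarith
end
end

section
/- Let μ, ν ∈ 𝓜 with μ ≤E ν. Then the set F^ν_μ = {η : μ ≤C η and η ≤ ν setwise} has a maximal element with respect to the convex order: there exists a measure T such that T ≤ ν setwise, μ ≤C T, and η ≤C T for every measure η with η ≤ ν and μ ≤C η. -/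
open MeasureTheory Set Filter Topology

noncomputable section

lemma exists_quantile (ν : Measure ℝ) [IsFiniteMeasure ν] :
    ∃ Q : ℝ → ℝ, MonotoneOn Q (Ioo 0 (ν.real univ)) ∧
      AEMeasurable Q (volume.restrict (Ioo 0 (ν.real univ))) ∧
      ν = (volume.restrict (Ioo 0 (ν.real univ))).map Q := by
  set N := ν.real univ with hN
  set F : ℝ → ℝ := fun x => ν.real (Iic x) with hF
  have Fmono : Monotone F := fun a b hab => measureReal_mono (Iic_subset_Iic.2 hab)
  have Ftop : Tendsto F atTop (𝓝 N) :=
    (ENNReal.tendsto_toReal (measure_ne_top ν univ)).comp (tendsto_measure_Iic_atTop ν)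
  have Fbot : Tendsto F atBot (𝓝 0) := by
    have h1 : Tendsto (fun x : ℝ => ν (Iic x)) atBot (𝓝 (ν (⋂ x : ℝ, Iic x))) :=
      tendsto_measure_iInter_atBot (fun i => measurableSet_Iic.nullMeasurableSet)
        monotone_Iic ⟨0, measure_ne_top _ _⟩
    rw [iInter_Iic_eq_empty_iff.2 (by simp), measure_empty] at h1
    exact (ENNReal.tendsto_toReal ENNReal.zero_ne_top).comp h1
  have Fr : ∀ a, Tendsto F (𝓝[>] a) (𝓝 (F a)) := by
    intro a
    have h1 := tendsto_measure_biInter_gt (μ := ν) (s := fun x : ℝ => Iic x) (a := a)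
      (fun r _ => measurableSet_Iic.nullMeasurableSet)
      (fun i j _ hij => Iic_subset_Iic.2 hij) ⟨a + 1, by simp, measure_ne_top _ _⟩
    have h2 : (⋂ r : ℝ, ⋂ (_ : r > a), Iic r) = Iic a := by
      ext x
      simp only [mem_iInter, mem_Iic]
      exact ⟨fun h => le_of_forall_gt_imp_ge_of_dense h, fun h r hr => h.trans hr.le⟩
    rw [h2] at h1
    exact (ENNReal.tendsto_toReal (measure_ne_top ν _)).comp h1
  set Q : ℝ → ℝ := fun u => sInf {x | u ≤ F x} with hQ
  have gal : ∀ u ∈ Ioo 0 N, ∀ x, Q u ≤ x ↔ u ≤ F x := by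
    intro u hu x
    have hne : {x | u ≤ F x}.Nonempty :=
      ((Ftop.eventually (lt_mem_nhds hu.2)).exists).imp fun _ h => h.le
    have hbd : BddBelow {x | u ≤ F x} := by
      obtain ⟨y, hy⟩ := (Fbot.eventually (gt_mem_nhds hu.1)).exists
      refine ⟨y, fun z hz => ?_⟩
      by_contra hzy
      have := Fmono (not_le.1 hzy).le
      have hz' : u ≤ F z := hz
      linarith
    constructor
    · intro h
      refine ge_of_tendsto (Fr x) ?_
      filter_upwards [self_mem_nhdsWithin] with y hy
      obtain ⟨z, hz, hzy⟩ := exists_lt_of_csInf_lt hne (lt_of_le_of_lt h hy)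
      exact le_trans hz (Fmono hzy.le)
    · intro h
      exact csInf_le hbd h
  have Qmono : MonotoneOn Q (Ioo 0 N) := by
    intro u hu v hv huv
    rw [gal u hu]
    exact huv.trans ((gal v hv _).1 le_rfl)
  have Qm : AEMeasurable Q (volume.restrict (Ioo 0 N)) :=
    aemeasurable_restrict_of_monotoneOn measurableSet_Ioo Qmono
  refine ⟨Q, Qmono, Qm, ?_⟩
  refine Measure.ext_of_Iic _ _ fun x => ?_
  rw [Measure.map_apply_of_aemeasurable Qm measurableSet_Iic,
    Measure.restrict_apply' measurableSet_Ioo]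
  have hFN : F x ≤ N := measureReal_mono (subset_univ _)
  have hs : (Q ⁻¹' Iic x ∩ Ioo 0 N : Set ℝ) =ᵐ[volume] Ioc 0 (F x) := by
    have e : Q ⁻¹' Iic x ∩ Ioo 0 N = Ioc 0 (F x) ∩ Iio N := by
      ext u
      simp only [mem_inter_iff, mem_preimage, mem_Iic, mem_Ioo, mem_Ioc, mem_Iio]
      constructor
      · rintro ⟨h1, h2, h3⟩
        exact ⟨⟨h2, (gal u ⟨h2, h3⟩ x).1 h1⟩, h3⟩
      · rintro ⟨⟨h1, h2⟩, h3⟩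
        exact ⟨(gal u ⟨h1, h3⟩ x).2 h2, h1, h3⟩
    rw [e]
    have h3 : (Ioc 0 (F x) ∩ Iio N : Set ℝ) =ᵐ[volume] (Ioc 0 (F x) ∩ Iic N : Set ℝ) :=
      (ae_eq_refl _).inter Iio_ae_eq_Iic
    refine h3.trans ?_
    rw [inter_eq_left.2 (fun u hu => hu.2.trans hFN)]
    exact ae_eq_refl _
  rw [measure_congr hs, Real.volume_Ioc, sub_zero]
  simp [hF, Measure.real]

lemma ext_integral_le {μ ν : Measure ℝ} (φ : ℝ → ℝ) (h0 : ∀ x, 0 ≤ φ x)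
    (h1 : Integrable φ μ) (h2 : Integrable φ ν)
    (h : (∫⁻ x, ENNReal.ofReal (φ x) ∂μ) ≤ ∫⁻ x, ENNReal.ofReal (φ x) ∂ν) :
    ∫ x, φ x ∂μ ≤ ∫ x, φ x ∂ν := by
  rw [integral_eq_lintegral_of_nonneg_ae (ae_of_all _ h0) h1.1,
    integral_eq_lintegral_of_nonneg_ae (ae_of_all _ h0) h2.1]
  exact ENNReal.toReal_mono
    ((hasFiniteIntegral_iff_ofReal (ae_of_all _ h0)).1 h2.2).ne h

lemma tail_tendsto (ν : Measure ℝ) [IsFiniteMeasure ν] (f : ℝ → ℝ) (hf : Integrable f ν) :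
    Tendsto (fun n : ℕ => ∫ x, max (-(n:ℝ) - f x) 0 ∂ν) atTop (𝓝 0) := by
  have := tendsto_integral_of_dominated_convergence (μ := ν)
    (F := fun (n : ℕ) x => max (-(n:ℝ) - f x) 0) (f := fun _ => (0:ℝ)) (fun x => |f x|)
    (fun n => (((integrable_const _).sub hf).sup (integrable_const 0)).1) hf.abs
    (fun n => ae_of_all _ fun x => ?_) (ae_of_all _ fun x => ?_)
  · simpa using this
  · rw [Real.norm_eq_abs, abs_of_nonneg (le_max_right _ _)]
    have : (0:ℝ) ≤ n := Nat.cast_nonneg n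
    exact max_le (by linarith [neg_abs_le (f x)]) (abs_nonneg _)
  · refine tendsto_const_nhds.congr' ?_
    filter_upwards [eventually_ge_atTop ⌈|f x|⌉₊] with n hn
    have := Nat.ceil_le.1 hn
    rw [max_eq_right]
    linarith [neg_abs_le (f x)]

lemma tent_line (a b k : ℝ) (hab : a ≤ b) : ∃ p q : ℝ,
    (∀ x, x ≤ a → 0 ≤ max (x - k) 0 - (p * x + q)) ∧
    (∀ x, a ≤ x → x ≤ b → max (x - k) 0 - (p * x + q) ≤ 0) ∧
    (∀ x, b ≤ x → 0 ≤ max (x - k) 0 - (p * x + q)) := by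
  rcases le_total k a with hk | hk
  · refine ⟨1, -k, fun x hx => ?_, fun x h1 h2 => ?_, fun x hx => ?_⟩
    · linarith [le_max_left (x - k) 0]
    · rw [max_eq_left (by linarith)]; linarith
    · linarith [le_max_left (x - k) 0]
  rcases le_total b k with hk' | hk'
  · refine ⟨0, 0, fun x hx => ?_, fun x h1 h2 => ?_, fun x hx => ?_⟩
    · linarith [le_max_right (x - k) 0]
    · rw [max_eq_right (by linarith)]; linarith
    · linarith [le_max_right (x - k) 0]
  rcases hab.eq_or_lt with rfl | hlt
  · obtain rfl : k = a := le_antisymm hk' hk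
    refine ⟨0, 0, fun x hx => ?_, fun x h1 h2 => ?_, fun x hx => ?_⟩
    · linarith [le_max_right (x - k) 0]
    · rw [max_eq_right (by linarith)]; linarith
    · linarith [le_max_right (x - k) 0]
  have hba : 0 < b - a := by linarith
  obtain ⟨p, hp⟩ : ∃ p, p * (b - a) = b - k := ⟨(b - k) / (b - a), by field_simp⟩
  have hp0 : 0 ≤ p := by
    by_contra hc
    nlinarith
  have hp1 : p ≤ 1 := by
    by_contra hc
    nlinarith
  refine ⟨p, -p * a, fun x hx => ?_, fun x h1 h2 => ?_, fun x hx => ?_⟩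
  · nlinarith [le_max_right (x - k) 0]
  · rw [sub_nonpos]
    refine max_le ?_ ?_ <;> nlinarith
  · nlinarith [le_max_left (x - k) 0]

lemma core_eq {ν : Measure ℝ} {Q : ℝ → ℝ} {I A : Set ℝ} (hI : MeasurableSet I)
    (hA : MeasurableSet A) (hAI : A ⊆ I) (hQ : AEMeasurable Q (volume.restrict I))
    (hν : ν = (volume.restrict I).map Q) (g : ℝ → ℝ) (hg : Continuous g)
    (hpos : ∀ u ∈ A, 0 ≤ g (Q u)) (hneg : ∀ u ∈ I \ A, g (Q u) ≤ 0) :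
    ∫ x, g x ∂((volume.restrict A).map Q) = ∫ x, max (g x) 0 ∂ν := by
  have hQA : AEMeasurable Q (volume.restrict A) :=
    hQ.mono_measure (Measure.restrict_mono hAI le_rfl)
  rw [hν, integral_map hQA hg.aestronglyMeasurable,
    integral_map hQ (hg.max continuous_const).aestronglyMeasurable,
    setIntegral_eq_of_subset_of_forall_sdiff_eq_zero hI hAI
      (fun u hu => max_eq_right (hneg u hu))]
  exact setIntegral_congr_fun hA fun u hu => (max_eq_left (hpos u hu)).symm

lemma convexOn_tent (k p q : ℝ) :
    ConvexOn ℝ univ (fun x : ℝ => max (max (x - k) 0 - (p * x + q)) 0) := by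
  have h1 : ∀ r t : ℝ, ConvexOn ℝ univ (fun x : ℝ => r * x + t) := fun r t =>
    ⟨convex_univ, fun x _ y _ a b _ _ hab => by
      simp only [smul_eq_mul]
      have : t = (a + b) * t := by rw [hab, one_mul]
      nlinarith⟩
  have h2 := ((h1 (1 - p) (-k - q)).sup (h1 (-p) (-q))).sup (h1 0 0)
  refine h2.congr fun x _ => ?_
  simp only [Pi.sup_apply]
  symm
  rw [← max_sub_sub_right]
  congr 1
  · congr 1 <;> ring
  · ring

lemma tent_integrable {ν : Measure ℝ} [IsFiniteMeasure ν]
    (hν : Integrable (fun x : ℝ => x) ν) (k p q : ℝ) :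
    Integrable (fun x : ℝ => max (x - k) 0) ν ∧ Integrable (fun x : ℝ => p * x + q) ν ∧
    Integrable (fun x : ℝ => max (x - k) 0 - (p * x + q)) ν ∧
    Integrable (fun x : ℝ => max (max (x - k) 0 - (p * x + q)) 0) ν := by
  have h1 : Integrable (fun x : ℝ => max (x - k) 0) ν :=
    (hν.sub (integrable_const k)).sup (integrable_const 0)
  have h2 : Integrable (fun x : ℝ => p * x + q) ν := (hν.const_mul p).add (integrable_const q)
  exact ⟨h1, h2, h1.sub h2, (h1.sub h2).sup (integrable_const 0)⟩

lemma convexOrder_of {μ ν T : Measure ℝ} [IsFiniteMeasure μ] [IsFiniteMeasure ν]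
    [IsFiniteMeasure T]
    (hμ : Integrable (fun x : ℝ => x) μ) (hν : Integrable (fun x : ℝ => x) ν)
    (hT : Integrable (fun x : ℝ => x) T)
    (h : ExtConvexOrder μ ν) (hm : μ univ = T univ) (hM : ∫ x, x ∂μ = ∫ x, x ∂T)
    (hk : ∀ k : ℝ, ∃ p q : ℝ, ∫ x, (max (x - k) 0 - (p * x + q)) ∂T =
      ∫ x, max (max (x - k) 0 - (p * x + q)) 0 ∂ν) : ConvexOrder μ T := by
  refine ⟨hm, hM, fun k => ?_⟩
  obtain ⟨p, q, e⟩ := hk k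
  obtain ⟨a1, a2, a3, a4⟩ := tent_integrable hμ k p q
  obtain ⟨b1, b2, b3, b4⟩ := tent_integrable hν k p q
  obtain ⟨c1, c2, c3, c4⟩ := tent_integrable hT k p q
  have h1 := ext_integral_le _ (fun x => le_max_right _ _) a4 b4
    (h _ (convexOn_tent k p q) (fun x => le_max_right _ _))
  have h2 : ∫ x, (max (x - k) 0 - (p * x + q)) ∂μ ≤
      ∫ x, max (max (x - k) 0 - (p * x + q)) 0 ∂μ :=
    integral_mono a3 a4 fun x => le_max_left _ _
  have lin : ∫ x, (p * x + q) ∂μ = ∫ x, (p * x + q) ∂T := by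
    rw [integral_add (hμ.const_mul p) (integrable_const q),
      integral_add (hT.const_mul p) (integrable_const q), integral_const_mul,
      integral_const_mul, hM]
    simp [Measure.real, hm]
  rw [integral_sub a1 a2] at h2
  rw [integral_sub c1 c2] at e
  linarith

lemma sign_line {Q : ℝ → ℝ} {N m d s : ℝ} (hm : 0 < m) (hd : 0 ≤ d) (hN : m + d = N)
    (hQ : MonotoneOn Q (Ioo 0 N)) (hs0 : 0 ≤ s) (hsm : s ≤ m) (k : ℝ) : ∃ p q : ℝ,
    (∀ u ∈ Ioo 0 N \ Ioo s (s + d), 0 ≤ max (Q u - k) 0 - (p * Q u + q)) ∧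
    (∀ u ∈ Ioo 0 N \ (Ioo 0 N \ Ioo s (s + d)), max (Q u - k) 0 - (p * Q u + q) ≤ 0) := by
  have key : ∀ p q : ℝ, (∀ u ∈ Ioo 0 N, u ≤ s → 0 ≤ max (Q u - k) 0 - (p * Q u + q)) →
      (∀ u ∈ Ioo 0 N, s + d ≤ u → 0 ≤ max (Q u - k) 0 - (p * Q u + q)) →
      (∀ u ∈ Ioo 0 N, s < u → u < s + d → max (Q u - k) 0 - (p * Q u + q) ≤ 0) →
      (∀ u ∈ Ioo 0 N \ Ioo s (s + d), 0 ≤ max (Q u - k) 0 - (p * Q u + q)) ∧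
      (∀ u ∈ Ioo 0 N \ (Ioo 0 N \ Ioo s (s + d)), max (Q u - k) 0 - (p * Q u + q) ≤ 0) := by
    intro p q h1 h2 h3
    constructor
    · rintro u ⟨hu, hu'⟩
      rcases le_or_gt u s with h | h
      · exact h1 u hu h
      · exact h2 u hu (not_lt.1 fun h' => hu' ⟨h, h'⟩)
    · rintro u ⟨hu, hu'⟩
      have : u ∈ Ioo s (s + d) := by
        by_contra hc
        exact hu' ⟨hu, hc⟩
      exact h3 u hu this.1 this.2
  rcases hd.eq_or_lt with rfl | hd
  · refine ⟨0, 0, key 0 0 (fun u hu h => ?_) (fun u hu h => ?_) (fun u hu h h' => ?_)⟩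
    · simp
    · simp
    · linarith
  rcases hs0.eq_or_lt with rfl | hs0
  · refine ⟨0, max (Q d - k) 0, key _ _ (fun u hu h => ?_) (fun u hu h => ?_)
      (fun u hu h h' => ?_)⟩
    · linarith [hu.1]
    · have := hQ ⟨hd, by linarith⟩ hu (by linarith)
      have := max_le_max_right 0 (sub_le_sub_right this k)
      linarith
    · have := hQ hu ⟨hd, by linarith⟩ (by linarith)
      have := max_le_max_right 0 (sub_le_sub_right this k)
      linarith
  rcases hsm.eq_or_lt with rfl | hsm
  · refine ⟨1, max (Q s - k) 0 - Q s, key _ _ (fun u hu h => ?_) (fun u hu h => ?_)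
      (fun u hu h h' => ?_)⟩
    · have := hQ hu ⟨hm, by linarith⟩ h
      have : max (Q s - k) 0 ≤ max (Q u - k) 0 + (Q s - Q u) :=
        max_le (by linarith [le_max_left (Q u - k) 0]) (by linarith [le_max_right (Q u - k) 0])
      linarith
    · linarith [hu.2]
    · have := hQ ⟨hm, by linarith⟩ hu h.le
      have : max (Q u - k) 0 ≤ max (Q s - k) 0 + (Q u - Q s) :=
        max_le (by linarith [le_max_left (Q s - k) 0]) (by linarith [le_max_right (Q s - k) 0])
      linarith
  have ms : s ∈ Ioo 0 N := ⟨hs0, by linarith⟩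
  have msd : s + d ∈ Ioo 0 N := ⟨by linarith, by linarith⟩
  obtain ⟨p, q, h1, h2, h3⟩ := tent_line (Q s) (Q (s + d)) k (hQ ms msd (by linarith))
  exact ⟨p, q, key p q (fun u hu h => h1 _ (hQ hu ms h)) (fun u hu h => h3 _ (hQ msd hu h))
    (fun u hu h h' => h2 _ (hQ ms hu h.le) (hQ hu msd h'.le))⟩

lemma ext_of_le {η ν : Measure ℝ} (h : η ≤ ν) : ExtConvexOrder η ν :=
  fun _ _ _ => lintegral_mono' h le_rfl

/-- Real-valued consequence for `(σ x - k)⁺`. -/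
lemma ext_call {μ ν : Measure ℝ} [IsFiniteMeasure μ] [IsFiniteMeasure ν]
    (hμ : Integrable (fun x : ℝ => x) μ) (hν : Integrable (fun x : ℝ => x) ν)
    (h : ExtConvexOrder μ ν) (σ k : ℝ) :
    σ * (∫ x, x ∂μ) - k * μ.real univ ≤ ∫ x, max (σ * x - k) 0 ∂ν := by
  have i1 : Integrable (fun x : ℝ => σ * x - k) μ := (hμ.const_mul σ).sub (integrable_const k)
  have i2 : Integrable (fun x : ℝ => σ * x - k) ν := (hν.const_mul σ).sub (integrable_const k)
  have c : ConvexOn ℝ univ (fun x : ℝ => max (σ * x - k) 0) := by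
    have h1 : ∀ r t : ℝ, ConvexOn ℝ univ (fun x : ℝ => r * x + t) := fun r t =>
      ⟨convex_univ, fun x _ y _ a b _ _ hab => by
        simp only [smul_eq_mul]
        have : t = (a + b) * t := by rw [hab, one_mul]
        nlinarith⟩
    refine ((h1 σ (-k)).sup (h1 0 0)).congr fun x _ => ?_
    simp [sub_eq_add_neg]
  have j1 : Integrable (fun x : ℝ => max (σ * x - k) 0) μ := i1.sup (integrable_const 0)
  have j2 : Integrable (fun x : ℝ => max (σ * x - k) 0) ν := i2.sup (integrable_const 0)
  have := ext_integral_le _ (fun x => le_max_right _ _) j1 j2 (h _ c fun x => le_max_right _ _)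
  have h2 : ∫ x, (σ * x - k) ∂μ ≤ ∫ x, max (σ * x - k) 0 ∂μ :=
    integral_mono i1 j1 fun x => le_max_left _ _
  rw [integral_sub (hμ.const_mul σ) (integrable_const k), integral_const_mul] at h2
  simp only [integral_const, smul_eq_mul] at h2
  linarith

lemma mean_le_of_mass_eq {μ ν : Measure ℝ} [IsFiniteMeasure μ] [IsFiniteMeasure ν]
    (hμ : Integrable (fun x : ℝ => x) μ) (hν : Integrable (fun x : ℝ => x) ν)
    (h : ExtConvexOrder μ ν) (hm : μ.real univ = ν.real univ) (σ : ℝ) :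
    σ * (∫ x, x ∂μ) ≤ σ * ∫ x, x ∂ν := by
  have t := (tail_tendsto ν (fun x => σ * x) (hν.const_mul σ)).const_add (σ * ∫ x, x ∂ν)
  rw [add_zero] at t
  refine ge_of_tendsto' t fun n => ?_
  have h1 := ext_call hμ hν h σ (-n)
  have i2 : Integrable (fun x : ℝ => σ * x + n) ν := (hν.const_mul σ).add (integrable_const _)
  have i3 : Integrable (fun x : ℝ => max (-(n:ℝ) - σ * x) 0) ν :=
    ((integrable_const _).sub (hν.const_mul σ)).sup (integrable_const 0)
  have e : ∫ x, max (σ * x - -(n:ℝ)) 0 ∂ν =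
      ∫ x, (σ * x + n) ∂ν + ∫ x, max (-(n:ℝ) - σ * x) 0 ∂ν := by
    rw [← integral_add i2 i3]
    congr 1
    funext x
    rcases le_total (σ * x + n) 0 with hx | hx
    · rw [max_eq_right (by linarith), max_eq_left (by linarith)]; ring
    · rw [max_eq_left (by linarith), max_eq_right (by linarith)]; ring
  rw [e, integral_add (hν.const_mul σ) (integrable_const _), integral_const_mul, hm] at h1
  simp only [integral_const, smul_eq_mul] at h1
  linarith

/-- the set `F^ν_μ` has a maximal element for the convex order. -/
theorem exists_maximal_element_convexOrder
    (μ ν : MeasureTheory.Measure ℝ)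
    [MeasureTheory.IsFiniteMeasure μ] [MeasureTheory.IsFiniteMeasure ν]
    (hμ : MeasureTheory.Integrable (fun x : ℝ => x) μ)
    (hν : MeasureTheory.Integrable (fun x : ℝ => x) ν)
    (h : ExtConvexOrder μ ν) :
    ∃ T : MeasureTheory.Measure ℝ, T ≤ ν ∧ ConvexOrder μ T ∧
      ∀ η : MeasureTheory.Measure ℝ, η ≤ ν → ConvexOrder μ η → ConvexOrder η T := by
  set N := ν.real univ with hNdef
  set m := μ.real univ with hmdef
  have hmN : m ≤ N := by
    have := h (fun _ => 1) (convexOn_const 1 convex_univ) (fun _ => zero_le_one)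
    simp only [ENNReal.ofReal_one, lintegral_const, one_mul] at this
    exact ENNReal.toReal_mono (measure_ne_top _ _) this
  have hm0 : 0 ≤ m := measureReal_nonneg
  rcases hm0.eq_or_lt with hm0 | hm0
  · have hμ0 : μ univ = 0 := by
      rw [hmdef, eq_comm, measureReal_eq_zero_iff] at hm0
      exact hm0
    have hμz : μ = 0 := Measure.measure_univ_eq_zero.1 hμ0
    subst hμz
    refine ⟨0, Measure.zero_le _, ⟨rfl, rfl, fun k => le_rfl⟩, fun η _ hη => ?_⟩
    have hηz : η = 0 := Measure.measure_univ_eq_zero.1 (by rw [← hη.1]; simp)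
    subst hηz
    exact ⟨rfl, rfl, fun k => le_rfl⟩
  obtain ⟨Q, Qmono, Qm, hνQ⟩ := exists_quantile ν
  rw [← hNdef] at Qmono Qm hνQ
  obtain ⟨d, hd⟩ : ∃ d, m + d = N := ⟨N - m, by ring⟩
  have hd0 : 0 ≤ d := by linarith
  set A : ℝ → Set ℝ := fun s => Ioo 0 N \ Ioo s (s + d) with hA
  have Ameas : ∀ s, MeasurableSet (A s) := fun s => measurableSet_Ioo.diff measurableSet_Ioo
  have Asub : ∀ s, A s ⊆ Ioo 0 N := fun s => sdiff_subset
  have QA : ∀ s, AEMeasurable Q (volume.restrict (A s)) := fun s =>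
    Qm.mono_measure (Measure.restrict_mono (Asub s) le_rfl)
  have sub : ∀ s ∈ Icc 0 m, Ioo s (s + d) ⊆ Ioo 0 N := fun s hs u hu =>
    ⟨lt_of_le_of_lt hs.1 hu.1, by linarith [hu.2, hs.2]⟩
  have Avol : ∀ s ∈ Icc 0 m, volume (A s) = ENNReal.ofReal m := by
    intro s hs
    rw [hA, measure_sdiff (sub s hs) measurableSet_Ioo.nullMeasurableSet (by simp),
      Real.volume_Ioo, Real.volume_Ioo, ← ENNReal.ofReal_sub _ (by linarith)]
    congr 1
    linarith
  set T : ℝ → Measure ℝ := fun s => (volume.restrict (A s)).map Q with hT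
  have Tuniv : ∀ s ∈ Icc 0 m, T s univ = μ univ := by
    intro s hs
    rw [hT, Measure.map_apply_of_aemeasurable (QA s) MeasurableSet.univ, preimage_univ,
      Measure.restrict_apply_univ, Avol s hs, hmdef]
    exact ENNReal.ofReal_toReal (measure_ne_top _ _)
  have Tle : ∀ s, T s ≤ ν := by
    intro s
    rw [Measure.le_iff]
    intro B hB
    rw [hνQ, hT, Measure.map_apply_of_aemeasurable (QA s) hB,
      Measure.map_apply_of_aemeasurable Qm hB]
    exact Measure.restrict_mono (Asub s) le_rfl _
  have Tfin : ∀ s, IsFiniteMeasure (T s) := fun s => isFiniteMeasure_of_le ν (Tle s)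
  have Tint : ∀ s, Integrable (fun x : ℝ => x) (T s) := fun s => hν.mono_measure (Tle s)
  have Qint : IntegrableOn Q (Ioo 0 N) := by
    have h1 := hν
    rw [hνQ, integrable_map_measure continuous_id'.aestronglyMeasurable Qm] at h1
    exact h1
  set G : ℝ → ℝ := fun s => ∫ x, x ∂(T s) with hG
  have Gcont : ContinuousOn G (Icc 0 m) := by
    set R := (Ioo 0 N).indicator Q with hR
    have Rint : Integrable R := (integrable_indicator_iff measurableSet_Ioo).2 Qint
    have c := intervalIntegral.continuous_primitive
      (fun a b => Rint.intervalIntegrable (a := a) (b := b)) 0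
    have c2 : Continuous fun s => (∫ x in Ioo 0 N, Q x) -
        ((∫ x in (0:ℝ)..(s + d), R x) - ∫ x in (0:ℝ)..s, R x) :=
      continuous_const.sub ((c.comp (continuous_id.add continuous_const)).sub c)
    refine c2.continuousOn.congr fun s hs => ?_
    simp only [hG, hT]
    rw [integral_map (QA s) continuous_id'.aestronglyMeasurable, hA,
      setIntegral_sdiff measurableSet_Ioo Qint (sub s hs),
      intervalIntegral.integral_interval_sub_left Rint.intervalIntegrable
        Rint.intervalIntegrable, intervalIntegral.integral_of_le (by linarith),
      integral_Ioc_eq_integral_Ioo]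
    congr 1
    exact setIntegral_congr_fun measurableSet_Ioo fun u hu =>
      (indicator_of_mem (sub s hs hu) Q).symm
  have aff : ∀ s ∈ Icc 0 m, ∀ σ k : ℝ, ∫ x, (σ * x - k) ∂(T s) = σ * G s - k * m := by
    intro s hs σ k
    have := Tfin s
    rw [integral_sub ((Tint s).const_mul σ) (integrable_const k), integral_const_mul]
    simp only [integral_const, smul_eq_mul, Measure.real, Tuniv s hs]
    rw [hmdef, mul_comm k]
    rfl
  have hex : ∃ s ∈ Icc 0 m, G s = ∫ x, x ∂μ := by
    rcases hd0.eq_or_lt with hd0 | hd0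
    · refine ⟨0, ⟨le_rfl, hm0.le⟩, ?_⟩
      have hTν : T 0 = ν := by
        rw [hT, hνQ]
        simp [hA, ← hd0]
      have hmm : m = N := by linarith
      have h1 := mean_le_of_mass_eq hμ hν h hmm 1
      have h2 := mean_le_of_mass_eq hμ hν h hmm (-1)
      simp only [hG, hTν]
      linarith
    · have l0 : (0:ℝ) ∈ Icc 0 m := ⟨le_rfl, hm0.le⟩
      have lm : m ∈ Icc 0 m := ⟨hm0.le, le_rfl⟩
      have md : d ∈ Ioo 0 N := ⟨hd0, by linarith⟩
      have mm : m ∈ Ioo 0 N := ⟨hm0, by linarith⟩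
      have h0 : ∫ x, x ∂μ ≤ G 0 := by
        have h1 := ext_call hμ hν h 1 (Q d)
        rw [← core_eq measurableSet_Ioo (Ameas 0) (Asub 0) Qm hνQ (fun x => 1 * x - Q d)
          (by fun_prop) ?_ ?_, aff 0 l0, ← hmdef] at h1
        · linarith
        · rintro u ⟨hu, hu'⟩
          have : d ≤ u := not_lt.1 fun hc => hu' ⟨hu.1, by linarith⟩
          linarith [Qmono md hu this]
        · rintro u ⟨hu, hu'⟩
          have : u ∈ Ioo 0 (0 + d) := by
            by_contra hc
            exact hu' ⟨hu, hc⟩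
          linarith [Qmono hu md (by linarith [this.2])]
      have h1 : G m ≤ ∫ x, x ∂μ := by
        have h1 := ext_call hμ hν h (-1) (-Q m)
        rw [← core_eq measurableSet_Ioo (Ameas m) (Asub m) Qm hνQ (fun x => (-1) * x - (-Q m))
          (by fun_prop) ?_ ?_, aff m lm, ← hmdef] at h1
        · linarith
        · rintro u ⟨hu, hu'⟩
          have : u ≤ m := not_lt.1 fun hc => hu' ⟨hc, by linarith [hu.2]⟩
          linarith [Qmono hu mm this]
        · rintro u ⟨hu, hu'⟩
          have : u ∈ Ioo m (m + d) := by
            by_contra hc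
            exact hu' ⟨hu, hc⟩
          linarith [Qmono mm hu this.1.le]
      exact intermediate_value_Icc' hm0.le Gcont ⟨h1, h0⟩
  obtain ⟨s, hs, hGs⟩ := hex
  have := Tfin s
  have hk : ∀ k : ℝ, ∃ p q : ℝ, ∫ x, (max (x - k) 0 - (p * x + q)) ∂(T s) =
      ∫ x, max (max (x - k) 0 - (p * x + q)) 0 ∂ν := by
    intro k
    obtain ⟨p, q, h1, h2⟩ := sign_line hm0 hd0 hd Qmono hs.1 hs.2 k
    exact ⟨p, q, core_eq measurableSet_Ioo (Ameas s) (Asub s) Qm hνQ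
      (fun x => max (x - k) 0 - (p * x + q)) (by fun_prop) h1 h2⟩
  refine ⟨T s, Tle s, convexOrder_of hμ hν (Tint s) h (Tuniv s hs).symm hGs.symm hk,
    fun η hη hμη => ?_⟩
  have := isFiniteMeasure_of_le ν hη
  exact convexOrder_of (hν.mono_measure hη) hν (Tint s) (ext_of_le hη)
    (hμη.1.symm.trans (Tuniv s hs).symm) (hμη.2.1.symm.trans hGs.symm) hk
end
end
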